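/- arXiv:1407.7334 — 2 statements merged into one kernel-verified Lean document; each statement's English description precedes it below -/
import Mathlib

section
/- For every α > 0 there exists a function r : (0, ∞) → ℝ, infinitely differentiable on (0, ∞), which satisfies the third-order nonlinear ODE 2s² r'(s) r'''(s) − s² (r''(s))² + 2s r'(s) r''(s) − 4s (r'(s))³ + (2 r(s) − 1/4)(r'(s))² + 1 = 0 for all s > 0, and which satisfies the boundary conditions lim_{s→0⁺} r(s) = (1 − 4α²)/8 and, for some constants M > 0 and s₀ > 0, |r(s) − ((3/2) s^{2/3} − α s^{1/3})| ≤ M for all s ≥ s₀. -/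
open Filter Topology

/-- Maximum principle on the line: a function of at most linear growth satisfying `c g ≤ g''`
wherever it is positive is nonpositive. -/
theorem nonpos_of_mul_le_deriv_deriv {g g' g'' : ℝ → ℝ} {c C : ℝ} (hc : 0 < c)
    (hg : ∀ t, HasDerivAt g (g' t) t) (hg' : ∀ t, HasDerivAt g' (g'' t) t)
    (hC : ∀ t, g t ≤ C * (1 + |t|)) (h : ∀ t, 0 < g t → c * g t ≤ g'' t) (t : ℝ) :
    g t ≤ 0 := by
  by_contra! ht
  have hD : 0 < 2 / c + t ^ 2 := by positivity
  obtain ⟨ε, hε, hεt⟩ : ∃ ε > 0, ε * (2 / c + t ^ 2) < g t :=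
    ⟨g t / (2 * (2 / c + t ^ 2)), by positivity, by
      have : g t / (2 * (2 / c + t ^ 2)) * (2 / c + t ^ 2) = g t / 2 := by field_simp
      linarith⟩
  let f : ℝ → ℝ := fun x => g x - ε * (2 / c + x ^ 2)
  let f' : ℝ → ℝ := fun x => g' x - ε * (2 * x)
  have hf : ∀ x, HasDerivAt f (f' x) x := fun x => by
    have := (hg x).fun_sub ((((hasDerivAt_id x).pow 2).const_add (2 / c)).const_mul ε)
    simpa [f, f'] using this
  have hf' : ∀ x, HasDerivAt f' (g'' x - ε * 2) x := fun x => by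
    have := (hg' x).fun_sub (((hasDerivAt_id x).const_mul 2).const_mul ε)
    simpa [f'] using this
  have hfc : Continuous f := continuous_iff_continuousAt.2 fun x => (hf x).continuousAt
  let R := 1 + 2 * |C| / ε + |t|
  have hR : 0 ≤ 2 * |C| / ε := by positivity
  obtain ⟨x, hx, hmax⟩ := (isCompact_Icc (a := -R) (b := R)).exists_isMaxOn
    ⟨t, by constructor <;> linarith [neg_abs_le t, le_abs_self t]⟩ hfc.continuousOn
  have hft : 0 < f t := by simp only [f]; linarith
  have hfx : 0 < f x := hft.trans_le <| hmax
    ⟨by linarith [neg_abs_le t], by linarith [le_abs_self t]⟩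
  have hglob : ∀ y, f y ≤ f x := fun y => by
    by_cases hy : y ∈ Set.Icc (-R) R
    · exact hmax hy
    · have hyR : R < |y| := by
        by_contra! hcon
        exact hy (abs_le.1 hcon)
      have h1 : 1 ≤ |y| := by linarith [abs_nonneg t]
      have h2 : 2 * |C| ≤ ε * |y| := by
        have : 2 * |C| / ε ≤ |y| := by linarith [abs_nonneg t]
        rwa [div_le_iff₀ hε, mul_comm _ ε] at this
      have h3 : C * (1 + |y|) ≤ ε * y ^ 2 := by
        rw [← sq_abs y]
        nlinarith [le_abs_self C, abs_nonneg C]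
      have : 0 < 2 / c := by positivity
      have : f y ≤ 0 := by simp only [f]; nlinarith [hC y]
      linarith
  have hlm : IsLocalMax f x := Eventually.of_forall hglob
  have hdf : deriv f = f' := funext fun y => (hf y).deriv
  have hpos : 0 < deriv (deriv f) x := by
    rw [hdf, (hf' x).deriv]
    have hgx : ε * (2 / c + x ^ 2) < g x := by simp only [f] at hfx; linarith
    have := h x (lt_trans (by positivity) hgx)
    have h4 : c * (ε * (2 / c + x ^ 2)) = ε * 2 + c * ε * x ^ 2 := by field_simp
    have h5 : 0 ≤ c * ε * x ^ 2 := by positivity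
    nlinarith
  have hmin := isLocalMin_of_deriv_deriv_pos hpos hlm.deriv_eq_zero hfc.continuousAt
  have hconst : f =ᶠ[𝓝 x] fun _ => f x := by
    filter_upwards [hmin] with y hy using le_antisymm (hglob y) hy
  rw [hconst.deriv.deriv_eq] at hpos
  simp at hpos

/-- The equation `a' = -k a + φ` with bounded continuous `φ` has a bounded solution on the line. -/
theorem exists_bounded_solution_first_order {k M : ℝ} (hk : 0 < k) {φ : ℝ → ℝ}
    (hφ : Continuous φ) (hM : ∀ t, |φ t| ≤ M) :
    ∃ a : ℝ → ℝ, (∀ t, HasDerivAt a (-k * a t + φ t) t) ∧ ∀ t, |a t| ≤ M / k := by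
  let ψ : ℝ → ℝ := fun τ => Real.exp (k * τ) * φ τ
  have hψ : Continuous ψ := by fun_prop
  have hbound : ∀ τ, ‖ψ τ‖ ≤ M * Real.exp (k * τ) := fun τ => by
    rw [Real.norm_eq_abs, abs_mul, Real.abs_exp, mul_comm]
    exact mul_le_mul_of_nonneg_right (hM τ) (Real.exp_pos _).le
  have hint : ∀ t, MeasureTheory.IntegrableOn (fun τ => M * Real.exp (k * τ)) (Set.Iic t) :=
    fun t => (integrableOn_exp_mul_Iic hk t).const_mul M
  have hψint : ∀ t, MeasureTheory.IntegrableOn ψ (Set.Iic t) := fun t =>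
    (hint t).mono' hψ.aestronglyMeasurable (Eventually.of_forall hbound)
  let A : ℝ → ℝ := fun t => ∫ τ in Set.Iic t, ψ τ
  have hA : ∀ t, HasDerivAt A (ψ t) t := fun t => by
    have hAeq : A = fun t => A 0 + ∫ τ in (0:ℝ)..t, ψ τ := by
      funext t
      rw [← intervalIntegral.integral_Iic_sub_Iic (hψint 0) (hψint t)]
      simp [A]
    rw [hAeq]
    exact (intervalIntegral.integral_hasDerivAt_right (hψ.intervalIntegrable _ _)
      (hψ.stronglyMeasurableAtFilter _ _) hψ.continuousAt).const_add _
  have hAb : ∀ t, |A t| ≤ M * (Real.exp (k * t) / k) := fun t => by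
    rw [← integral_exp_mul_Iic hk t, ← MeasureTheory.integral_const_mul]
    exact MeasureTheory.norm_integral_le_of_norm_le (hint t) (Eventually.of_forall hbound)
  refine ⟨fun t => Real.exp (-k * t) * A t, fun t => ?_, fun t => ?_⟩
  · have h1 : HasDerivAt (fun t => Real.exp (-k * t)) (Real.exp (-k * t) * (-k)) t := by
      simpa using ((hasDerivAt_id t).const_mul (-k)).exp
    refine (h1.fun_mul (hA t)).congr_deriv ?_
    have : Real.exp (-k * t) * Real.exp (k * t) = 1 := by rw [← Real.exp_add]; simp
    simp only [ψ]
    linear_combination φ t * this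
  · rw [abs_mul, Real.abs_exp]
    calc _ ≤ Real.exp (-k * t) * (M * (Real.exp (k * t) / k)) :=
          mul_le_mul_of_nonneg_left (hAb t) (Real.exp_pos _).le
      _ = M / k * (Real.exp (-k * t) * Real.exp (k * t)) := by ring
      _ = M / k := by rw [← Real.exp_add]; simp

/-- The equation `u'' = k² u - φ` with bounded continuous `φ` has a bounded solution on the line. -/
theorem exists_bounded_solution_second_order {k M : ℝ} (hk : 0 < k) {φ : ℝ → ℝ}
    (hφ : Continuous φ) (hM : ∀ t, |φ t| ≤ M) :
    ∃ u u' : ℝ → ℝ, (∀ t, HasDerivAt u (u' t) t) ∧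
      (∀ t, HasDerivAt u' (k ^ 2 * u t - φ t) t) ∧ ∀ t, |u t| ≤ M / k ^ 2 := by
  obtain ⟨a, ha, hab⟩ := exists_bounded_solution_first_order hk hφ hM
  obtain ⟨b, hb, hbb⟩ := exists_bounded_solution_first_order hk
    (φ := fun t => φ (-t)) (by fun_prop) (fun t => hM (-t))
  have hb' : ∀ t, HasDerivAt (fun t => b (-t)) (k * b (-t) - φ t) t := fun t => by
    refine ((hb (-t)).comp t (hasDerivAt_neg t)).congr_deriv ?_
    rw [neg_neg]; ring
  refine ⟨fun t => (a t + b (-t)) / (2 * k), fun t => (b (-t) - a t) / 2, fun t => ?_,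
    fun t => ?_, fun t => ?_⟩
  · refine (((ha t).fun_add (hb' t)).div_const (2 * k)).congr_deriv ?_
    field_simp; ring
  · refine (((hb' t).fun_sub (ha t)).div_const 2).congr_deriv ?_
    field_simp; ring
  · rw [abs_div, abs_of_pos (by positivity : 0 < 2 * k), div_le_iff₀ (by positivity)]
    calc _ ≤ |a t| + |b (-t)| := abs_add_le _ _
      _ ≤ M / k + M / k := add_le_add (hab t) (hbb (-t))
      _ = _ := by field_simp; ring

/-- A second-order equation whose right-hand side is uniformly increasing and Lipschitz in the
unknown has a bounded solution on the line. -/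
theorem exists_bounded_solution_of_monotone {m K C : ℝ} (hm : 0 < m) (hmK : m ≤ K)
    {F : ℝ → ℝ → ℝ} (hF : Continuous (Function.uncurry F))
    (hlo : ∀ t x y, x ≤ y → m * (y - x) ≤ F t y - F t x)
    (hhi : ∀ t x y, x ≤ y → F t y - F t x ≤ K * (y - x)) (hC : ∀ t, |F t 0| ≤ C) :
    ∃ (w w' : ℝ → ℝ) (B : ℝ), (∀ t, HasDerivAt w (w' t) t) ∧
      (∀ t, HasDerivAt w' (F t (w t)) t) ∧ ∀ t, |w t| ≤ B := by
  have hK : 0 < K := hm.trans_le hmK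
  have hslope : ∀ t x y, |(K * x - F t x) - (K * y - F t y)| ≤ (K - m) * |x - y| := by
    intro t x y
    rcases le_total x y with h | h
    · rw [abs_of_nonpos (sub_nonpos.2 h), abs_le]
      constructor <;> linarith [hlo t x y h, hhi t x y h]
    · rw [abs_of_nonneg (sub_nonneg.2 h), abs_le]
      constructor <;> linarith [hlo t y x h, hhi t y x h]
  have hφc : ∀ v : BoundedContinuousFunction ℝ ℝ, Continuous fun t => K * v t - F t (v t) :=
    fun v => (continuous_const.mul v.continuous).sub
      (hF.comp (continuous_id.prodMk v.continuous))
  have hφb : ∀ (v : BoundedContinuousFunction ℝ ℝ) t,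
      |K * v t - F t (v t)| ≤ (K - m) * ‖v‖ + C := fun v t => by
    have h1 := hslope t (v t) 0
    have h2 : (K - m) * |v t - 0| ≤ (K - m) * ‖v‖ := by
      rw [sub_zero]
      exact mul_le_mul_of_nonneg_left (v.norm_coe_le_norm t) (by linarith)
    have h3 := hC t
    have h4 := abs_add_le ((K * v t - F t (v t)) - (K * 0 - F t 0)) (-F t 0)
    rw [abs_neg] at h4
    have h5 : (K * v t - F t (v t)) - (K * 0 - F t 0) + -F t 0 = K * v t - F t (v t) := by ring
    rw [h5] at h4
    linarith
  have hex := fun v => exists_bounded_solution_second_order (Real.sqrt_pos.2 hK) (hφc v) (hφb v)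
  simp only [Real.sq_sqrt hK.le] at hex
  choose u u' hu hu' hub using hex
  let T : BoundedContinuousFunction ℝ ℝ → BoundedContinuousFunction ℝ ℝ := fun v =>
    BoundedContinuousFunction.ofNormedAddCommGroup (u v)
      (continuous_iff_continuousAt.2 fun t => (hu v t).continuousAt) _ (hub v)
  have hT : ∀ v t, T v t = u v t := fun v t => rfl
  have hle : ∀ v₁ v₂ t, u v₁ t - u v₂ t ≤ (K - m) / K * dist v₁ v₂ := fun v₁ v₂ t => by
    have key := nonpos_of_mul_le_deriv_deriv (C := ‖T v₁‖ + ‖T v₂‖) hK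
      (fun t => ((hu v₁ t).fun_sub (hu v₂ t)).sub_const ((K - m) / K * dist v₁ v₂))
      (fun t => (hu' v₁ t).fun_sub (hu' v₂ t)) (fun t => ?_) (fun t _ => ?_) t
    · linarith
    · have h1 := (abs_le.1 ((T v₁).norm_coe_le_norm t)).2
      have h2 := (abs_le.1 ((T v₂).norm_coe_le_norm t)).1
      rw [hT] at h1 h2
      have h3 : 0 ≤ (K - m) / K * dist v₁ v₂ :=
        mul_nonneg (div_nonneg (by linarith) hK.le) dist_nonneg
      have h4 : 0 ≤ (‖T v₁‖ + ‖T v₂‖) * |t| := by positivity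
      linarith
    · have h1 := (abs_le.1 (hslope t (v₁ t) (v₂ t))).2
      have h2 : |v₁ t - v₂ t| ≤ dist v₁ v₂ := by
        rw [← Real.dist_eq]
        exact BoundedContinuousFunction.dist_coe_le_dist t
      have h3 := mul_le_mul_of_nonneg_left h2 (by linarith : 0 ≤ K - m)
      have h4 : K * ((K - m) / K * dist v₁ v₂) = (K - m) * dist v₁ v₂ := by field_simp
      linarith
  obtain ⟨q, hq⟩ : ∃ q : NNReal, (q : ℝ) = (K - m) / K :=
    ⟨⟨(K - m) / K, div_nonneg (by linarith) hK.le⟩, rfl⟩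
  have hcontr : ContractingWith q T := by
    refine ⟨?_, LipschitzWith.of_dist_le_mul fun v₁ v₂ => ?_⟩
    · rw [← NNReal.coe_lt_coe, hq, NNReal.coe_one, div_lt_one hK]
      linarith
    · refine (BoundedContinuousFunction.dist_le (by positivity)).2 fun t => ?_
      rw [Real.dist_eq, hT, hT]
      have h1 := hle v₂ v₁ t
      rw [dist_comm] at h1
      exact abs_le.2 ⟨by rw [hq]; linarith, by rw [hq]; exact hle v₁ v₂ t⟩
  let v := hcontr.fixedPoint T
  have hv : T v = v := hcontr.fixedPoint_isFixedPt
  have huv : ∀ t, u v t = v t := fun t => by rw [← hT, hv]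
  refine ⟨u v, u' v, ‖T v‖, hu v, fun t => (hu' v t).congr_deriv ?_,
    fun t => (T v).norm_coe_le_norm t⟩
  rw [huv]; ring

/-- The right-hand side of `w'' = e^{2w} - α e^w - e^{t-w}`, the third Painlevé equation for `v(s)`
in the variables `s = e^t`, `v = e^{t-w}`. -/
noncomputable def painleveRHS (α t w : ℝ) : ℝ :=
  Real.exp (2 * w) - α * Real.exp w - Real.exp (t - w)

theorem hasDerivAt_painleveRHS (α t w : ℝ) : HasDerivAt (painleveRHS α t)
    (2 * Real.exp (2 * w) - α * Real.exp w + Real.exp (t - w)) w := by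
  have h1 := ((hasDerivAt_id w).const_mul 2).exp
  have h2 := (Real.hasDerivAt_exp w).const_mul α
  have h3 := ((hasDerivAt_id w).const_sub t).exp
  refine ((h1.fun_sub h2).fun_sub h3).congr_deriv ?_
  simp; ring

theorem continuous_painleveRHS (α : ℝ) :
    Continuous fun p : ℝ × ℝ => painleveRHS α p.1 p.2 := by
  unfold painleveRHS; fun_prop

theorem painleveRHS_le_of_le (α w : ℝ) {t t' : ℝ} (h : t ≤ t') :
    painleveRHS α t' w ≤ painleveRHS α t w := by
  have : Real.exp (t - w) ≤ Real.exp (t' - w) := Real.exp_le_exp.2 (by linarith)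
  unfold painleveRHS; linarith

theorem painleveRHS_log {α : ℝ} (hα : 0 < α) (t : ℝ) :
    painleveRHS α t (Real.log α) = -(Real.exp t / α) := by
  unfold painleveRHS
  rw [two_mul, Real.exp_add, Real.exp_sub, Real.exp_log hα]; ring

theorem abs_painleveRHS_le {α t w T L : ℝ} (hα : 0 < α) (ht : t ≤ T) (hw : Real.log α ≤ w)
    (hwL : w ≤ L) :
    |painleveRHS α t w| ≤
      Real.exp (2 * L) + α * Real.exp L + Real.exp (T - Real.log α) := by
  have h1 : Real.exp (2 * w) ≤ Real.exp (2 * L) := Real.exp_le_exp.2 (by linarith)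
  have h2 : α * Real.exp w ≤ α * Real.exp L :=
    mul_le_mul_of_nonneg_left (Real.exp_le_exp.2 hwL) hα.le
  have h3 : Real.exp (t - w) ≤ Real.exp (T - Real.log α) := Real.exp_le_exp.2 (by linarith)
  have := Real.exp_pos (2 * w)
  have := Real.exp_pos (t - w)
  have : 0 < α * Real.exp w := by positivity
  unfold painleveRHS
  rw [abs_le]
  constructor <;> linarith

theorem sq_mul_sub_le_painleveRHS_sub {α : ℝ} (hα : 0 < α) (t : ℝ) {x y : ℝ}
    (hx : Real.log α ≤ x) (hxy : x ≤ y) :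
    α ^ 2 * (y - x) ≤ painleveRHS α t y - painleveRHS α t x := by
  refine (convex_Ici (Real.log α)).mul_sub_le_image_sub_of_le_deriv
    (fun w _ => (hasDerivAt_painleveRHS α t w).continuousAt.continuousWithinAt)
    (fun w _ => (hasDerivAt_painleveRHS α t w).differentiableAt.differentiableWithinAt)
    (fun w hw => ?_) x hx y (hx.trans hxy) hxy
  rw [(hasDerivAt_painleveRHS α t w).deriv]
  rw [interior_Ici] at hw
  have h1 : α ≤ Real.exp w := (Real.log_le_iff_le_exp hα).1 (le_of_lt hw)
  have h2 := Real.exp_pos (t - w)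
  rw [two_mul w, Real.exp_add]
  nlinarith

theorem painleveRHS_sub_le {α : ℝ} (hα : 0 < α) {t T L x y : ℝ} (ht : t ≤ T)
    (hx : Real.log α ≤ x) (hxy : x ≤ y) (hy : y ≤ L) :
    painleveRHS α t y - painleveRHS α t x ≤
      (2 * Real.exp (2 * L) + Real.exp (T - Real.log α)) * (y - x) := by
  refine (convex_Icc (Real.log α) L).image_sub_le_mul_sub_of_deriv_le
    (fun w _ => (hasDerivAt_painleveRHS α t w).continuousAt.continuousWithinAt)
    (fun w _ => (hasDerivAt_painleveRHS α t w).differentiableAt.differentiableWithinAt)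
    (fun w hw => ?_) x ⟨hx, hxy.trans hy⟩ y ⟨hx.trans hxy, hy⟩ hxy
  rw [(hasDerivAt_painleveRHS α t w).deriv]
  have hw := interior_subset hw
  have h1 : Real.exp (2 * w) ≤ Real.exp (2 * L) := Real.exp_le_exp.2 (by linarith [hw.2])
  have h2 : Real.exp (t - w) ≤ Real.exp (T - Real.log α) :=
    Real.exp_le_exp.2 (by linarith [hw.1])
  have : 0 < α * Real.exp w := by positivity
  linarith

/-- An explicit supersolution of `w'' = painleveRHS α t w`. -/
noncomputable def painleveSuper (α t : ℝ) : ℝ := Real.log (Real.exp (t / 3) + (α + 1))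

theorem exp_painleveSuper {α : ℝ} (hα : 0 < α) (t : ℝ) :
    Real.exp (painleveSuper α t) = Real.exp (t / 3) + (α + 1) :=
  Real.exp_log (by positivity)

theorem log_le_painleveSuper {α : ℝ} (hα : 0 < α) (t : ℝ) : Real.log α ≤ painleveSuper α t :=
  Real.log_le_log hα (by linarith [Real.exp_pos (t / 3)])

theorem painleveSuper_nonneg {α : ℝ} (hα : 0 < α) (t : ℝ) : 0 ≤ painleveSuper α t :=
  Real.log_nonneg (by linarith [Real.exp_pos (t / 3)])

theorem painleveSuper_mono {α : ℝ} (hα : 0 < α) : Monotone (painleveSuper α) := fun s t h =>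
  Real.log_le_log (by positivity)
    (by linarith [Real.exp_le_exp.2 (by linarith : s / 3 ≤ t / 3)])

theorem hasDerivAt_exp_div_three (t : ℝ) :
    HasDerivAt (fun t => Real.exp (t / 3)) (Real.exp (t / 3) / 3) t := by
  simpa [div_eq_mul_inv] using ((hasDerivAt_id t).div_const 3).exp

theorem hasDerivAt_painleveSuper {α : ℝ} (hα : 0 < α) (t : ℝ) : HasDerivAt (painleveSuper α)
    (Real.exp (t / 3) / 3 / (Real.exp (t / 3) + (α + 1))) t :=
  ((hasDerivAt_exp_div_three t).add_const (α + 1)).log (by positivity)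

theorem hasDerivAt_deriv_painleveSuper {α : ℝ} (hα : 0 < α) (t : ℝ) :
    HasDerivAt (fun t => Real.exp (t / 3) / 3 / (Real.exp (t / 3) + (α + 1)))
      ((α + 1) * Real.exp (t / 3) / (9 * (Real.exp (t / 3) + (α + 1)) ^ 2)) t := by
  have h := ((hasDerivAt_exp_div_three t).div_const 3).fun_div
    ((hasDerivAt_exp_div_three t).add_const (α + 1)) (by positivity)
  refine h.congr_deriv ?_
  have : Real.exp (t / 3) + (α + 1) ≠ 0 := by positivity
  field_simp; ring

theorem exp_div_three_pow (t : ℝ) : Real.exp (t / 3) ^ 3 = Real.exp t := by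
  rw [← Real.exp_nat_mul]; congr 1; push_cast; ring

theorem deriv_deriv_painleveSuper_le {α : ℝ} (hα : 0 < α) (t : ℝ) :
    (α + 1) * Real.exp (t / 3) / (9 * (Real.exp (t / 3) + (α + 1)) ^ 2) ≤
      painleveRHS α t (painleveSuper α t) := by
  unfold painleveRHS
  rw [two_mul, Real.exp_add, Real.exp_sub, exp_painleveSuper hα, ← exp_div_three_pow t]
  have hx := Real.exp_pos (t / 3)
  set x := Real.exp (t / 3)
  have hA : 0 < x + (α + 1) := by positivity
  rw [div_le_iff₀ (by positivity)]
  have : ((x + (α + 1)) * (x + (α + 1)) - α * (x + (α + 1)) - x ^ 3 / (x + (α + 1))) *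
      (9 * (x + (α + 1)) ^ 2) =
      9 * (x + (α + 1)) * ((x + (α + 1)) ^ 2 * (x + 1) - x ^ 3) := by
    field_simp; ring
  rw [this]
  have h1 : (α + 1) * x ≤ (x + (α + 1)) ^ 2 * (x + 1) - x ^ 3 := by
    have : (x + (α + 1)) ^ 2 * (x + 1) - x ^ 3 - (α + 1) * x =
      (2 * (α + 1) + 1) * x ^ 2 + ((α + 1) ^ 2 + (α + 1)) * x + (α + 1) ^ 2 := by ring
    have : 0 ≤ (2 * (α + 1) + 1) * x ^ 2 + ((α + 1) ^ 2 + (α + 1)) * x + (α + 1) ^ 2 := by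
      positivity
    linarith
  have h2 : 0 < (α + 1) * x := by positivity
  nlinarith

theorem exists_painleveSuper_sub_log_le {α : ℝ} (hα : 0 < α) :
    ∃ C, 0 ≤ C ∧ ∀ t, painleveSuper α t - Real.log α ≤ C * (1 + |t|) := by
  refine ⟨|Real.log (α + 2)| + |Real.log α| + 1, by positivity, fun t => ?_⟩
  have h1 : painleveSuper α t ≤ Real.log (α + 2) + |t| := by
    rw [← Real.log_exp |t|, ← Real.log_mul (by positivity) (by positivity)]
    refine Real.log_le_log (by positivity) ?_
    have h2 : Real.exp (t / 3) ≤ Real.exp |t| :=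
      Real.exp_le_exp.2 (by linarith [le_abs_self t, abs_nonneg t])
    have h3 : 1 ≤ Real.exp |t| := Real.one_le_exp (abs_nonneg t)
    nlinarith
  have := le_abs_self (Real.log (α + 2))
  have := neg_abs_le (Real.log α)
  have := mul_nonneg (add_nonneg (abs_nonneg (Real.log (α + 2))) (abs_nonneg (Real.log α)))
    (abs_nonneg t)
  linarith

/-- The equation with time capped at `n` has a solution between `log α` and the supersolution. -/
theorem exists_capped_solution {α : ℝ} (hα : 0 < α) (n : ℝ) :
    ∃ w w' : ℝ → ℝ, (∀ t, HasDerivAt w (w' t) t) ∧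
      (∀ t, HasDerivAt w' (painleveRHS α (min t n) (w t)) t) ∧
      (∀ t, Real.log α ≤ w t) ∧ ∀ t, w t ≤ painleveSuper α t := by
  set a := Real.log α with ha
  set L := painleveSuper α n with hL
  have haL : a ≤ L := log_le_painleveSuper hα n
  let c : ℝ → ℝ := fun w => max a (min w L)
  have hcc : Continuous c := by fun_prop
  have hca : ∀ w, a ≤ c w := fun w => le_max_left _ _
  have hcL : ∀ w, c w ≤ L := fun w => max_le haL (min_le_right _ _)
  have hcm : ∀ x y, x ≤ y → c x ≤ c y := fun x y h => by simp only [c]; gcongr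
  have hcd : ∀ x y, x ≤ y → c y - c x ≤ y - x := fun x y h => by
    simp only [c]; grind
  let F : ℝ → ℝ → ℝ := fun t w => painleveRHS α (min t n) (c w) + α ^ 2 * (w - c w)
  have hα2 : 0 < α ^ 2 := by positivity
  have hK : α ^ 2 ≤ 2 * Real.exp (2 * L) + Real.exp (n - a) := by
    have h1 : α ≤ Real.exp L := (Real.log_le_iff_le_exp hα).1 haL
    rw [two_mul L, Real.exp_add]
    nlinarith [Real.exp_pos (n - a)]
  have hF : Continuous (Function.uncurry F) := by
    have := (continuous_painleveRHS α).comp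
      (f := fun p : ℝ × ℝ => (min p.1 n, c p.2)) (by fun_prop)
    exact this.add (by fun_prop)
  have hlo : ∀ t x y, x ≤ y → α ^ 2 * (y - x) ≤ F t y - F t x := fun t x y h => by
    have := sq_mul_sub_le_painleveRHS_sub hα (min t n) (hca x) (hcm x y h)
    simp only [F]; linarith
  have hhi : ∀ t x y, x ≤ y →
      F t y - F t x ≤ (2 * Real.exp (2 * L) + Real.exp (n - a)) * (y - x) := fun t x y h => by
    have h1 := painleveRHS_sub_le hα (min_le_right t n) (hca x) (hcm x y h) (hcL y)
    have h2 := mul_le_mul_of_nonneg_right hK (sub_nonneg.2 (hcd x y h))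
    simp only [F]; linarith
  have hC : ∀ t, |F t 0| ≤
      Real.exp (2 * L) + α * Real.exp L + Real.exp (n - a) + |α ^ 2 * (0 - c 0)| := fun t =>
    (abs_add_le _ _).trans
      (by gcongr; exact abs_painleveRHS_le hα (min_le_right t n) (hca 0) (hcL 0))
  obtain ⟨w, w', B, hw, hw', hB⟩ := exists_bounded_solution_of_monotone hα2 hK hF hlo hhi hC
  have hB0 : 0 ≤ B := (abs_nonneg _).trans (hB 0)
  have hBt : ∀ t, 0 ≤ B * |t| := fun t => by positivity
  have hwa : ∀ t, a ≤ w t := fun t => by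
    have := nonpos_of_mul_le_deriv_deriv (C := |a| + B) hα2 (fun t => (hw t).const_sub a)
      (fun t => (hw' t).fun_neg) (fun t => ?_) (fun t ht => ?_) t
    · linarith
    · have := (abs_le.1 (hB t)).1
      have := le_abs_self a
      have : 0 ≤ |a| * |t| := by positivity
      linarith [hBt t]
    · have hc : c (w t) = a := max_eq_left ((min_le_left _ _).trans (by linarith))
      simp only [F, hc]
      rw [ha, painleveRHS_log hα, ← ha]
      have : 0 < Real.exp (min t n) / α := by positivity
      linarith
  have hwL : ∀ t, w t ≤ L := fun t => by
    have := nonpos_of_mul_le_deriv_deriv (C := |L| + B) hα2 (fun t => (hw t).sub_const L)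
      hw' (fun t => ?_) (fun t ht => ?_) t
    · linarith
    · have := (abs_le.1 (hB t)).2
      have := neg_abs_le L
      have : 0 ≤ |L| * |t| := by positivity
      linarith [hBt t]
    · have hc : c (w t) = L := by
        simp only [c]; rw [min_eq_right (by linarith), max_eq_right haL]
      simp only [F, hc]
      have h1 := painleveRHS_le_of_le α L (min_le_right t n)
      have h2 := deriv_deriv_painleveSuper_le hα n
      have h3 : 0 ≤ (α + 1) * Real.exp (n / 3) / (9 * (Real.exp (n / 3) + (α + 1)) ^ 2) := by
        positivity
      linarith
  have hc : ∀ t, c (w t) = w t := fun t => by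
    simp only [c]; rw [min_eq_left (hwL t), max_eq_right (hwa t)]
  simp only [F, hc, sub_self, mul_zero, add_zero] at hw'
  refine ⟨w, w', hw, hw', hwa, fun t => ?_⟩
  have := nonpos_of_mul_le_deriv_deriv (C := B) hα2
    (fun t => (hw t).fun_sub (hasDerivAt_painleveSuper hα t))
    (fun t => (hw' t).fun_sub (hasDerivAt_deriv_painleveSuper hα t))
    (fun t => ?_) (fun t ht => ?_) t
  · linarith
  · linarith [(abs_le.1 (hB t)).2, painleveSuper_nonneg hα t, hBt t]
  · have h1 := painleveRHS_le_of_le α (w t) (min_le_left t n)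
    have h2 := deriv_deriv_painleveSuper_le hα t
    have h3 := sq_mul_sub_le_painleveRHS_sub hα t (log_le_painleveSuper hα t)
      (by linarith : painleveSuper α t ≤ w t)
    linarith

/-- Pointwise limits of functions with locally uniformly bounded second derivatives may be
differentiated twice under the limit. -/
theorem exists_hasDerivAt_of_tendsto {W W' f : ℕ → ℝ → ℝ} {w g b : ℝ → ℝ}
    (hW : ∀ n t, HasDerivAt (W n) (W' n t) t) (hW' : ∀ n t, HasDerivAt (W' n) (f n t) t)
    (hf : ∀ n, Continuous (f n)) (hb : ∀ n t τ, |τ| ≤ t → |f n τ| ≤ b t)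
    (hw : ∀ t, Tendsto (fun n => W n t) atTop (𝓝 (w t)))
    (hg : ∀ t, Tendsto (fun n => f n t) atTop (𝓝 (g t))) :
    ∃ w' : ℝ → ℝ, (∀ t, HasDerivAt w (w' t) t) ∧
      (Continuous g → ∀ t, HasDerivAt w' (g t) t) := by
  have habs : ∀ t τ : ℝ, τ ∈ Set.uIoc 0 t → |τ| ≤ |t| := fun t τ h => by
    rcases Set.mem_uIoc.1 h with h | h
    · rw [abs_of_pos h.1]; exact h.2.trans (le_abs_self t)
    · rw [abs_of_nonpos h.2]; exact (by linarith [h.1] : -τ ≤ -t).trans (neg_le_abs t)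
  have hgb : ∀ t τ, |τ| ≤ t → |g τ| ≤ b t := fun t τ h =>
    le_of_tendsto (hg τ).abs (Eventually.of_forall fun n => hb n t τ h)
  have hgm : Measurable g :=
    measurable_of_tendsto_metrizable (fun n => (hf n).measurable) (tendsto_pi_nhds.2 hg)
  have hgi0 : ∀ t, IntervalIntegrable g MeasureTheory.volume 0 t := fun t => by
    refine (intervalIntegrable_const (c := b |t|)).mono_fun hgm.aestronglyMeasurable ?_
    refine (MeasureTheory.ae_restrict_iff' measurableSet_uIoc).2 (Eventually.of_forall ?_)
    exact fun τ hτ => (hgb _ _ (habs t τ hτ)).trans (le_abs_self _)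
  have hgi : ∀ s t, IntervalIntegrable g MeasureTheory.volume s t := fun s t =>
    (hgi0 s).symm.trans (hgi0 t)
  let I : ℝ → ℝ := fun t => ∫ τ in (0:ℝ)..t, g τ
  have hI : Continuous I := intervalIntegral.continuous_primitive hgi 0
  have hIn : ∀ n t, W' n t - W' n 0 = ∫ τ in (0:ℝ)..t, f n τ := fun n t =>
    (intervalIntegral.integral_eq_sub_of_hasDerivAt (fun τ _ => hW' n τ)
      ((hf n).intervalIntegrable _ _)).symm
  have hW'c : ∀ n, Continuous (W' n) := fun n =>
    continuous_iff_continuousAt.2 fun t => (hW' n t).continuousAt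
  have hIlim : ∀ t, Tendsto (fun n => W' n t - W' n 0) atTop (𝓝 (I t)) := fun t => by
    simp only [hIn]
    refine intervalIntegral.tendsto_integral_filter_of_dominated_convergence (fun _ => b |t|)
      (Eventually.of_forall fun n => (hf n).aestronglyMeasurable)
      (Eventually.of_forall fun n => Eventually.of_forall fun τ hτ => hb n _ _ (habs t τ hτ))
      intervalIntegrable_const (Eventually.of_forall fun τ _ => hg τ)
  have hJn : ∀ n t, W n t - W n 0 - t * W' n 0 = ∫ τ in (0:ℝ)..t, (W' n τ - W' n 0) :=
    fun n t => by
      rw [intervalIntegral.integral_sub ((hW'c n).intervalIntegrable _ _)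
        intervalIntegrable_const, intervalIntegral.integral_eq_sub_of_hasDerivAt
        (fun τ _ => hW n τ) ((hW'c n).intervalIntegrable _ _)]
      simp
  have hJlim : ∀ t, Tendsto (fun n => W n t - W n 0 - t * W' n 0) atTop
      (𝓝 (∫ τ in (0:ℝ)..t, I τ)) := fun t => by
    simp only [hJn]
    refine intervalIntegral.tendsto_integral_filter_of_dominated_convergence
      (fun _ => b |t| * |t|)
      (Eventually.of_forall fun n => ((hW'c n).sub continuous_const).aestronglyMeasurable)
      (Eventually.of_forall fun n => Eventually.of_forall fun τ hτ => ?_)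
      intervalIntegrable_const (Eventually.of_forall fun τ _ => hIlim τ)
    have hτt := habs t τ hτ
    have h1 : ‖W' n τ - W' n 0‖ ≤ b |t| * |τ - 0| := by
      rw [hIn]
      exact intervalIntegral.norm_integral_le_of_norm_le_const fun x hx =>
        hb n _ _ ((habs τ x hx).trans hτt)
    have h2 : 0 ≤ b |t| := (abs_nonneg _).trans (hb n |t| τ hτt)
    rw [sub_zero] at h1
    exact h1.trans (mul_le_mul_of_nonneg_left hτt h2)
  have hplim : Tendsto (fun n => W' n 0) atTop
      (𝓝 (w 1 - w 0 - ∫ τ in (0:ℝ)..1, I τ)) := by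
    refine (((hw 1).sub (hw 0)).sub (hJlim 1)).congr fun n => ?_
    ring
  set p := w 1 - w 0 - ∫ τ in (0:ℝ)..1, I τ
  have hweq : w = fun t => w 0 + t * p + ∫ τ in (0:ℝ)..t, I τ := by
    funext t
    refine tendsto_nhds_unique (hw t) ((((hw 0).add (hplim.const_mul t)).add (hJlim t)).congr
      fun n => ?_)
    ring
  refine ⟨fun t => p + I t, fun t => ?_, fun hgc t => ?_⟩
  · rw [hweq]
    have h1 := intervalIntegral.integral_hasDerivAt_right (hI.intervalIntegrable 0 t)
      (hI.stronglyMeasurableAtFilter _ _) hI.continuousAt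
    have h2 := ((hasDerivAt_id t).mul_const p).const_add (w 0)
    simpa using h2.fun_add h1
  · exact (intervalIntegral.integral_hasDerivAt_right (hgi 0 t)
      (hgc.stronglyMeasurableAtFilter _ _) hgc.continuousAt).const_add p

/-- The third Painlevé equation in logarithmic variables has a global solution lying between
`log α` and the supersolution. -/
theorem exists_painleve_solution {α : ℝ} (hα : 0 < α) :
    ∃ w w' : ℝ → ℝ, (∀ t, HasDerivAt w (w' t) t) ∧
      (∀ t, HasDerivAt w' (painleveRHS α t (w t)) t) ∧
      (∀ t, Real.log α ≤ w t) ∧ ∀ t, w t ≤ painleveSuper α t := by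
  choose W W' hW hW' hlow hup using fun n : ℕ => exists_capped_solution hα (n : ℝ)
  obtain ⟨C, -, hC⟩ := exists_painleveSuper_sub_log_le hα
  have hmono : ∀ t, Monotone fun n => W n t := fun t n n' hn => by
    have := nonpos_of_mul_le_deriv_deriv (C := C) (by positivity : 0 < α ^ 2)
      (fun t => (hW n t).fun_sub (hW n' t)) (fun t => (hW' n t).fun_sub (hW' n' t))
      (fun t => by linarith [hC t, hup n t, hlow n' t]) (fun t ht => ?_) t
    · simpa using this
    · have h1 := sq_mul_sub_le_painleveRHS_sub hα (min t n') (hlow n' t)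
        (by linarith : W n' t ≤ W n t)
      have h2 := painleveRHS_le_of_le α (W n t)
        (min_le_min_left t (by exact_mod_cast hn : (n : ℝ) ≤ n'))
      linarith
  let w : ℝ → ℝ := fun t => ⨆ n, W n t
  have hw : ∀ t, Tendsto (fun n => W n t) atTop (𝓝 (w t)) := fun t =>
    tendsto_atTop_ciSup (hmono t) ⟨painleveSuper α t, by rintro _ ⟨n, rfl⟩; exact hup n t⟩
  have hWc : ∀ n, Continuous (W n) := fun n =>
    continuous_iff_continuousAt.2 fun t => (hW n t).continuousAt
  have hG := continuous_painleveRHS α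
  have hmin : ∀ t : ℝ, Tendsto (fun n : ℕ => min t n) atTop (𝓝 t) := fun t =>
    tendsto_const_nhds.congr' <| by
      filter_upwards [eventually_ge_atTop ⌈t⌉₊] with n hn
      exact (min_eq_left (Nat.ceil_le.1 hn)).symm
  obtain ⟨w', hd, hd'⟩ := exists_hasDerivAt_of_tendsto
    (f := fun n t => painleveRHS α (min t n) (W n t)) (g := fun t => painleveRHS α t (w t))
    hW hW' (fun n => hG.comp (f := fun t => (min t (n : ℝ), W n t))
      ((continuous_id.min continuous_const).prodMk (hWc n)))
    (fun n t τ hτ => abs_painleveRHS_le hα ((min_le_left τ n).trans ((le_abs_self τ).trans hτ))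
      (hlow n τ) ((hup n τ).trans (painleveSuper_mono hα ((le_abs_self τ).trans hτ))))
    hw (fun t => (hG.tendsto (t, w t)).comp ((hmin t).prodMk_nhds (hw t)))
  have hwc : Continuous w := continuous_iff_continuousAt.2 fun t => (hd t).continuousAt
  exact ⟨w, w', hd, hd' (hG.comp (continuous_id.prodMk hwc)),
    fun t => ge_of_tendsto' (hw t) fun n => hlow n t,
    fun t => le_of_tendsto' (hw t) fun n => hup n t⟩

section Asymptotics

variable {α : ℝ} {w w' : ℝ → ℝ}

theorem div_three_le_of_painleve (hα : 0 < α) (hw : ∀ t, HasDerivAt w (w' t) t)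
    (hw' : ∀ t, HasDerivAt w' (painleveRHS α t (w t)) t) (hlow : ∀ t, Real.log α ≤ w t)
    (t : ℝ) : t / 3 ≤ w t := by
  have := nonpos_of_mul_le_deriv_deriv (C := 1 + |Real.log α|) (by positivity : 0 < α ^ 2)
    (fun t => ((hasDerivAt_id t).div_const 3).fun_sub (hw t))
    (fun t => (hw' t).const_sub (1 / 3)) (fun t => ?_) (fun t ht => ?_) t
  · simpa using this
  · have h1 := le_abs_self t
    have h2 := neg_abs_le (Real.log α)
    have h3 : 0 ≤ |Real.log α| * |t| := by positivity
    have h4 := abs_nonneg t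
    simp only [id]
    linarith [hlow t]
  · simp only [id] at ht ⊢
    have h1 := sq_mul_sub_le_painleveRHS_sub hα t (hlow t) (by linarith : w t ≤ t / 3)
    have h2 : painleveRHS α t (t / 3) ≤ 0 := by
      unfold painleveRHS
      rw [show t - t / 3 = 2 * (t / 3) by ring]
      have : 0 < α * Real.exp (t / 3) := by positivity
      linarith
    linarith

theorem exists_le_exp_of_painleve (hα : 0 < α) (hw : ∀ t, HasDerivAt w (w' t) t)
    (hw' : ∀ t, HasDerivAt w' (painleveRHS α t (w t)) t) (hlow : ∀ t, Real.log α ≤ w t)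
    (hup : ∀ t, w t ≤ painleveSuper α t) :
    ∃ A κ, 0 < κ ∧ ∀ t, w t - Real.log α ≤ A * Real.exp (κ * t) := by
  obtain ⟨C, hC0, hC⟩ := exists_painleveSuper_sub_log_le hα
  obtain ⟨κ, hκ, hκ1, hκ2⟩ : ∃ κ > 0, κ ≤ 1 ∧ κ ≤ α / 2 :=
    ⟨min 1 (α / 2), by positivity, min_le_left _ _, min_le_right _ _⟩
  obtain ⟨A, hA⟩ : ∃ A, A = 2 / α ^ 3 + C + C / κ := ⟨_, rfl⟩
  have hCκ : 0 ≤ C / κ := by positivity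
  have hα3 : 0 < 2 / α ^ 3 := by positivity
  have hA0 : 0 < A := by linarith
  have hexp : ∀ t, HasDerivAt (fun t => A * Real.exp (κ * t)) (A * κ * Real.exp (κ * t)) t :=
    fun t => by
      refine ((((hasDerivAt_id t).const_mul κ).exp).const_mul A).congr_deriv ?_
      simp; ring
  have hexp' : ∀ t, HasDerivAt (fun t => A * κ * Real.exp (κ * t))
      (A * κ ^ 2 * Real.exp (κ * t)) t := fun t => by
    refine ((((hasDerivAt_id t).const_mul κ).exp).const_mul (A * κ)).congr_deriv ?_
    simp; ring
  refine ⟨A, κ, hκ, fun t => ?_⟩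
  have := nonpos_of_mul_le_deriv_deriv (C := C) (by positivity : 0 < α ^ 2)
    (fun t => ((hw t).sub_const (Real.log α)).fun_sub (hexp t))
    (fun t => (hw' t).fun_sub (hexp' t)) (fun t => ?_) (fun t ht => ?_) t
  · linarith
  · have : 0 < A * Real.exp (κ * t) := by positivity
    linarith [hC t, hup t]
  · have ht0 : t < 0 := by
      by_contra! ht0
      have h1 := Real.add_one_le_exp (κ * t)
      have h2 := hC t
      rw [abs_of_nonneg ht0] at h2
      have h3 : A * (κ * t + 1) ≤ A * Real.exp (κ * t) := mul_le_mul_of_nonneg_left h1 hA0.le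
      have h4 : C ≤ A * κ := by
        rw [hA, add_mul, div_mul_cancel₀ _ hκ.ne']
        have : 0 ≤ (2 / α ^ 3 + C) * κ := by positivity
        linarith
      have h5 := mul_le_mul_of_nonneg_right h4 ht0
      linarith [hup t]
    have h1 := sq_mul_sub_le_painleveRHS_sub hα t le_rfl (hlow t)
    rw [painleveRHS_log hα] at h1
    have h2 : Real.exp t ≤ Real.exp (κ * t) := Real.exp_le_exp.2 (by nlinarith)
    have h3 : Real.exp t / α ≤ α ^ 2 / 2 * A * Real.exp (κ * t) := by
      have h4 : 1 / α ≤ α ^ 2 / 2 * A := by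
        have h5 : α ^ 2 / 2 * (2 / α ^ 3) = 1 / α := by field_simp
        have h6 : 0 ≤ α ^ 2 / 2 * (C + C / κ) := by positivity
        rw [hA]; linarith
      calc Real.exp t / α = 1 / α * Real.exp t := by ring
        _ ≤ α ^ 2 / 2 * A * Real.exp (κ * t) := mul_le_mul h4 h2 (Real.exp_pos _).le (by positivity)
    have h7 : κ ^ 2 ≤ α ^ 2 / 2 := by nlinarith
    have h8 := mul_le_mul_of_nonneg_right h7 (by positivity : 0 ≤ A * Real.exp (κ * t))
    linarith

theorem tendsto_atBot_of_painleve (hα : 0 < α) (hw : ∀ t, HasDerivAt w (w' t) t)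
    (hw' : ∀ t, HasDerivAt w' (painleveRHS α t (w t)) t) (hlow : ∀ t, Real.log α ≤ w t)
    (hup : ∀ t, w t ≤ painleveSuper α t) : Tendsto w atBot (𝓝 (Real.log α)) := by
  obtain ⟨A, κ, hκ, hA⟩ := exists_le_exp_of_painleve hα hw hw' hlow hup
  have h1 : Tendsto (fun t => Real.log α + A * Real.exp (κ * t)) atBot (𝓝 (Real.log α)) := by
    have := ((Real.tendsto_exp_atBot.comp (tendsto_id.const_mul_atBot hκ)).const_mul A).const_add
      (Real.log α)
    simpa using this
  exact tendsto_of_tendsto_of_tendsto_of_le_of_le tendsto_const_nhds h1 hlow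
    fun t => by linarith [hA t]

/-- Landau-type bound of a derivative by the increment of the function and a bound on the second
derivative. -/
theorem abs_deriv_mul_le {w'' : ℝ → ℝ} (hw : ∀ t, HasDerivAt w (w' t) t)
    (hw' : ∀ t, HasDerivAt w' (w'' t) t) {t h B : ℝ} (hh : 0 < h)
    (hB : ∀ τ ∈ Set.Icc t (t + h), |w'' τ| ≤ B) :
    |w' t| * h ≤ |w (t + h) - w t| + B * h ^ 2 := by
  obtain ⟨ξ, hξ, hξe⟩ := exists_hasDerivAt_eq_slope w w' (by linarith : t < t + h)
    (fun x _ => (hw x).continuousAt.continuousWithinAt) fun x _ => hw x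
  obtain ⟨η, hη, hηe⟩ := exists_hasDerivAt_eq_slope w' w'' hξ.1
    (fun x _ => (hw' x).continuousAt.continuousWithinAt) fun x _ => hw' x
  rw [add_sub_cancel_left, eq_div_iff hh.ne'] at hξe
  rw [eq_div_iff (by linarith [hξ.1])] at hηe
  have h1 := hB η ⟨hη.1.le, hη.2.le.trans hξ.2.le⟩
  have hξt : 0 < ξ - t := by linarith [hξ.1]
  have hB0 : 0 ≤ B := (abs_nonneg _).trans h1
  have h2 : w' t * h = (w (t + h) - w t) - w'' η * (ξ - t) * h := by
    rw [hηe, ← hξe]; ring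
  have h3 : |w'' η * (ξ - t) * h| ≤ B * h * h := by
    rw [abs_mul, abs_mul, abs_of_pos hξt, abs_of_pos hh]
    gcongr
    linarith [hξ.2]
  calc |w' t| * h = |w' t * h| := by rw [abs_mul, abs_of_pos hh]
    _ ≤ |w (t + h) - w t| + |w'' η * (ξ - t) * h| := by rw [h2]; exact abs_sub _ _
    _ ≤ _ := by nlinarith

theorem tendsto_exp_atBot_of_tendsto (hα : 0 < α) (hlim : Tendsto w atBot (𝓝 (Real.log α))) :
    Tendsto (fun t => Real.exp (2 * w t)) atBot (𝓝 (α ^ 2)) ∧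
      Tendsto (fun t => Real.exp (w t)) atBot (𝓝 α) ∧
      Tendsto (fun t => Real.exp (t - w t)) atBot (𝓝 0) := by
  refine ⟨?_, ?_, Real.tendsto_exp_atBot.comp (by
    simpa [sub_eq_add_neg] using tendsto_id.atBot_add hlim.neg)⟩
  · have := (Real.continuous_exp.tendsto _).comp (hlim.const_mul 2)
    rwa [two_mul, Real.exp_add, Real.exp_log hα, ← sq] at this
  · have := (Real.continuous_exp.tendsto _).comp hlim
    rwa [Real.exp_log hα] at this

theorem tendsto_deriv_atBot_of_painleve (hα : 0 < α) (hw : ∀ t, HasDerivAt w (w' t) t)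
    (hw' : ∀ t, HasDerivAt w' (painleveRHS α t (w t)) t)
    (hlim : Tendsto w atBot (𝓝 (Real.log α))) : Tendsto w' atBot (𝓝 0) := by
  have hG : Tendsto (fun t => painleveRHS α t (w t)) atBot (𝓝 0) := by
    obtain ⟨h1, h2, h3⟩ := tendsto_exp_atBot_of_tendsto hα hlim
    have := (h1.sub (h2.const_mul α)).sub h3
    simpa [painleveRHS, sq] using this
  rw [Metric.tendsto_nhds] at hlim hG ⊢
  intro ε hε
  obtain ⟨T₁, hT₁⟩ := eventually_atBot.1 (hlim (ε / 4) (by positivity))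
  obtain ⟨T₂, hT₂⟩ := eventually_atBot.1 (hG (ε / 4) (by positivity))
  filter_upwards [eventually_le_atBot (min T₁ T₂ - 1)] with t ht
  have h1 := min_le_left T₁ T₂
  have h2 := min_le_right T₁ T₂
  have key := abs_deriv_mul_le hw hw' (t := t) one_pos (B := ε / 4) fun τ hτ => by
    have := (hT₂ τ (by linarith [hτ.2])).le
    rwa [Real.dist_eq, sub_zero] at this
  have h3 := hT₁ t (by linarith)
  have h4 := hT₁ (t + 1) (by linarith)
  rw [Real.dist_eq] at h3 h4 ⊢
  have h5 := abs_sub_le (w (t + 1)) (Real.log α) (w t)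
  rw [abs_sub_comm (Real.log α)] at h5
  rw [sub_zero]
  linarith

theorem painleveSuper_le {t : ℝ} (hα : 0 < α) :
    painleveSuper α t ≤ t / 3 + (α + 1) * Real.exp (-(t / 3)) := by
  have h1 : Real.exp (t / 3) + (α + 1) =
      Real.exp (t / 3) * (1 + (α + 1) * Real.exp (-(t / 3))) := by
    rw [Real.exp_neg]; field_simp
  rw [painleveSuper, h1, Real.log_mul (by positivity) (by positivity), Real.log_exp]
  have := Real.log_le_sub_one_of_pos
    (by positivity : 0 < 1 + (α + 1) * Real.exp (-(t / 3)))
  linarith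

theorem abs_painleveRHS_le_exp {t u : ℝ} (hα : 0 < α) (hu : t / 3 ≤ u)
    (huS : u ≤ painleveSuper α t) :
    |painleveRHS α t u| ≤ (4 * α + 3) * (Real.exp (t / 3) + (α + 1)) := by
  have hy := Real.exp_le_exp.2 huS
  rw [exp_painleveSuper hα] at hy
  have hx := Real.exp_le_exp.2 hu
  have hx0 := Real.exp_pos (t / 3)
  unfold painleveRHS
  rw [two_mul, Real.exp_add, Real.exp_sub, ← exp_div_three_pow t]
  set x := Real.exp (t / 3)
  set y := Real.exp u
  have hy0 : 0 < y := Real.exp_pos u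
  have h1 : y * y - x ^ 3 / y = (y - x) * (y ^ 2 + y * x + x ^ 2) / y := by field_simp; ring
  have h2 : 0 ≤ y * y - x ^ 3 / y := by
    rw [h1]
    have : 0 ≤ y - x := by linarith
    positivity
  have h3 : y * y - x ^ 3 / y ≤ 3 * (α + 1) * y := by
    rw [h1, div_le_iff₀ hy0]
    have h4 : y ^ 2 + y * x + x ^ 2 ≤ 3 * y ^ 2 := by nlinarith
    have h5 : (y - x) * (y ^ 2 + y * x + x ^ 2) ≤ (α + 1) * (3 * y ^ 2) :=
      mul_le_mul (by linarith) h4 (by positivity) (by positivity)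
    linarith
  have h6 : 0 < α * y := by positivity
  have h7 : (4 * α + 3) * y ≤ (4 * α + 3) * (x + (α + 1)) :=
    mul_le_mul_of_nonneg_left hy (by positivity)
  rw [abs_le]
  constructor <;> nlinarith

theorem exists_abs_deriv_le_of_painleve (hα : 0 < α) (hw : ∀ t, HasDerivAt w (w' t) t)
    (hw' : ∀ t, HasDerivAt w' (painleveRHS α t (w t)) t) (hlow : ∀ t, t / 3 ≤ w t)
    (hup : ∀ t, w t ≤ painleveSuper α t) : ∃ M, ∀ t, 0 ≤ t → |w' t| ≤ M := by
  refine ⟨1 / 3 + (α + 1) + (4 * α + 3) * (3 + (α + 1)), fun t ht => ?_⟩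
  obtain ⟨h, hh⟩ : ∃ h, h = Real.exp (-(t / 3)) := ⟨_, rfl⟩
  have hh0 : 0 < h := hh ▸ Real.exp_pos _
  have hh1 : h ≤ 1 := by rw [hh]; exact Real.exp_le_one_iff.2 (by linarith)
  have hx1 : 1 ≤ Real.exp (t / 3) := Real.one_le_exp (by linarith)
  have hhx : Real.exp (t / 3) * h = 1 := by rw [hh, ← Real.exp_add]; simp
  have key := abs_deriv_mul_le hw hw' (t := t) hh0
    (B := (4 * α + 3) * (3 + (α + 1)) * Real.exp (t / 3)) fun τ hτ => by
      refine (abs_painleveRHS_le_exp hα (hlow τ) (hup τ)).trans ?_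
      have h1 : Real.exp (τ / 3) ≤ 3 * Real.exp (t / 3) := by
        calc Real.exp (τ / 3) ≤ Real.exp (1 + t / 3) := Real.exp_le_exp.2 (by linarith [hτ.2])
          _ = Real.exp 1 * Real.exp (t / 3) := Real.exp_add _ _
          _ ≤ _ := by gcongr; exact Real.exp_one_lt_three.le
      rw [mul_assoc]
      gcongr
      nlinarith
  have h2 : |w (t + h) - w t| ≤ (1 / 3 + (α + 1)) * h := by
    have h3 := (hup t).trans (painleveSuper_le hα)
    have h4 := (hup (t + h)).trans (painleveSuper_le hα)
    have h5 : Real.exp (-((t + h) / 3)) ≤ h := by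
      rw [hh]; exact Real.exp_le_exp.2 (by rw [← hh]; linarith)
    have h6 := mul_le_mul_of_nonneg_left h5 (by positivity : 0 ≤ α + 1)
    rw [← hh] at h3
    have := hlow t
    have := hlow (t + h)
    rw [abs_le]
    constructor <;> linarith
  have h7 : (4 * α + 3) * (3 + (α + 1)) * Real.exp (t / 3) * h ^ 2 =
      (4 * α + 3) * (3 + (α + 1)) * h := by
    linear_combination (4 * α + 3) * (3 + (α + 1)) * h * hhx
  rw [h7] at key
  refine le_of_mul_le_mul_right (a := h) ?_ hh0
  linarith

theorem contDiff_of_painleve (hw : ∀ t, HasDerivAt w (w' t) t)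
    (hw' : ∀ t, HasDerivAt w' (painleveRHS α t (w t)) t) :
    ContDiff ℝ (⊤ : ℕ∞) w ∧ ContDiff ℝ (⊤ : ℕ∞) w' := by
  have hdw : deriv w = w' := funext fun t => (hw t).deriv
  have hdw' : deriv w' = fun t => painleveRHS α t (w t) := funext fun t => (hw' t).deriv
  have hind : ∀ n : ℕ, ContDiff ℝ n w ∧ ContDiff ℝ n w' := fun n => by
    induction n with
    | zero =>
      exact ⟨contDiff_zero.2 (continuous_iff_continuousAt.2 fun t => (hw t).continuousAt),
        contDiff_zero.2 (continuous_iff_continuousAt.2 fun t => (hw' t).continuousAt)⟩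
    | succ n ih =>
      have h1 := ih.1
      push_cast
      rw [contDiff_succ_iff_deriv, contDiff_succ_iff_deriv, hdw, hdw']
      refine ⟨⟨fun t => (hw t).differentiableAt, by simp, ih.2⟩,
        fun t => (hw' t).differentiableAt, by simp, ?_⟩
      unfold painleveRHS
      fun_prop
  exact ⟨contDiff_infty.2 fun n => (hind n).1, contDiff_infty.2 fun n => (hind n).2⟩

end Asymptotics

/-- The solution `r` as a function of `t = log s`. -/
noncomputable def painleveEnergy (α : ℝ) (w w' : ℝ → ℝ) (t : ℝ) : ℝ :=
  1 / 8 + Real.exp (t - w t) - w' t ^ 2 / 2 - α * Real.exp (w t) + Real.exp (2 * w t) / 2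

section Energy

variable {α : ℝ} {w w' : ℝ → ℝ}

theorem hasDerivAt_painleveEnergy (hw : ∀ t, HasDerivAt w (w' t) t)
    (hw' : ∀ t, HasDerivAt w' (painleveRHS α t (w t)) t) (t : ℝ) :
    HasDerivAt (painleveEnergy α w w') (Real.exp (t - w t)) t := by
  have h1 := ((hasDerivAt_id t).fun_sub (hw t)).exp
  have h2 := ((hw' t).fun_pow 2).div_const 2
  have h3 := (hw t).exp.const_mul α
  have h4 := ((hw t).const_mul 2).exp.div_const 2
  refine ((((h1.const_add (1 / 8)).fun_sub h2).fun_sub h3).fun_add h4).congr_deriv ?_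
  simp [painleveRHS]; ring

theorem hasDerivAt_painleveEnergy_log (hw : ∀ t, HasDerivAt w (w' t) t)
    (hw' : ∀ t, HasDerivAt w' (painleveRHS α t (w t)) t) {s : ℝ} (hs : 0 < s) :
    HasDerivAt (fun s => painleveEnergy α w w' (Real.log s)) (Real.exp (-w (Real.log s))) s := by
  refine ((hasDerivAt_painleveEnergy hw hw' (Real.log s)).comp s
    (Real.hasDerivAt_log hs.ne')).congr_deriv ?_
  rw [sub_eq_add_neg, Real.exp_add, Real.exp_log hs]
  field_simp

theorem hasDerivAt_exp_neg_log (hw : ∀ t, HasDerivAt w (w' t) t) {s : ℝ} (hs : 0 < s) :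
    HasDerivAt (fun s => Real.exp (-w (Real.log s)))
      (-(Real.exp (-w (Real.log s)) * w' (Real.log s) / s)) s := by
  refine (((hw (Real.log s)).comp s (Real.hasDerivAt_log hs.ne')).fun_neg.exp).congr_deriv ?_
  simp only [Function.comp]
  field_simp

theorem painleveEnergy_ode (hw : ∀ t, HasDerivAt w (w' t) t)
    (hw' : ∀ t, HasDerivAt w' (painleveRHS α t (w t)) t) {r : ℝ → ℝ}
    (hr : r = fun s => painleveEnergy α w w' (Real.log s)) {s : ℝ} (hs : 0 < s) :
    2 * s ^ 2 * deriv r s * deriv (deriv (deriv r)) s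
      - s ^ 2 * (deriv (deriv r) s) ^ 2
      + 2 * s * deriv r s * deriv (deriv r) s
      - 4 * s * (deriv r s) ^ 3
      + (2 * r s - 1 / 4) * (deriv r s) ^ 2 + 1 = 0 := by
  have hd1 : ∀ s > 0, deriv r s = Real.exp (-w (Real.log s)) := fun s hs => by
    rw [hr]; exact (hasDerivAt_painleveEnergy_log hw hw' hs).deriv
  have hd2 : ∀ s > 0, deriv (deriv r) s = -(Real.exp (-w (Real.log s)) * w' (Real.log s) / s) :=
    fun s hs => by
      have : deriv r =ᶠ[𝓝 s] fun s => Real.exp (-w (Real.log s)) := by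
        filter_upwards [lt_mem_nhds hs] with x hx using hd1 x hx
      rw [this.deriv_eq]
      exact (hasDerivAt_exp_neg_log hw hs).deriv
  have hd3 : deriv (deriv (deriv r)) s =
      Real.exp (-w (Real.log s)) * (w' (Real.log s) ^ 2 + w' (Real.log s)
        - painleveRHS α (Real.log s) (w (Real.log s))) / s ^ 2 := by
    have : deriv (deriv r) =ᶠ[𝓝 s]
        fun s => -(Real.exp (-w (Real.log s)) * w' (Real.log s) / s) := by
      filter_upwards [lt_mem_nhds hs] with x hx using hd2 x hx
    rw [this.deriv_eq]
    have h1 := (hw' (Real.log s)).comp s (Real.hasDerivAt_log hs.ne')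
    have h2 := (((hasDerivAt_exp_neg_log hw hs).fun_mul h1).fun_div
      (hasDerivAt_id s) hs.ne').fun_neg
    refine (h2.congr_deriv ?_).deriv
    simp only [Function.comp, id]
    field_simp
    ring
  rw [hd1 s hs, hd2 s hs, hd3, hr]
  simp only [painleveEnergy, painleveRHS]
  rw [two_mul (w (Real.log s)), Real.exp_add, Real.exp_sub, Real.exp_log hs, Real.exp_neg]
  have hy := (Real.exp_pos (w (Real.log s))).ne'
  generalize Real.exp (w (Real.log s)) = y at *
  field_simp
  ring

theorem tendsto_painleveEnergy_atBot (hα : 0 < α)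
    (hlim : Tendsto w atBot (𝓝 (Real.log α))) (hlim' : Tendsto w' atBot (𝓝 0)) :
    Tendsto (painleveEnergy α w w') atBot (𝓝 ((1 - 4 * α ^ 2) / 8)) := by
  obtain ⟨h1, h2, h3⟩ := tendsto_exp_atBot_of_tendsto hα hlim
  have := (((h3.const_add (1 / 8)).sub ((hlim'.pow 2).div_const 2)).sub (h2.const_mul α)).add
    (h1.div_const 2)
  rw [show (1 - 4 * α ^ 2) / 8 = 1 / 8 + 0 - 0 ^ 2 / 2 - α * α + α ^ 2 / 2 by ring]
  exact this

theorem abs_painleveEnergy_sub_le (hα : 0 < α) {t M : ℝ} (hlow : t / 3 ≤ w t)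
    (hup : w t ≤ painleveSuper α t) (hM : |w' t| ≤ M) :
    |painleveEnergy α w w' t - (3 / 2 * Real.exp (t / 3) ^ 2 - α * Real.exp (t / 3))| ≤
      1 / 8 + M ^ 2 / 2 + α * (α + 1) + 3 / 2 * (α + 1) ^ 2 := by
  have hy := Real.exp_le_exp.2 hup
  rw [exp_painleveSuper hα] at hy
  have hx := Real.exp_le_exp.2 hlow
  have hx0 := Real.exp_pos (t / 3)
  have hp : w' t ^ 2 ≤ M ^ 2 := sq_le_sq.2 (hM.trans (le_abs_self M))
  have hp0 := sq_nonneg (w' t)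
  unfold painleveEnergy
  rw [two_mul, Real.exp_add, Real.exp_sub, ← exp_div_three_pow t]
  set x := Real.exp (t / 3)
  have hy0 : 0 < Real.exp (w t) := Real.exp_pos (w t)
  generalize Real.exp (w t) = y at *
  have h1 : x ^ 3 / y + y * y / 2 - 3 / 2 * x ^ 2 = (y - x) ^ 2 * (y + 2 * x) / (2 * y) := by
    field_simp; ring
  have h2 : 0 ≤ (y - x) ^ 2 * (y + 2 * x) / (2 * y) := by positivity
  have h3 : (y - x) ^ 2 * (y + 2 * x) / (2 * y) ≤ 3 / 2 * (α + 1) ^ 2 := by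
    rw [div_le_iff₀ (by positivity)]
    have h4 : (y - x) ^ 2 ≤ (α + 1) ^ 2 := by
      apply pow_le_pow_left₀ <;> linarith
    have h5 : (y - x) ^ 2 * (y + 2 * x) ≤ (α + 1) ^ 2 * (3 * y) :=
      mul_le_mul h4 (by linarith) (by positivity) (by positivity)
    linarith
  have h6 : α * (y - x) ≤ α * (α + 1) := mul_le_mul_of_nonneg_left (by linarith) hα.le
  have h7 : 0 ≤ α * (y - x) := mul_nonneg hα.le (by linarith)
  have h8 : 0 ≤ M ^ 2 := sq_nonneg M
  have h9 : 0 ≤ (α + 1) ^ 2 := sq_nonneg _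
  rw [abs_le]
  constructor <;> nlinarith

end Energy

/-- For every `α > 0` there exists a function `r`, infinitely differentiable
on `(0,∞)`, satisfying the third-order nonlinear ODE
`2s² r' r''' - s² (r'')² + 2s r' r'' - 4s (r')³ + (2r - 1/4)(r')² + 1 = 0` for all `s > 0`,
with `r(s) → (1-4α²)/8` as `s → 0⁺` and `r(s) - ((3/2) s^{2/3} - α s^{1/3})` bounded for
large `s`. -/
theorem exists_painleve_III_solution (α : ℝ) (hα : 0 < α) :
    ∃ r : ℝ → ℝ,
      (∀ s > (0:ℝ), ContDiffAt ℝ (⊤ : ℕ∞) r s) ∧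
      (∀ s > (0:ℝ),
        2 * s ^ 2 * deriv r s * deriv (deriv (deriv r)) s
          - s ^ 2 * (deriv (deriv r) s) ^ 2
          + 2 * s * deriv r s * deriv (deriv r) s
          - 4 * s * (deriv r s) ^ 3
          + (2 * r s - 1 / 4) * (deriv r s) ^ 2 + 1 = 0) ∧
      Tendsto r (𝓝[>] (0:ℝ)) (𝓝 ((1 - 4 * α ^ 2) / 8)) ∧
      (∃ M > (0:ℝ), ∃ s₀ > (0:ℝ), ∀ s ≥ s₀,
        |r s - ((3 / 2) * s ^ ((2:ℝ) / 3) - α * s ^ ((1:ℝ) / 3))| ≤ M) := by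
  obtain ⟨w, w', hw, hw', hlow, hup⟩ := exists_painleve_solution hα
  have hlow' := div_three_le_of_painleve hα hw hw' hlow
  have hlim := tendsto_atBot_of_painleve hα hw hw' hlow hup
  have hlim' := tendsto_deriv_atBot_of_painleve hα hw hw' hlim
  obtain ⟨M, hM⟩ := exists_abs_deriv_le_of_painleve hα hw hw' hlow' hup
  obtain ⟨hsm, hsm'⟩ := contDiff_of_painleve hw hw'
  refine ⟨fun s => painleveEnergy α w w' (Real.log s), fun s hs => ?_,
    fun s hs => painleveEnergy_ode hw hw' rfl hs, ?_,
    1 / 8 + M ^ 2 / 2 + α * (α + 1) + 3 / 2 * (α + 1) ^ 2, by positivity, 1, one_pos,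
    fun s hs => ?_⟩
  · have h1 : ContDiff ℝ (⊤ : ℕ∞) (painleveEnergy α w w') := by
      unfold painleveEnergy
      fun_prop
    exact h1.contDiffAt.comp s (Real.contDiffAt_log.2 hs.ne')
  · exact (tendsto_painleveEnergy_atBot hα hlim hlim').comp Real.tendsto_log_nhdsGT_zero
  · have hs0 : 0 < s := lt_of_lt_of_le one_pos hs
    have h1 : s ^ ((1:ℝ) / 3) = Real.exp (Real.log s / 3) := by
      rw [Real.rpow_def_of_pos hs0]; congr 1; ring
    have h2 : s ^ ((2:ℝ) / 3) = Real.exp (Real.log s / 3) ^ 2 := by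
      rw [Real.rpow_def_of_pos hs0, ← Real.exp_nat_mul]; congr 1; push_cast; ring
    rw [h1, h2]
    exact abs_painleveEnergy_sub_le hα (hlow' _) (hup _) (hM _ (Real.log_nonneg hs))
end

section
/- Fix α > 0 and d > 0. There exist a function r : (0, ∞) → ℝ, infinitely differentiable, satisfying 2s² r' r''' − s² (r'')² + 2s r' r'' − 4s (r')³ + (2r − 1/4)(r')² + 1 = 0 on (0, ∞), with lim_{s→0⁺} r(s) = (1 − 4α²)/8 and r(s) − ((3/2) s^{2/3} − α s^{1/3}) bounded as s → +∞, and constants C > 0 and N ∈ ℕ, such that for every integer n ≥ N and every t ∈ (0, d], writing s = 2nt, the recurrence coefficient satisfies α_n(t) = 2n + α + 1 + (s r'(s)/(2n)) (1 + ε_n(t)) with |ε_n(t)| ≤ C n^{−1/3}. -/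
open MeasureTheory Set Filter Topology

/-- The singularly perturbed Laguerre weight `w(x; t, α) = x^α e^{-x - t/x}`. -/
noncomputable def pertLagWeight (α t x : ℝ) : ℝ := x ^ α * Real.exp (-x - t / x)

/-! ### Moments of the weight -/

/-- The moment `∫₀^∞ x^β e^{-x - t/x} dx`. -/
noncomputable def pertLagMoment (β t : ℝ) : ℝ := ∫ x in Ioi (0 : ℝ), pertLagWeight β t x

lemma pertLagWeight_nonneg (β t : ℝ) {x : ℝ} (hx : 0 < x) : 0 ≤ pertLagWeight β t x := by
  unfold pertLagWeight; positivity

lemma continuousOn_pertLagWeight (β t : ℝ) : ContinuousOn (pertLagWeight β t) (Ioi 0) := by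
  unfold pertLagWeight
  intro x hx
  have hx : x ≠ 0 := ne_of_gt hx
  have := Real.continuousAt_rpow_const x β (Or.inl hx)
  refine (this.mul ?_).continuousWithinAt
  fun_prop (disch := assumption)

lemma aestronglyMeasurable_pertLagWeight (β t : ℝ) :
    AEStronglyMeasurable (pertLagWeight β t) (volume.restrict (Ioi 0)) :=
  (continuousOn_pertLagWeight β t).aestronglyMeasurable measurableSet_Ioi

lemma pertLagWeight_add (β γ t : ℝ) {x : ℝ} (hx : 0 < x) :
    pertLagWeight (β + γ) t x = x ^ β * pertLagWeight γ t x := by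
  unfold pertLagWeight; rw [Real.rpow_add hx]; ring

lemma integrableOn_rpow_mul_exp_neg {β : ℝ} (hβ : -1 < β) :
    IntegrableOn (fun x : ℝ => x ^ β * Real.exp (-x)) (Ioi 0) := by
  have := Real.GammaIntegral_convergent (s := β + 1) (by linarith)
  refine this.congr_fun (fun x _ => ?_) measurableSet_Ioi
  simp [mul_comm]

lemma exp_neg_le_two_div_sq {y : ℝ} (hy : 0 < y) : Real.exp (-y) ≤ 2 / y ^ 2 := by
  rw [Real.exp_neg, inv_eq_one_div, div_le_div_iff₀ (Real.exp_pos y) (by positivity)]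
  nlinarith [Real.quadratic_le_exp_of_nonneg hy.le]

lemma integrableOn_pertLagWeight {β t : ℝ} (hβ : -3 < β) (ht : 0 < t) :
    IntegrableOn (pertLagWeight β t) (Ioi 0) := by
  have h := (integrableOn_rpow_mul_exp_neg (β := β + 2) (by linarith)).const_mul (2 / t ^ 2)
  refine Integrable.mono' h (aestronglyMeasurable_pertLagWeight β t) ?_
  refine (ae_restrict_iff' measurableSet_Ioi).2 (Eventually.of_forall fun x hx => ?_)
  have hx : 0 < x := hx
  rw [Real.norm_of_nonneg (pertLagWeight_nonneg β t hx)]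
  have h1 := exp_neg_le_two_div_sq (y := t / x) (by positivity)
  have h2 : (2 : ℝ) / (t / x) ^ 2 = 2 / t ^ 2 * x ^ (2 : ℝ) := by
    rw [Real.rpow_two]; field_simp
  rw [h2] at h1
  unfold pertLagWeight
  rw [sub_eq_add_neg, Real.exp_add, Real.rpow_add hx]
  calc x ^ β * (Real.exp (-x) * Real.exp (-(t / x)))
      ≤ x ^ β * (Real.exp (-x) * (2 / t ^ 2 * x ^ (2 : ℝ))) := by gcongr
    _ = _ := by ring

lemma pertLagWeight_le {β t x : ℝ} (ht : 0 < t) (hx : 0 < x) :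
    pertLagWeight β t x ≤ x ^ β * Real.exp (-x) := by
  unfold pertLagWeight
  gcongr
  have : 0 < t / x := by positivity
  linarith

lemma hasDerivAt_pertLagMoment {β t : ℝ} (hβ : 0 < β) (ht : 0 < t) :
    HasDerivAt (pertLagMoment β) (-pertLagMoment (β - 1) t) t := by
  have key := (hasDerivAt_integral_of_dominated_loc_of_deriv_le
    (μ := volume.restrict (Ioi (0 : ℝ))) (𝕜 := ℝ) (s := Ioi 0) (x₀ := t)
    (F := fun τ x => pertLagWeight β τ x) (F' := fun τ x => -pertLagWeight (β - 1) τ x)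
    (bound := fun x => x ^ (β - 1) * Real.exp (-x)) (Ioi_mem_nhds ht)
    (Eventually.of_forall fun τ => aestronglyMeasurable_pertLagWeight β τ)
    (integrableOn_pertLagWeight (by linarith) ht)
    (aestronglyMeasurable_pertLagWeight (β - 1) t).neg ?_
    (integrableOn_rpow_mul_exp_neg (by linarith)) ?_).2
  · rw [integral_neg] at key
    exact key
  · refine (ae_restrict_iff' measurableSet_Ioi).2 (Eventually.of_forall fun x hx τ hτ => ?_)
    rw [norm_neg, Real.norm_of_nonneg (pertLagWeight_nonneg _ _ hx)]
    exact pertLagWeight_le hτ hx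
  · refine (ae_restrict_iff' measurableSet_Ioi).2 (Eventually.of_forall fun x hx τ _ => ?_)
    have hx : 0 < x := hx
    have h1 : HasDerivAt (fun τ : ℝ => -x - τ / x) (-(1 / x)) τ := by
      simpa using ((hasDerivAt_id τ).div_const x).const_sub (-x)
    have h2 := h1.exp.const_mul (x ^ β)
    unfold pertLagWeight
    refine h2.congr_deriv ?_
    rw [Real.rpow_sub_one hx.ne']
    field_simp

lemma pertLagMoment_integration_by_parts {β t : ℝ} (hβ : 0 < β) (ht : 0 < t) :
    β * pertLagMoment (β - 1) t - pertLagMoment β t + t * pertLagMoment (β - 2) t = 0 := by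
  have hi0 := integrableOn_pertLagWeight (β := β) (by linarith) ht
  have hi1 := integrableOn_pertLagWeight (β := β - 1) (by linarith) ht
  have hi2 := integrableOn_pertLagWeight (β := β - 2) (by linarith) ht
  have hi01 : IntegrableOn (fun x => β * pertLagWeight (β - 1) t x - pertLagWeight β t x) (Ioi 0) :=
    (hi1.const_mul β).sub hi0
  have h := integral_Ioi_of_hasDerivAt_of_tendsto (f := pertLagWeight β t) (a := 0) (m := 0)
    (f' := fun x => β * pertLagWeight (β - 1) t x - pertLagWeight β t x
      + t * pertLagWeight (β - 2) t x) ?_ ?_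
      (hi01.add (hi2.const_mul t)) ?_
  · rw [integral_add hi01 (hi2.const_mul t),
      integral_sub (hi1.const_mul β) hi0, integral_const_mul, integral_const_mul] at h
    unfold pertLagMoment
    rw [h]
    simp [pertLagWeight, Real.zero_rpow hβ.ne']
  · have h0 : pertLagWeight β t 0 = 0 := by simp [pertLagWeight, Real.zero_rpow hβ.ne']
    rw [ContinuousWithinAt, h0]
    have hup : Tendsto (fun x : ℝ => x ^ β) (𝓝[Ici 0] 0) (𝓝 0) := by
      have := (Real.continuousAt_rpow_const 0 β (Or.inr hβ.le)).tendsto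
      rw [Real.zero_rpow hβ.ne'] at this
      exact this.mono_left nhdsWithin_le_nhds
    refine squeeze_zero_norm' ?_ hup
    filter_upwards [self_mem_nhdsWithin] with x hx
    rcases eq_or_lt_of_le (mem_Ici.1 hx) with rfl | hx
    · simp [h0, Real.zero_rpow hβ.ne']
    · rw [Real.norm_of_nonneg (pertLagWeight_nonneg _ _ hx)]
      refine (pertLagWeight_le ht hx).trans ?_
      exact mul_le_of_le_one_right (by positivity) (Real.exp_le_one_iff.2 (by linarith))
  · intro x hx
    have hx : 0 < x := hx
    have h1 : HasDerivAt (fun x : ℝ => -x - t / x) (-1 + t / x ^ 2) x := by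
      have := (hasDerivAt_id x).neg.sub ((hasDerivAt_inv hx.ne').const_mul t)
      simp only [div_eq_mul_inv]
      refine this.congr_deriv ?_
      ring
    have h2 := (Real.hasDerivAt_rpow_const (x := x) (p := β) (Or.inl hx.ne')).mul h1.exp
    unfold pertLagWeight
    refine h2.congr_deriv ?_
    rw [Real.rpow_sub_one hx.ne', Real.rpow_sub hx, Real.rpow_two]
    field_simp
    ring
  · have h := tendsto_rpow_mul_exp_neg_mul_atTop_nhds_zero β 1 one_pos
    refine squeeze_zero_norm' ?_ h
    filter_upwards [eventually_gt_atTop 0] with x hx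
    rw [Real.norm_of_nonneg (pertLagWeight_nonneg _ _ hx)]
    simpa using pertLagWeight_le (β := β) ht hx

/-! ### The moment functional on polynomials -/

/-- The linear functional `p ↦ ∫₀^∞ p(x) x^β e^{-x - t/x} dx`, defined through the moments. -/
noncomputable def pertLagFunctional (β t : ℝ) : Polynomial ℝ →ₗ[ℝ] ℝ :=
  Polynomial.lsum fun i => pertLagMoment (β + i) t • LinearMap.id

lemma pertLagFunctional_monomial (β t : ℝ) (i : ℕ) (a : ℝ) :
    pertLagFunctional β t (Polynomial.monomial i a) = pertLagMoment (β + i) t * a := by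
  simp [pertLagFunctional, Polynomial.lsum_apply, Polynomial.sum_monomial_index]

lemma pertLagFunctional_X_mul (β t : ℝ) (p : Polynomial ℝ) :
    pertLagFunctional β t (Polynomial.X * p) = pertLagFunctional (β + 1) t p := by
  induction p using Polynomial.induction_on' with
  | add p q hp hq => rw [mul_add, map_add, map_add, hp, hq]
  | monomial i a =>
    rw [Polynomial.X_mul_monomial, pertLagFunctional_monomial, pertLagFunctional_monomial]
    push_cast
    ring_nf

lemma pertLagFunctional_integration_by_parts {β t : ℝ} (hβ : 0 < β) (ht : 0 < t)
    (p : Polynomial ℝ) :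
    pertLagFunctional β t (Polynomial.derivative p) + β * pertLagFunctional (β - 1) t p
      - pertLagFunctional β t p + t * pertLagFunctional (β - 2) t p = 0 := by
  induction p using Polynomial.induction_on' with
  | add p q hp hq =>
    simp only [map_add]
    linear_combination hp + hq
  | monomial i a =>
    have h := pertLagMoment_integration_by_parts (β := β + i) (t := t) (by positivity) ht
    rw [Polynomial.derivative_monomial]
    simp only [pertLagFunctional_monomial]
    rw [show β - 1 + (i : ℝ) = β + i - 1 by ring, show β - 2 + (i : ℝ) = β + i - 2 by ring]
    rcases i with _ | i
    · push_cast at h ⊢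
      linear_combination a * h
    · rw [Nat.add_sub_cancel, show β + (i : ℝ) = β + ((i + 1 : ℕ) : ℝ) - 1 by push_cast; ring]
      push_cast at h ⊢
      linear_combination a * h

lemma integrableOn_eval_mul_pertLagWeight {β t : ℝ} (hβ : -3 < β) (ht : 0 < t)
    (p : Polynomial ℝ) :
    IntegrableOn (fun x => p.eval x * pertLagWeight β t x) (Ioi 0) ∧
      ∫ x in Ioi (0 : ℝ), p.eval x * pertLagWeight β t x = pertLagFunctional β t p := by
  induction p using Polynomial.induction_on' with
  | add p q hp hq =>
    simp only [Polynomial.eval_add, add_mul, map_add]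
    exact ⟨hp.1.add hq.1, by rw [integral_add hp.1 hq.1, hp.2, hq.2]⟩
  | monomial i a =>
    have hi : (0 : ℝ) ≤ i := by positivity
    have h := integrableOn_pertLagWeight (β := β + i) (t := t) (by linarith) ht
    have heq : EqOn (fun x => a * pertLagWeight (β + i) t x)
        (fun x => (Polynomial.monomial i a).eval x * pertLagWeight β t x) (Ioi 0) := by
      intro x hx
      simp only [Polynomial.eval_monomial]
      rw [add_comm β, pertLagWeight_add _ _ _ hx, Real.rpow_natCast]
      ring
    refine ⟨IntegrableOn.congr_fun (h.const_mul a) heq measurableSet_Ioi, ?_⟩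
    rw [← setIntegral_congr_fun measurableSet_Ioi heq, integral_const_mul,
      pertLagFunctional_monomial, mul_comm]
    rfl

lemma pertLagFunctional_nonneg {β t : ℝ} (hβ : -3 < β) (ht : 0 < t) {p : Polynomial ℝ}
    (hp : ∀ x > (0 : ℝ), 0 ≤ p.eval x) : 0 ≤ pertLagFunctional β t p := by
  rw [← (integrableOn_eval_mul_pertLagWeight hβ ht p).2]
  exact setIntegral_nonneg measurableSet_Ioi fun x hx =>
    mul_nonneg (hp x hx) (pertLagWeight_nonneg _ _ hx)

lemma hasDerivAt_pertLagFunctional {β t : ℝ} (hβ : 0 < β) (ht : 0 < t) (p : Polynomial ℝ) :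
    HasDerivAt (fun τ => pertLagFunctional β τ p) (-pertLagFunctional (β - 1) t p) t := by
  induction p using Polynomial.induction_on' with
  | add p q hp hq =>
    simp only [map_add]
    exact (hp.add hq).congr_deriv (by ring)
  | monomial i a =>
    simp only [pertLagFunctional_monomial]
    have := (hasDerivAt_pertLagMoment (β := β + i) (t := t) (by positivity) ht).mul_const a
    exact this.congr_deriv (by rw [show β - 1 + (i : ℝ) = β + i - 1 by ring]; ring)

/-! ### Orthogonal polynomials -/

/-- `Q` is a sequence of monic orthogonal polynomials for the functional `L`,
with squared norms `h`. -/
structure IsMonicOrthogonal (L : Polynomial ℝ →ₗ[ℝ] ℝ) (Q : ℕ → Polynomial ℝ) (h : ℕ → ℝ) :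
    Prop where
  monic : ∀ n, (Q n).Monic
  natDegree : ∀ n, (Q n).natDegree = n
  orth : ∀ j k, L (Q j * Q k) = if j = k then h j else 0
  pos : ∀ n, 0 < h n

namespace IsMonicOrthogonal

variable {L : Polynomial ℝ →ₗ[ℝ] ℝ} {Q : ℕ → Polynomial ℝ} {h : ℕ → ℝ}

lemma coeff_self (H : IsMonicOrthogonal L Q h) (n : ℕ) : (Q n).coeff n = 1 := by
  have := (H.monic n).coeff_natDegree
  rwa [H.natDegree] at this

lemma coeff_of_lt (H : IsMonicOrthogonal L Q h) {n k : ℕ} (hk : n < k) : (Q n).coeff k = 0 :=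
  Polynomial.coeff_eq_zero_of_natDegree_lt (by rwa [H.natDegree])

lemma map_mul_of_natDegree_lt (H : IsMonicOrthogonal L Q h) (n : ℕ) :
    ∀ m ≤ n, ∀ f : Polynomial ℝ, f.degree < m → L (Q n * f) = 0 := by
  intro m
  induction m with
  | zero =>
    intro _ f hf
    have : f = 0 := by
      rw [← Polynomial.degree_eq_bot]
      simpa using hf
    simp [this]
  | succ m ih =>
    intro hm f hf
    have hd : (f - Polynomial.C (f.coeff m) * Q m).degree < m := by
      rw [Polynomial.degree_lt_iff_coeff_zero] at hf ⊢
      intro k hk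
      rw [Polynomial.coeff_sub, Polynomial.coeff_C_mul]
      rcases eq_or_lt_of_le hk with rfl | hk
      · simp [H.coeff_self]
      · rw [hf k hk, H.coeff_of_lt hk]
        ring
    have h1 := ih (by omega) _ hd
    rw [mul_sub, map_sub, mul_left_comm, ← Polynomial.smul_eq_C_mul, map_smul, H.orth,
      if_neg (by omega)] at h1
    simpa using h1

lemma map_mul (H : IsMonicOrthogonal L Q h) {n : ℕ} {f : Polynomial ℝ} (hf : f.natDegree ≤ n) :
    L (Q n * f) = f.coeff n * h n := by
  have hd : (f - Polynomial.C (f.coeff n) * Q n).degree < n := by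
    rw [Polynomial.degree_lt_iff_coeff_zero]
    intro k hk
    rw [Polynomial.coeff_sub, Polynomial.coeff_C_mul]
    rcases eq_or_lt_of_le hk with rfl | hk
    · simp [H.coeff_self]
    · rw [Polynomial.coeff_eq_zero_of_natDegree_lt (lt_of_le_of_lt hf hk),
        H.coeff_of_lt hk]
      ring
  have h1 := H.map_mul_of_natDegree_lt n n le_rfl _ hd
  rw [mul_sub, map_sub, mul_left_comm, ← Polynomial.smul_eq_C_mul, map_smul, H.orth,
    if_pos rfl, smul_eq_mul] at h1
  linarith

lemma map_mul_of_lt (H : IsMonicOrthogonal L Q h) {n : ℕ} {f : Polynomial ℝ}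
    (hf : f.natDegree < n) : L (Q n * f) = 0 := by
  rw [H.map_mul hf.le, Polynomial.coeff_eq_zero_of_natDegree_lt hf, zero_mul]

/-- The Gram–Schmidt formula. -/
lemma eq_X_pow_sub (H : IsMonicOrthogonal L Q h) (n : ℕ) :
    Q n = Polynomial.X ^ n
      - ∑ k ∈ Finset.range n, Polynomial.C (L (Q k * Polynomial.X ^ n) / h k) * Q k := by
  set S := ∑ k ∈ Finset.range n, Polynomial.C (L (Q k * Polynomial.X ^ n) / h k) * Q k with hS
  set D := Polynomial.X ^ n - S - Q n with hD
  have hSn : ∀ i, n ≤ i → S.coeff i = 0 := by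
    intro i hi
    rw [hS, Polynomial.finsetSum_coeff]
    refine Finset.sum_eq_zero fun k hk => ?_
    rw [Polynomial.coeff_C_mul, H.coeff_of_lt (lt_of_lt_of_le (Finset.mem_range.1 hk) hi),
      mul_zero]
  have hDn : ∀ i, n ≤ i → D.coeff i = 0 := by
    intro i hi
    rw [hD, Polynomial.coeff_sub, Polynomial.coeff_sub, hSn i hi, Polynomial.coeff_X_pow]
    rcases eq_or_lt_of_le hi with rfl | hi
    · simp [H.coeff_self]
    · rw [H.coeff_of_lt hi, if_neg (by omega)]
      ring
  have hor : ∀ m < n, L (Q m * D) = 0 := by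
    intro m hm
    have h1 : L (Q m * S) = L (Q m * Polynomial.X ^ n) := by
      rw [hS, Finset.mul_sum, map_sum, Finset.sum_eq_single m]
      · rw [mul_left_comm, ← Polynomial.smul_eq_C_mul, map_smul, H.orth, if_pos rfl, smul_eq_mul]
        field_simp [(H.pos m).ne']
      · intro k _ hk
        rw [mul_left_comm, ← Polynomial.smul_eq_C_mul, map_smul, H.orth, if_neg (Ne.symm hk),
          smul_zero]
      · intro hk
        exact absurd (Finset.mem_range.2 hm) hk
    rw [hD, mul_sub, mul_sub, map_sub, map_sub, h1, H.orth, if_neg (by omega)]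
    ring
  have hD0 : D = 0 := by
    by_contra hne
    have hlt : D.natDegree < n := by
      by_contra hge
      exact hne (Polynomial.leadingCoeff_eq_zero.1 (hDn _ (not_lt.1 hge)))
    have h1 := H.map_mul (n := D.natDegree) (f := D) le_rfl
    rw [hor _ hlt] at h1
    rcases mul_eq_zero.1 h1.symm with h2 | h2
    · exact hne (Polynomial.leadingCoeff_eq_zero.1 h2)
    · exact (H.pos _).ne' h2
  rw [← sub_eq_zero, ← neg_eq_zero, ← hD0, hD]
  ring

end IsMonicOrthogonal

/-! ### Algebraic identities at a fixed parameter -/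

namespace IsMonicOrthogonal

variable {α t : ℝ} {Q : ℕ → Polynomial ℝ} {h : ℕ → ℝ}

lemma natDegree_derivative_le (H : IsMonicOrthogonal (pertLagFunctional α t) Q h) (n : ℕ) :
    (Polynomial.X * Polynomial.derivative (Q n)).natDegree ≤ n := by
  rcases n with _ | n
  · have : Q 0 = 1 := Polynomial.eq_one_of_monic_natDegree_zero (H.monic 0) (H.natDegree 0)
    simp [this]
  · refine Polynomial.natDegree_mul_le.trans ?_
    have := Polynomial.natDegree_derivative_le (Q (n + 1))
    rw [H.natDegree] at this
    have := Polynomial.natDegree_X_le (R := ℝ)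
    omega

lemma coeff_X_mul_derivative (p : Polynomial ℝ) (n : ℕ) :
    (Polynomial.X * Polynomial.derivative p).coeff n = n * p.coeff n := by
  rcases n with _ | n
  · simp
  · rw [Polynomial.coeff_X_mul, Polynomial.coeff_derivative]
    push_cast; ring

lemma functional_X_mul_sq (H : IsMonicOrthogonal (pertLagFunctional α t) Q h) (hα : 0 < α)
    (ht : 0 < t) (n : ℕ) :
    pertLagFunctional α t (Polynomial.X * (Q n * Q n))
      = (2 * n + 1 + α) * h n + t * pertLagFunctional (α - 1) t (Q n * Q n) := by
  have h1 := pertLagFunctional_integration_by_parts (β := α + 1) (by linarith) ht (Q n * Q n)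
  rw [← pertLagFunctional_X_mul, ← pertLagFunctional_X_mul, show α + 1 - 1 = α by ring,
    show α + 1 - 2 = α - 1 by ring, Polynomial.derivative_mul, H.orth, if_pos rfl] at h1
  have h2 := H.map_mul (H.natDegree_derivative_le n)
  rw [coeff_X_mul_derivative, H.coeff_self] at h2
  have h3 : Polynomial.X * (Polynomial.derivative (Q n) * Q n + Q n * Polynomial.derivative (Q n))
      = (2 : ℝ) • (Q n * (Polynomial.X * Polynomial.derivative (Q n))) := by
    rw [two_smul]; ring
  rw [h3, map_smul, h2, smul_eq_mul] at h1
  linarith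

lemma functional_sq_relation (H : IsMonicOrthogonal (pertLagFunctional α t) Q h) (hα : 0 < α)
    (ht : 0 < t) (n : ℕ) :
    α * pertLagFunctional (α - 1) t (Q n * Q n) + t * pertLagFunctional (α - 2) t (Q n * Q n)
      = h n := by
  have h1 := pertLagFunctional_integration_by_parts hα ht (Q n * Q n)
  rw [Polynomial.derivative_mul, mul_comm _ (Q n), ← two_smul ℝ, map_smul, H.orth,
    if_pos rfl] at h1
  have h2 : pertLagFunctional α t (Q n * Polynomial.derivative (Q n)) = 0 := by
    rcases n with _ | n
    · have : Q 0 = 1 := Polynomial.eq_one_of_monic_natDegree_zero (H.monic 0) (H.natDegree 0)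
      simp [this]
    · refine H.map_mul_of_lt ?_
      have := Polynomial.natDegree_derivative_le (Q (n + 1))
      rw [H.natDegree] at this
      omega
  rw [h2, smul_zero] at h1
  linarith

lemma functional_mul_succ (H : IsMonicOrthogonal (pertLagFunctional α t) Q h) (hα : 0 < α)
    (ht : 0 < t) (n : ℕ) :
    t * pertLagFunctional (α - 1) t (Q (n + 1) * Q n) = (Q (n + 1)).coeff n * h n + h (n + 1) := by
  have h1 := pertLagFunctional_integration_by_parts (β := α + 1) (by linarith) ht
    (Q (n + 1) * Q n)
  rw [← pertLagFunctional_X_mul, ← pertLagFunctional_X_mul, show α + 1 - 1 = α by ring,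
    show α + 1 - 2 = α - 1 by ring, Polynomial.derivative_mul, H.orth, if_neg (by omega)] at h1
  set E := Polynomial.X * Polynomial.derivative (Q (n + 1)) - ((n : ℝ) + 1) • Q (n + 1) with hE
  have hEn : E.natDegree ≤ n := by
    rw [Polynomial.natDegree_le_iff_coeff_eq_zero]
    intro k hk
    rw [hE, Polynomial.coeff_sub, coeff_X_mul_derivative, Polynomial.coeff_smul, smul_eq_mul]
    rcases eq_or_lt_of_le (Nat.succ_le_of_lt hk) with rfl | hk
    · push_cast; ring
    · rw [H.coeff_of_lt hk]; ring
  have h2 := H.map_mul hEn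
  have hEc : E.coeff n = -(Q (n + 1)).coeff n := by
    rw [hE, Polynomial.coeff_sub, coeff_X_mul_derivative, Polynomial.coeff_smul, smul_eq_mul]
    ring
  have h3 := H.map_mul_of_lt (Nat.lt_succ_of_le (H.natDegree_derivative_le n))
  have h4 := H.map_mul (n := n + 1) (f := Polynomial.X * Q n) (by
    refine Polynomial.natDegree_mul_le.trans ?_
    rw [H.natDegree]
    have := Polynomial.natDegree_X_le (R := ℝ)
    omega)
  rw [Polynomial.coeff_X_mul, H.coeff_self, mul_left_comm] at h4
  have h5 : Polynomial.X * (Polynomial.derivative (Q (n + 1)) * Q n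
      + Q (n + 1) * Polynomial.derivative (Q n))
      = Q n * E + ((n : ℝ) + 1) • (Q (n + 1) * Q n)
        + Q (n + 1) * (Polynomial.X * Polynomial.derivative (Q n)) := by
    rw [hE, mul_sub, mul_smul_comm, mul_comm (Q n) (Q (n + 1))]
    ring
  rw [h5, map_add, map_add, map_smul, H.orth, if_neg (by omega), h2, h3, h4, hEc] at h1
  simp only [smul_zero] at h1
  linarith

lemma functional_mul_succ_relation (H : IsMonicOrthogonal (pertLagFunctional α t) Q h)
    (hα : 0 < α) (ht : 0 < t) (n : ℕ) :
    (n + 1) * h n + α * pertLagFunctional (α - 1) t (Q (n + 1) * Q n)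
      + t * pertLagFunctional (α - 2) t (Q (n + 1) * Q n) = 0 := by
  have h1 := pertLagFunctional_integration_by_parts hα ht (Q (n + 1) * Q n)
  rw [Polynomial.derivative_mul, map_add, H.orth, if_neg (by omega)] at h1
  have hd := Polynomial.natDegree_derivative_le (Q (n + 1))
  have hd' := Polynomial.natDegree_derivative_le (Q n)
  rw [H.natDegree] at hd hd'
  have h2 := H.map_mul (n := n) (f := Polynomial.derivative (Q (n + 1))) (by omega)
  rw [Polynomial.coeff_derivative, H.coeff_self, mul_comm] at h2
  have h3 := H.map_mul_of_lt (n := n + 1) (f := Polynomial.derivative (Q n)) (by omega)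
  rw [h2, h3] at h1
  linarith

lemma functional_sub_one_mul (f g : Polynomial ℝ) :
    pertLagFunctional (α - 1) t (f * g)
      = g.coeff 0 * pertLagFunctional (α - 1) t f + pertLagFunctional α t (f * g.divX) := by
  conv_lhs => rw [← Polynomial.divX_mul_X_add g]
  rw [show f * (g.divX * Polynomial.X + Polynomial.C (g.coeff 0))
      = Polynomial.X * (f * g.divX) + Polynomial.C (g.coeff 0) * f by ring, map_add,
    pertLagFunctional_X_mul, ← Polynomial.smul_eq_C_mul, map_smul, sub_add_cancel, smul_eq_mul]
  ring

lemma functional_sub_two_mul (f g : Polynomial ℝ) :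
    pertLagFunctional (α - 2) t (f * g)
      = g.coeff 0 * pertLagFunctional (α - 2) t f + g.coeff 1 * pertLagFunctional (α - 1) t f
        + pertLagFunctional α t (f * g.divX.divX) := by
  conv_lhs => rw [← Polynomial.divX_mul_X_add g]
  rw [show f * (g.divX * Polynomial.X + Polynomial.C (g.coeff 0))
      = Polynomial.X * (f * g.divX) + Polynomial.C (g.coeff 0) * f by ring, map_add,
    pertLagFunctional_X_mul, ← Polynomial.smul_eq_C_mul, map_smul,
    show α - 2 + 1 = α - 1 by ring, functional_sub_one_mul, Polynomial.coeff_divX, smul_eq_mul]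
  ring

lemma functional_sub_one_mul_of_le (H : IsMonicOrthogonal (pertLagFunctional α t) Q h) {m n : ℕ}
    (hmn : m ≤ n) :
    pertLagFunctional (α - 1) t (Q n * Q m)
      = (Q m).coeff 0 * pertLagFunctional (α - 1) t (Q n) := by
  rw [functional_sub_one_mul]
  have hd := Polynomial.natDegree_divX_eq_natDegree_tsub_one (p := Q m)
  rw [H.natDegree] at hd
  rcases n with _ | n
  · have : Q m = 1 := Polynomial.eq_one_of_monic_natDegree_zero (H.monic m)
      (by rw [H.natDegree]; omega)
    simp [this, Polynomial.divX_one]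
  · rw [H.map_mul_of_lt (by omega), add_zero]

lemma functional_sub_two_mul_of_le (H : IsMonicOrthogonal (pertLagFunctional α t) Q h) {m n : ℕ}
    (hmn : m ≤ n + 1) :
    pertLagFunctional (α - 2) t (Q n * Q m)
      = (Q m).coeff 0 * pertLagFunctional (α - 2) t (Q n)
        + (Q m).coeff 1 * pertLagFunctional (α - 1) t (Q n) := by
  rw [functional_sub_two_mul]
  have hd := Polynomial.natDegree_divX_eq_natDegree_tsub_one (p := Q m)
  have hd' := Polynomial.natDegree_divX_eq_natDegree_tsub_one (p := (Q m).divX)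
  rw [H.natDegree] at hd
  rcases n with _ | n
  · have : (Q m).divX.divX = 0 := by
      have h1 : ∀ k, (Q m).divX.divX.coeff k = 0 := fun k => by
        rw [Polynomial.coeff_divX, Polynomial.coeff_divX, H.coeff_of_lt (by omega)]
      exact Polynomial.ext (by simpa using h1)
    simp [this]
  · rw [H.map_mul_of_lt (by omega), add_zero]

lemma functional_sub_one_mul_succ (H : IsMonicOrthogonal (pertLagFunctional α t) Q h) (n : ℕ) :
    pertLagFunctional (α - 1) t (Q n * Q (n + 1))
      = (Q (n + 1)).coeff 0 * pertLagFunctional (α - 1) t (Q n) + h n := by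
  rw [functional_sub_one_mul]
  have hd := Polynomial.natDegree_divX_eq_natDegree_tsub_one (p := Q (n + 1))
  rw [H.natDegree] at hd
  rw [H.map_mul (n := n) (by omega), Polynomial.coeff_divX, H.coeff_self, one_mul]

lemma functional_sq_mul_sq (H : IsMonicOrthogonal (pertLagFunctional α t) Q h) (n : ℕ) :
    pertLagFunctional (α - 1) t (Q (n + 1) * Q (n + 1)) * pertLagFunctional (α - 1) t (Q n * Q n)
      = pertLagFunctional (α - 1) t (Q (n + 1) * Q n)
        * (pertLagFunctional (α - 1) t (Q (n + 1) * Q n) - h n) := by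
  have h1 := H.functional_sub_one_mul_succ n
  rw [mul_comm (Q n)] at h1
  have h2 := H.functional_sub_one_mul_of_le (Nat.le_succ n)
  rw [H.functional_sub_one_mul_of_le le_rfl, H.functional_sub_one_mul_of_le le_rfl]
  rw [show pertLagFunctional (α - 1) t (Q (n + 1) * Q n) - h n
    = (Q (n + 1)).coeff 0 * pertLagFunctional (α - 1) t (Q n) by rw [h1]; ring, h2]
  ring

lemma functional_linear_relation (H : IsMonicOrthogonal (pertLagFunctional α t) Q h)
    (hα : 0 < α) (ht : 0 < t) (n : ℕ) :
    h (n + 1) * pertLagFunctional (α - 1) t (Q n * Q n)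
      + h n * pertLagFunctional (α - 1) t (Q (n + 1) * Q (n + 1))
      + (2 * n + 2 + α) * h n * pertLagFunctional (α - 1) t (Q (n + 1) * Q n)
      - (n + 1) * h n ^ 2 = 0 := by
  have a1 := H.functional_sq_relation hα ht (n + 1)
  have a2 := H.functional_sq_relation hα ht n
  have a3 := H.functional_mul_succ_relation hα ht n
  have b1 := H.functional_sub_one_mul_succ n
  rw [mul_comm (Q n)] at b1
  have b2 := H.functional_sub_one_mul_of_le (Nat.le_succ n)
  have c1 := H.functional_sub_two_mul_of_le (Nat.le_succ (n + 1))
  have c2 := H.functional_sub_two_mul_of_le (Nat.le_succ n)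
  have c3 := H.functional_sub_two_mul_of_le (m := n) (n := n + 1) (by omega)
  have c4 := H.functional_sub_two_mul_of_le (m := n + 1) (n := n) (by omega)
  rw [mul_comm (Q n)] at c4
  have d1 := H.functional_sub_one_mul_of_le (le_refl (n + 1))
  have d2 := H.functional_sub_one_mul_of_le (le_refl n)
  rw [d1] at a1 ⊢
  rw [d2] at a2 ⊢
  rw [b2] at a3 b1 ⊢
  generalize pertLagFunctional (α - 2) t (Q (n + 1) * Q (n + 1)) = X₁ at *
  generalize pertLagFunctional (α - 2) t (Q n * Q n) = X₂ at *
  generalize pertLagFunctional (α - 2) t (Q (n + 1) * Q n) = X₃ at *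
  generalize pertLagFunctional (α - 2) t (Q (n + 1)) = s at *
  generalize pertLagFunctional (α - 2) t (Q n) = s' at *
  generalize pertLagFunctional (α - 1) t (Q (n + 1)) = q at *
  generalize pertLagFunctional (α - 1) t (Q n) = q' at *
  generalize (Q (n + 1)).coeff 0 = p at *
  generalize (Q n).coeff 0 = p' at *
  generalize (Q (n + 1)).coeff 1 = u at *
  generalize (Q n).coeff 1 = u' at *
  have key : q' * (p' * X₁ - p * X₃) = q * (p' * X₃ - p * X₂) := by
    have e1 : p' * X₁ - p * X₃ = q * (p' * u - p * u') := by rw [c1, c3]; ring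
    have e2 : p' * X₃ - p * X₂ = q' * (p' * u - p * u') := by rw [c4, c2]; ring
    rw [e1, e2]; ring
  linear_combination t * key - q' * p' * a1 + (q' * p + q * p') * a3 - q * p * a2
    + ((n + 1) * h n - α * p' * q) * b1

end IsMonicOrthogonal

/-! ### Dependence on the parameter -/

/-- The polynomial of degree at most `n` obtained by differentiating the coefficients of a
parameter-dependent polynomial at `t`. -/
noncomputable def coeffDeriv (n : ℕ) (f : ℝ → Polynomial ℝ) (t : ℝ) : Polynomial ℝ :=
  ∑ i ∈ Finset.range (n + 1), deriv (fun τ => (f τ).coeff i) t • Polynomial.X ^ i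

lemma hasDerivAt_pertLagFunctional_mul {α t : ℝ} (hα : 0 < α) (ht : 0 < t) {n : ℕ}
    {f : ℝ → Polynomial ℝ} (hf : ∀ τ > 0, (f τ).natDegree = n)
    (hd : ∀ i, DifferentiableAt ℝ (fun τ => (f τ).coeff i) t) (g : Polynomial ℝ) :
    HasDerivAt (fun τ => pertLagFunctional α τ (f τ * g))
      (pertLagFunctional α t (coeffDeriv n f t * g) - pertLagFunctional (α - 1) t (f t * g)) t := by
  have hexp : ∀ β, ∀ τ > 0, ∀ s, pertLagFunctional β s (f τ * g)
      = ∑ i ∈ Finset.range (n + 1),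
        (f τ).coeff i * pertLagFunctional β s (Polynomial.X ^ i * g) := by
    intro β τ hτ s
    conv_lhs => rw [(f τ).as_sum_range_C_mul_X_pow, hf τ hτ]
    rw [Finset.sum_mul, map_sum]
    refine Finset.sum_congr rfl fun i _ => ?_
    rw [mul_assoc, ← Polynomial.smul_eq_C_mul, map_smul, smul_eq_mul]
  have hsum : HasDerivAt (fun τ => ∑ i ∈ Finset.range (n + 1),
      (f τ).coeff i * pertLagFunctional α τ (Polynomial.X ^ i * g))
      (∑ i ∈ Finset.range (n + 1), (deriv (fun τ => (f τ).coeff i) t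
          * pertLagFunctional α t (Polynomial.X ^ i * g)
        + (f t).coeff i * -pertLagFunctional (α - 1) t (Polynomial.X ^ i * g))) t :=
    HasDerivAt.fun_sum fun i _ =>
      (hd i).hasDerivAt.mul (hasDerivAt_pertLagFunctional hα ht (Polynomial.X ^ i * g))
  have hval : pertLagFunctional α t (coeffDeriv n f t * g)
        - pertLagFunctional (α - 1) t (f t * g)
      = ∑ i ∈ Finset.range (n + 1), (deriv (fun τ => (f τ).coeff i) t
          * pertLagFunctional α t (Polynomial.X ^ i * g)
        + (f t).coeff i * -pertLagFunctional (α - 1) t (Polynomial.X ^ i * g)) := by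
    rw [hexp (α - 1) t ht t, coeffDeriv, Finset.sum_mul, map_sum, ← Finset.sum_sub_distrib]
    refine Finset.sum_congr rfl fun i _ => ?_
    rw [smul_mul_assoc, map_smul, smul_eq_mul]
    ring
  rw [hval]
  refine hsum.congr_of_eventuallyEq ?_
  filter_upwards [Ioi_mem_nhds ht] with τ hτ
  exact hexp α τ hτ τ

section Family

variable {α : ℝ} {Q : ℕ → ℝ → Polynomial ℝ} {h : ℕ → ℝ → ℝ}

lemma differentiableAt_coeff (hα : 0 < α)
    (H : ∀ τ > 0, IsMonicOrthogonal (pertLagFunctional α τ) (Q · τ) (h · τ)) (n : ℕ) :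
    ∀ t > 0, (∀ i, DifferentiableAt ℝ (fun τ => (Q n τ).coeff i) t)
      ∧ DifferentiableAt ℝ (h n) t := by
  induction n using Nat.strong_induction_on with
  | _ n ih =>
    intro t ht
    have hc : ∀ i, DifferentiableAt ℝ (fun τ => (Q n τ).coeff i) t := by
      intro i
      have hs : DifferentiableAt ℝ (fun τ => (Polynomial.X ^ n : Polynomial ℝ).coeff i
          - ∑ k ∈ Finset.range n,
            pertLagFunctional α τ (Q k τ * Polynomial.X ^ n) / h k τ * (Q k τ).coeff i) t := by
        refine (differentiableAt_const _).sub (DifferentiableAt.fun_sum fun k hk => ?_)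
        have hk := Finset.mem_range.1 hk
        have h1 := (hasDerivAt_pertLagFunctional_mul hα ht (fun τ hτ => (H τ hτ).natDegree k)
          (ih k hk t ht).1 (Polynomial.X ^ n)).differentiableAt
        exact (h1.div (ih k hk t ht).2 ((H t ht).pos k).ne').mul ((ih k hk t ht).1 i)
      refine hs.congr_of_eventuallyEq ?_
      filter_upwards [Ioi_mem_nhds ht] with τ hτ
      conv_lhs => rw [(H τ hτ).eq_X_pow_sub n]
      rw [Polynomial.coeff_sub, Polynomial.finsetSum_coeff]
      simp only [Polynomial.coeff_C_mul]
    refine ⟨hc, ?_⟩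
    have h1 := (hasDerivAt_pertLagFunctional_mul hα ht (fun τ hτ => (H τ hτ).natDegree n)
      hc (Polynomial.X ^ n)).differentiableAt
    refine h1.congr_of_eventuallyEq ?_
    filter_upwards [Ioi_mem_nhds ht] with τ hτ
    rw [(H τ hτ).map_mul (by simp)]
    simp

lemma coeff_coeffDeriv (n : ℕ) (f : ℝ → Polynomial ℝ) (t : ℝ) (k : ℕ) :
    (coeffDeriv n f t).coeff k = if k ≤ n then deriv (fun τ => (f τ).coeff k) t else 0 := by
  simp only [coeffDeriv, Polynomial.finsetSum_coeff, Polynomial.coeff_smul, Polynomial.coeff_X_pow,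
    smul_eq_mul, mul_ite, mul_one, mul_zero, Finset.sum_ite_eq, Finset.mem_range, Nat.lt_succ_iff]

lemma coeffDeriv_coeff_of_le
    (H : ∀ τ > 0, IsMonicOrthogonal (pertLagFunctional α τ) (Q · τ) (h · τ)) {n : ℕ} {t : ℝ}
    (ht : 0 < t) {k : ℕ} (hk : n ≤ k) : (coeffDeriv n (Q n) t).coeff k = 0 := by
  rw [coeff_coeffDeriv]
  split_ifs with hkn
  · obtain rfl : k = n := le_antisymm hkn hk
    have : (fun τ => (Q k τ).coeff k) =ᶠ[𝓝 t] fun _ => 1 := by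
      filter_upwards [Ioi_mem_nhds ht] with τ hτ
      exact (H τ hτ).coeff_self k
    rw [this.deriv_eq, deriv_const]
  · rfl

lemma hasDerivAt_norm (hα : 0 < α)
    (H : ∀ τ > 0, IsMonicOrthogonal (pertLagFunctional α τ) (Q · τ) (h · τ)) (n : ℕ) {t : ℝ}
    (ht : 0 < t) :
    HasDerivAt (h n) (-pertLagFunctional (α - 1) t (Q n t * Q n t)) t := by
  have h1 := hasDerivAt_pertLagFunctional_mul hα ht (fun τ hτ => (H τ hτ).natDegree n)
    (differentiableAt_coeff hα H n t ht).1 (Q n t)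
  have hdeg : (coeffDeriv n (Q n) t).natDegree ≤ n :=
    Polynomial.natDegree_le_iff_coeff_eq_zero.2 fun k hk => coeffDeriv_coeff_of_le H ht hk.le
  rw [mul_comm (coeffDeriv n (Q n) t), (H t ht).map_mul hdeg, coeffDeriv_coeff_of_le H ht le_rfl,
    zero_mul, zero_sub] at h1
  refine h1.congr_of_eventuallyEq ?_
  filter_upwards [Ioi_mem_nhds ht] with τ hτ
  rw [(H τ hτ).map_mul ((H t ht).natDegree n).le, (H t ht).coeff_self n, one_mul]

lemma hasDerivAt_subleading_coeff (hα : 0 < α)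
    (H : ∀ τ > 0, IsMonicOrthogonal (pertLagFunctional α τ) (Q · τ) (h · τ)) (n : ℕ) {t : ℝ}
    (ht : 0 < t) :
    HasDerivAt (fun τ => (Q (n + 1) τ).coeff n)
      (pertLagFunctional (α - 1) t (Q (n + 1) t * Q n t) / h n t) t := by
  have hd := (differentiableAt_coeff hα H (n + 1) t ht).1
  have h1 := hasDerivAt_pertLagFunctional_mul hα ht (fun τ hτ => (H τ hτ).natDegree (n + 1))
    hd (Q n t)
  have hdeg : (coeffDeriv (n + 1) (Q (n + 1)) t).natDegree ≤ n :=
    Polynomial.natDegree_le_iff_coeff_eq_zero.2 fun k hk => coeffDeriv_coeff_of_le H ht hk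
  rw [mul_comm (coeffDeriv (n + 1) (Q (n + 1)) t), (H t ht).map_mul hdeg, coeff_coeffDeriv,
    if_pos (by omega)] at h1
  have h2 : (fun τ => pertLagFunctional α τ (Q (n + 1) τ * Q n t)) =ᶠ[𝓝 t] fun _ => 0 := by
    filter_upwards [Ioi_mem_nhds ht] with τ hτ
    exact (H τ hτ).map_mul_of_lt (by rw [(H t ht).natDegree]; omega)
  have h3 := h1.unique ((hasDerivAt_const t (0 : ℝ)).congr_of_eventuallyEq h2)
  have hp := (H t ht).pos n
  refine (hd n).hasDerivAt.congr_deriv ?_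
  rw [eq_div_iff hp.ne']
  linarith

/-- The auxiliary quantities `R = α_n - (2n + 1 + α)` and `r` attached to the orthogonal polynomial
of degree `n + 1` satisfy a first-order system, and `R` obeys two-sided bounds. -/
theorem exists_ladder_system (hα : 0 < α) {A B : ℕ → ℝ → ℝ}
    (H : ∀ τ > 0, IsMonicOrthogonal (pertLagFunctional α τ) (Q · τ) (h · τ))
    (hrec : ∀ m : ℕ, 1 ≤ m → ∀ τ > (0 : ℝ), Polynomial.X * Q m τ
      = Q (m + 1) τ + Polynomial.C (A m τ) * Q m τ + Polynomial.C (B m τ) * Q (m - 1) τ)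
    {n : ℕ} (hn : 1 ≤ n) :
    ∃ R r : ℝ → ℝ, ∀ t > 0,
      HasDerivAt R ((2 * r t + (2 * n + 1 + α) * R t + R t ^ 2 - t) / t) t ∧
      HasDerivAt r (((2 * n + 1 + α) * r t - n * t + 2 * r t * (r t - t) / R t) / t) t ∧
      0 < R t ∧ α * R t ≤ t ∧ t / R t ≤ 2 * n + 1 + α + R t ∧
      A n t = 2 * n + 1 + α + R t := by
  obtain ⟨n, rfl⟩ : ∃ m, n = m + 1 := ⟨n - 1, by omega⟩
  refine ⟨fun t => t * pertLagFunctional (α - 1) t (Q (n + 1) t * Q (n + 1) t) / h (n + 1) t,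
    fun t => t * pertLagFunctional (α - 1) t (Q (n + 1) t * Q n t) / h n t, ?_⟩
  have hA : ∀ τ > 0, A (n + 1) τ = 2 * ((n + 1 : ℕ) : ℝ) + 1 + α
      + τ * pertLagFunctional (α - 1) τ (Q (n + 1) τ * Q (n + 1) τ) / h (n + 1) τ := by
    intro τ hτ
    have e := (H τ hτ).functional_X_mul_sq hα hτ (n + 1)
    rw [← mul_assoc, hrec (n + 1) (by omega) τ hτ, add_mul, add_mul, map_add, map_add, mul_assoc,
      mul_assoc, ← Polynomial.smul_eq_C_mul, ← Polynomial.smul_eq_C_mul, map_smul, map_smul,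
      (H τ hτ).orth, (H τ hτ).orth, (H τ hτ).orth, if_neg (by omega), if_pos rfl,
      if_neg (by omega)] at e
    have hp := ((H τ hτ).pos (n + 1)).ne'
    simp only [smul_eq_mul, mul_zero, zero_add, add_zero] at e
    field_simp
    linarith
  have hB : ∀ τ > 0, B (n + 1) τ * h n τ = h (n + 1) τ := by
    intro τ hτ
    have e := (H τ hτ).map_mul (n := n + 1) (f := Polynomial.X * Q n τ) (by
      refine Polynomial.natDegree_mul_le.trans ?_
      rw [(H τ hτ).natDegree]
      have := Polynomial.natDegree_X_le (R := ℝ)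
      omega)
    rw [Polynomial.coeff_X_mul, (H τ hτ).coeff_self, mul_left_comm, ← mul_assoc,
      hrec (n + 1) (by omega) τ hτ, add_mul, add_mul, map_add, map_add, mul_assoc,
      mul_assoc, ← Polynomial.smul_eq_C_mul, ← Polynomial.smul_eq_C_mul, map_smul, map_smul,
      (H τ hτ).orth, (H τ hτ).orth, (H τ hτ).orth, if_neg (by omega), if_neg (by omega)] at e
    simpa using e
  have hAc : ∀ τ > 0, A (n + 1) τ = (Q (n + 1) τ).coeff n - (Q (n + 1 + 1) τ).coeff (n + 1) := by
    intro τ hτ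
    have e := congrArg (Polynomial.coeff · (n + 1)) (hrec (n + 1) (by omega) τ hτ)
    simp only [Polynomial.coeff_X_mul, Polynomial.coeff_add, Polynomial.coeff_C_mul,
      Nat.add_sub_cancel] at e
    rw [(H τ hτ).coeff_self (n + 1), (H τ hτ).coeff_of_lt (Nat.lt_succ_self n)] at e
    linarith
  have hr : ∀ τ > 0, τ * pertLagFunctional (α - 1) τ (Q (n + 1) τ * Q n τ) / h n τ
      = (Q (n + 1) τ).coeff n + h (n + 1) τ / h n τ := by
    intro τ hτ
    rw [(H τ hτ).functional_mul_succ hα hτ n]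
    have hp := ((H τ hτ).pos n).ne'
    field_simp
  intro t ht
  beta_reduce
  have Ht := H t ht
  have hp0 := Ht.pos n
  have hp1 := Ht.pos (n + 1)
  have hA' := hA t ht
  have hB' := hB t ht
  have hr' := hr t ht
  have hc1 := hasDerivAt_subleading_coeff hα H n ht
  have hc2 := hasDerivAt_subleading_coeff hα H (n + 1) ht
  have hh0 := hasDerivAt_norm hα H n ht
  have hh1 := hasDerivAt_norm hα H (n + 1) ht
  have hquad := Ht.functional_sq_mul_sq n
  have hlin := Ht.functional_linear_relation hα ht n
  have hsq := Ht.functional_sq_relation hα ht (n + 1)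
  have hxsq := Ht.functional_X_mul_sq hα ht (n + 1)
  have hnn : ∀ p : Polynomial ℝ, (∀ x > (0 : ℝ), 0 ≤ p.eval x) →
      0 ≤ pertLagFunctional (α - 1) t p ∧ 0 ≤ pertLagFunctional (α - 2) t p := fun p hp =>
    ⟨pertLagFunctional_nonneg (by linarith) ht hp, pertLagFunctional_nonneg (by linarith) ht hp⟩
  have hn1 := hnn (Q (n + 1) t * Q (n + 1) t) fun x _ => by
    rw [Polynomial.eval_mul]; exact mul_self_nonneg _
  have hquadratic : ∀ c : ℝ, 0 ≤ pertLagFunctional α t (Polynomial.X * (Q (n + 1) t * Q (n + 1) t))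
      - 2 * c * h (n + 1) t
      + c ^ 2 * pertLagFunctional (α - 1) t (Q (n + 1) t * Q (n + 1) t) := by
    intro c
    have e := (hnn ((Polynomial.X - Polynomial.C c) ^ 2 * (Q (n + 1) t * Q (n + 1) t)) fun x _ => by
      simp only [Polynomial.eval_mul, Polynomial.eval_pow]
      exact mul_nonneg (sq_nonneg _) (mul_self_nonneg _)).1
    have hX : ∀ p, pertLagFunctional (α - 1) t (Polynomial.X * p) = pertLagFunctional α t p := by
      intro p
      rw [pertLagFunctional_X_mul, sub_add_cancel]
    rw [show (Polynomial.X - Polynomial.C c) ^ 2 * (Q (n + 1) t * Q (n + 1) t)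
        = Polynomial.X * (Polynomial.X * (Q (n + 1) t * Q (n + 1) t))
          - Polynomial.C (2 * c) * (Polynomial.X * (Q (n + 1) t * Q (n + 1) t))
          + Polynomial.C (c ^ 2) * (Q (n + 1) t * Q (n + 1) t) by
        rw [Polynomial.C_mul, Polynomial.C_pow, show (Polynomial.C 2 : Polynomial ℝ) = 2 from rfl]
        ring,
      map_add, map_sub, ← Polynomial.smul_eq_C_mul, ← Polynomial.smul_eq_C_mul, map_smul, map_smul,
      hX, hX, Ht.orth, if_pos rfl] at e
    simpa [smul_eq_mul] using e
  have hr2 : t * pertLagFunctional (α - 1) t (Q (n + 1 + 1) t * Q (n + 1) t)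
      = t * (h (n + 1) t
        - A (n + 1) t * pertLagFunctional (α - 1) t (Q (n + 1) t * Q (n + 1) t)
        - B (n + 1) t * pertLagFunctional (α - 1) t (Q (n + 1) t * Q n t)) := by
    have e : Q (n + 1 + 1) t * Q (n + 1) t = Polynomial.X * (Q (n + 1) t * Q (n + 1) t)
        - Polynomial.C (A (n + 1) t) * (Q (n + 1) t * Q (n + 1) t)
        - Polynomial.C (B (n + 1) t) * (Q (n + 1) t * Q n t) := by
      have e1 := hrec (n + 1) (by omega) t ht
      rw [Nat.add_sub_cancel] at e1
      linear_combination (-Q (n + 1) t) * e1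
    rw [e, map_sub, map_sub, pertLagFunctional_X_mul, ← Polynomial.smul_eq_C_mul,
      ← Polynomial.smul_eq_C_mul, map_smul, map_smul, sub_add_cancel, Ht.orth, if_pos rfl,
      smul_eq_mul, smul_eq_mul]
  have hRev : (fun τ => (Q (n + 1) τ).coeff n - (Q (n + 1 + 1) τ).coeff (n + 1)
      - (2 * ((n + 1 : ℕ) : ℝ) + 1 + α)) =ᶠ[𝓝 t] fun τ =>
      τ * pertLagFunctional (α - 1) τ (Q (n + 1) τ * Q (n + 1) τ) / h (n + 1) τ := by
    filter_upwards [Ioi_mem_nhds ht] with τ hτ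
    rw [← hAc τ hτ, hA τ hτ]
    ring
  have hrev : (fun τ => (Q (n + 1) τ).coeff n + h (n + 1) τ / h n τ) =ᶠ[𝓝 t] fun τ =>
      τ * pertLagFunctional (α - 1) τ (Q (n + 1) τ * Q n τ) / h n τ := by
    filter_upwards [Ioi_mem_nhds ht] with τ hτ
    exact (hr τ hτ).symm
  have dR := ((hc1.sub hc2).sub_const (2 * ((n + 1 : ℕ) : ℝ) + 1 + α)).congr_of_eventuallyEq
    hRev.symm
  have dr := (hc1.add (hh1.div hh0 hp0.ne')).congr_of_eventuallyEq hrev.symm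
  clear hRev hrev hc1 hc2 hh0 hh1 hA hB hAc hr hnn
  generalize pertLagFunctional (α - 1) t (Q (n + 1) t * Q n t) = b at *
  generalize pertLagFunctional (α - 1) t (Q (n + 1) t * Q (n + 1) t) = a at *
  generalize pertLagFunctional (α - 1) t (Q n t * Q n t) = a' at *
  generalize pertLagFunctional (α - 2) t (Q (n + 1) t * Q (n + 1) t) = a₂ at *
  generalize pertLagFunctional (α - 1) t (Q (n + 1 + 1) t * Q (n + 1) t) = b' at *
  generalize pertLagFunctional α t (Polynomial.X * (Q (n + 1) t * Q (n + 1) t)) = e at *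
  generalize h (n + 1) t = k at *
  generalize h n t = k' at *
  have ha : 0 < a := by
    rcases hn1.1.lt_or_eq with h1 | h1
    · exact h1
    · have := hquadratic (e / k)
      rw [← h1] at this hxsq
      have h2 : 0 < e := by rw [hxsq]; push_cast; positivity
      have h3 : 2 * (e / k) * k = 2 * e := by field_simp
      linarith
  push_cast at *
  have hBk : B (n + 1) t = k / k' := by rw [eq_div_iff hp0.ne', hB']
  have hb' : b' = k - A (n + 1) t * a - B (n + 1) t * b := mul_left_cancel₀ ht.ne' hr2
  refine ⟨dR.congr_deriv ?_, dr.congr_deriv ?_, by positivity, ?_, ?_, hA'⟩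
  · rw [hb', hBk, hA']
    field_simp
    ring
  · have h1 : 2 * (t * b / k') * (t * b / k' - t) / (t * a / k) =
        2 * t * (a * a') * k / (k' ^ 2 * a) := by
      rw [hquad]
      field_simp
    rw [h1]
    field_simp
    linear_combination (-1 : ℝ) * hlin
  · rw [mul_div_assoc', div_le_iff₀ hp1]
    nlinarith [mul_nonneg ht.le (mul_nonneg ht.le hn1.2)]
  · have h1 := hquadratic (k / a)
    have h2 : e - 2 * (k / a) * k + (k / a) ^ 2 * a = e - k ^ 2 / a := by
      field_simp
      ring
    have h3 : t / (t * a / k) = k / a := by field_simp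
    have h4 : 2 * ((n : ℝ) + 1) + 1 + α + t * a / k = e / k := by
      rw [hxsq]
      field_simp
    rw [h3, h4, le_div_iff₀ hp1]
    have h5 : k / a * k = k ^ 2 / a := by ring
    linarith

end Family

/-! ### A maximum principle and a comparison principle on half-lines -/

lemma nonpos_of_deriv_deriv_pos {u u₁ u₂ : ℝ → ℝ} {X M : ℝ}
    (hu : ∀ x, HasDerivAt u (u₁ x) x) (hu₁ : ∀ x, HasDerivAt u₁ (u₂ x) x)
    (hM : ∀ x ≤ X, u x ≤ M) (hpos : ∀ x ≤ X, 0 < u x → x < X ∧ 0 < u₂ x) :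
    ∀ x ≤ X, u x ≤ 0 := by
  intro x₀ hx₀
  by_contra! h0
  have hX : 0 < X - x₀ + 1 := by linarith
  set η := u x₀ / (2 * (X - x₀ + 1)) with hη
  have hη0 : 0 < η := by positivity
  have hη1 : η * (X - x₀ + 1) = u x₀ / 2 := by
    rw [hη]
    field_simp
  set v : ℝ → ℝ := fun x => u x - η * (X - x + 1) with hv
  have hv' : ∀ x, HasDerivAt v (u₁ x + η) x := fun x =>
    ((hu x).sub ((((hasDerivAt_id x).const_sub X).add_const 1).const_mul η)).congr_deriv (by ring)
  have hv'' : ∀ x, HasDerivAt (fun x => u₁ x + η) (u₂ x) x := fun x => (hu₁ x).add_const η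
  obtain ⟨L, hL, hLM⟩ : ∃ L ≤ x₀, M ≤ η * (X - L + 1) := by
    refine ⟨min x₀ (X + 1 - M / η), min_le_left _ _, ?_⟩
    have h1 : M / η ≤ X - min x₀ (X + 1 - M / η) + 1 := by
      have := min_le_right x₀ (X + 1 - M / η)
      linarith
    rwa [div_le_iff₀' hη0] at h1
  have hvx₀ : 0 < v x₀ := by
    simp only [hv]
    linarith
  obtain ⟨z, hz, hmax⟩ := isCompact_Icc.exists_isMaxOn (nonempty_Icc.2 (hL.trans hx₀))
    (fun x _ => (hv' x).continuousAt.continuousWithinAt : ContinuousOn v (Icc L X))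
  have hvz : 0 < v z := hvx₀.trans_le (hmax ⟨hL, hx₀⟩)
  have hzL : L < z := by
    refine hz.1.lt_of_ne ?_
    rintro rfl
    have := hM L hz.2
    simp only [hv] at hvz
    linarith
  have huz : 0 < u z := by
    have h1 : 0 ≤ η * (X - z + 1) := mul_nonneg hη0.le (by linarith [hz.2])
    simp only [hv] at hvz
    linarith
  obtain ⟨hzX, hu₂⟩ := hpos z hz.2 huz
  have hlmax : IsLocalMax v z := hmax.isLocalMax (Icc_mem_nhds hzL hzX)
  have hd : deriv v = fun x => u₁ x + η := funext fun x => (hv' x).deriv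
  have hdd : deriv (deriv v) z = u₂ z := by rw [hd, (hv'' z).deriv]
  have hlmin : IsLocalMin v z := isLocalMin_of_deriv_deriv_pos (by rwa [hdd]) hlmax.deriv_eq_zero
    (hv' z).continuousAt
  have hconst : v =ᶠ[𝓝 z] fun _ => v z := by
    filter_upwards [hlmax, hlmin] with y h1 h2 using le_antisymm h1 h2
  have h1 : deriv (deriv v) z = 0 := by
    rw [hconst.deriv.deriv_eq]
    simp
  linarith

lemma hasDerivAt_max_zero_pow (k : ℕ) (x : ℝ) :
    HasDerivAt (fun x : ℝ => max x 0 ^ (k + 2)) ((k + 2) * max x 0 ^ (k + 1)) x := by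
  have h1 : HasDerivWithinAt (fun x : ℝ => max x 0 ^ (k + 2)) ((k + 2) * max x 0 ^ (k + 1))
      (Iic 0) x := by
    by_cases hx : x ∈ Iic (0 : ℝ)
    · have hx' : x ≤ 0 := hx
      rw [max_eq_right hx']
      have : HasDerivWithinAt (fun _ : ℝ => (0 : ℝ)) (((k : ℝ) + 2) * 0 ^ (k + 1)) (Iic 0) x := by
        simpa using hasDerivWithinAt_const x (Iic 0) (0 : ℝ)
      exact this.congr (fun y hy => by rw [max_eq_right (show y ≤ 0 from hy)]; simp)
        (by rw [max_eq_right hx']; simp)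
    · exact HasFDerivWithinAt.of_notMem_closure (by rwa [isClosed_Iic.closure_eq])
  have h2 : HasDerivWithinAt (fun x : ℝ => max x 0 ^ (k + 2)) ((k + 2) * max x 0 ^ (k + 1))
      (Ici 0) x := by
    by_cases hx : x ∈ Ici (0 : ℝ)
    · have hx' : 0 ≤ x := hx
      rw [max_eq_left hx']
      refine (((hasDerivAt_pow (k + 2) x).congr_deriv ?_).hasDerivWithinAt).congr
        (fun y hy => by rw [max_eq_left (show 0 ≤ y from hy)]) (by rw [max_eq_left hx'])
      push_cast
      rfl
    · exact HasFDerivWithinAt.of_notMem_closure (by rwa [isClosed_Ici.closure_eq])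
  have h3 := h1.union h2
  rwa [Iic_union_Ici, hasDerivWithinAt_univ] at h3

/-- The right-hand side of the limiting second-order equation in logarithmic coordinates. -/
noncomputable def limitForce (α w x : ℝ) : ℝ :=
  Real.exp (2 * w) - α * Real.exp w - Real.exp (x - w)

lemma limitForce_sub_ge {α f g x : ℝ} (hg : Real.log α ≤ g) (hα : 0 < α) (hfg : g ≤ f) :
    (f - g) * Real.exp (x - f) ≤ limitForce α f x - limitForce α g x ∧
    (f - g) * Real.exp (2 * x / 3) ≤ limitForce α f x - limitForce α g x := by
  have hαg : α ≤ Real.exp g := (Real.log_le_iff_le_exp hα).1 hg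
  have hgf : Real.exp g ≤ Real.exp f := Real.exp_le_exp.2 hfg
  have e1 : Real.exp (2 * f) = Real.exp f * Real.exp f := by rw [← Real.exp_add]; ring_nf
  have e2 : Real.exp (2 * g) = Real.exp g * Real.exp g := by rw [← Real.exp_add]; ring_nf
  have hT : limitForce α f x - limitForce α g x
      = (Real.exp f - Real.exp g) * (Real.exp f + Real.exp g - α)
        + (Real.exp (x - g) - Real.exp (x - f)) := by
    rw [limitForce, limitForce, e1, e2]
    ring
  constructor
  · have h1 : Real.exp (x - g) = Real.exp (x - f) * Real.exp (f - g) := by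
      rw [← Real.exp_add]
      ring_nf
    have h2 := Real.add_one_le_exp (f - g)
    have h3 := mul_nonneg (sub_nonneg.2 hgf)
      (show 0 ≤ Real.exp f + Real.exp g - α by linarith [Real.exp_pos f])
    rw [hT, h1]
    nlinarith [Real.exp_pos (x - f)]
  · set κ := (f + g) / 2 with hκ
    have hsinh : f - g ≤ Real.exp ((f - g) / 2) - Real.exp (-((f - g) / 2)) := by
      have h1 := Real.self_le_sinh_iff.2 (show 0 ≤ (f - g) / 2 by linarith)
      rw [Real.sinh_eq] at h1
      linarith
    have h1 : (f - g) * Real.exp κ ≤ Real.exp f - Real.exp g := by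
      have h2 : Real.exp f = Real.exp ((f - g) / 2) * Real.exp κ := by
        rw [← Real.exp_add, hκ]
        ring_nf
      have h3 : Real.exp g = Real.exp (-((f - g) / 2)) * Real.exp κ := by
        rw [← Real.exp_add, hκ]
        ring_nf
      rw [h2, h3, ← sub_mul]
      exact mul_le_mul_of_nonneg_right hsinh (Real.exp_pos _).le
    have h0 : 0 ≤ f - g := sub_nonneg.2 hfg
    have hκf : Real.exp κ ≤ Real.exp f := Real.exp_le_exp.2 (by linarith)
    have h4 : (f - g) * Real.exp (2 * κ)
        ≤ (Real.exp f - Real.exp g) * (Real.exp f + Real.exp g - α) := by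
      have h5 : Real.exp (2 * κ) = Real.exp κ * Real.exp κ := by rw [← Real.exp_add]; ring_nf
      rw [h5, ← mul_assoc]
      exact mul_le_mul h1 (by linarith) (Real.exp_pos _).le (sub_nonneg.2 hgf)
    have h6 : (f - g) * Real.exp (x - κ) ≤ Real.exp (x - g) - Real.exp (x - f) := by
      have h7 : Real.exp (x - g) - Real.exp (x - f)
          = (Real.exp f - Real.exp g) * Real.exp (x - 2 * κ) := by
        rw [sub_mul, ← Real.exp_add, ← Real.exp_add, hκ]
        ring_nf
      have h8 : Real.exp (x - κ) = Real.exp κ * Real.exp (x - 2 * κ) := by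
        rw [← Real.exp_add]
        ring_nf
      rw [h7, h8, ← mul_assoc]
      exact mul_le_mul_of_nonneg_right h1 (Real.exp_pos _).le
    have h9 : Real.exp (2 * x / 3) ≤ Real.exp (2 * κ) + Real.exp (x - κ) := by
      rcases le_total (x / 3) κ with h | h
      · linarith [Real.exp_le_exp.2 (show 2 * x / 3 ≤ 2 * κ by linarith), Real.exp_pos (x - κ)]
      · linarith [Real.exp_le_exp.2 (show 2 * x / 3 ≤ x - κ by linarith), Real.exp_pos (2 * κ)]
    rw [hT]
    nlinarith

/-- A sub- and a supersolution of `w'' = limitForce α w x`, up to relative error `p`, that are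
within `M` of each other on a half-line are much closer away from its endpoint. -/
theorem sub_le_of_limitForce {α X M p : ℝ} {f f₁ f₂ g g₁ g₂ : ℝ → ℝ} (hα : 0 < α)
    (hM0 : 0 ≤ M) (hp0 : 0 ≤ p) (hf : ∀ x, HasDerivAt f (f₁ x) x)
    (hf₁ : ∀ x, HasDerivAt f₁ (f₂ x) x) (hg : ∀ x, HasDerivAt g (g₁ x) x)
    (hg₁ : ∀ x, HasDerivAt g₁ (g₂ x) x) (hlog : ∀ x ≤ X, Real.log α ≤ g x)
    (hf₂ : ∀ x ≤ X, limitForce α (f x) x - p * Real.exp (x - f x) ≤ f₂ x)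
    (hg₂ : ∀ x ≤ X, g₂ x ≤ limitForce α (g x) x) (hM : ∀ x ≤ X, f x - g x ≤ M) :
    ∀ x ≤ X - 1, f x - g x ≤ 2 * p + 144 * M * Real.exp (-(4 * (X - 1) / 3)) := by
  rcases hM0.eq_or_lt with rfl | hMpos
  · intro x hx
    linarith [hM x (by linarith)]
  set S := Real.exp (2 * (X - 1) / 3) with hS
  have hS0 : 0 < S := Real.exp_pos _
  have hSS : Real.exp (-(4 * (X - 1) / 3)) = 1 / S ^ 2 := by
    rw [hS, ← Real.exp_nat_mul, one_div, ← Real.exp_neg]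
    push_cast
    ring_nf
  set ε := 144 * M / S ^ 2 with hε
  have hε0 : 0 < ε := by positivity
  have hy4 : ∀ x, HasDerivAt (fun x => max (x - (X - 1)) 0 ^ 4) (4 * max (x - (X - 1)) 0 ^ 3) x :=
    fun x => ((hasDerivAt_max_zero_pow 2 (x - (X - 1))).comp_sub_const x (X - 1)).congr_deriv
      (by norm_num)
  have hy3 : ∀ x, HasDerivAt (fun x => max (x - (X - 1)) 0 ^ 3) (3 * max (x - (X - 1)) 0 ^ 2) x :=
    fun x => ((hasDerivAt_max_zero_pow 1 (x - (X - 1))).comp_sub_const x (X - 1)).congr_deriv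
      (by norm_num)
  have key := nonpos_of_deriv_deriv_pos (X := X) (M := M)
    (u := fun x => f x - g x - (2 * p + ε) - M * max (x - (X - 1)) 0 ^ 4)
    (u₁ := fun x => f₁ x - g₁ x - M * (4 * max (x - (X - 1)) 0 ^ 3))
    (u₂ := fun x => f₂ x - g₂ x - M * (4 * (3 * max (x - (X - 1)) 0 ^ 2)))
    (fun x => (((hf x).sub (hg x)).sub_const _).sub ((hy4 x).const_mul M))
    (fun x => ((hf₁ x).sub (hg₁ x)).sub (((hy3 x).const_mul 4).const_mul M))
    (fun x hx => by
      have h1 : 0 ≤ M * max (x - (X - 1)) 0 ^ 4 := by positivity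
      have h2 := hM x hx
      linarith)
    (fun x hx hpos => by
      set y := max (x - (X - 1)) 0 with hy
      have hy0 : 0 ≤ y := le_max_right _ _
      constructor
      · refine hx.lt_of_ne ?_
        rintro rfl
        have hy1 : y = 1 := by rw [hy]; norm_num
        rw [hy1] at hpos
        have h2 := hM x le_rfl
        linarith
      · have hMy : 0 ≤ M * y ^ 4 := by positivity
        have hδ : 0 < f x - g x := by linarith
        obtain ⟨hT1, hT2⟩ := limitForce_sub_ge (x := x) (hlog x hx) hα (sub_pos.1 hδ).le
        have h3 := hf₂ x hx
        have h4 := hg₂ x hx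
        have h5 : 2 * p * Real.exp (x - f x) ≤ (f x - g x) * Real.exp (x - f x) :=
          mul_le_mul_of_nonneg_right (by linarith) (Real.exp_pos _).le
        have h6 : (ε + M * y ^ 4) * Real.exp (2 * x / 3) < (f x - g x) * Real.exp (2 * x / 3) :=
          mul_lt_mul_of_pos_right (by linarith) (Real.exp_pos _)
        suffices h7 : 24 * M * y ^ 2 ≤ (ε + M * y ^ 4) * Real.exp (2 * x / 3) by linarith
        rcases hy0.eq_or_lt with h8 | h8
        · rw [← h8]
          norm_num
          positivity
        · have h9 : 0 < x - (X - 1) := by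
            by_contra! h10
            rw [hy, max_eq_right h10] at h8
            exact lt_irrefl _ h8
          have h11 : S ≤ Real.exp (2 * x / 3) := Real.exp_le_exp.2 (by linarith)
          have h12 : 24 * M * y ^ 2 ≤ (ε + M * y ^ 4) * S := by
            have h13 : (ε + M * y ^ 4) * S - 24 * M * y ^ 2 = M / S * (12 - S * y ^ 2) ^ 2 := by
              rw [hε]
              field_simp
              ring
            have h14 : 0 ≤ M / S * (12 - S * y ^ 2) ^ 2 := by positivity
            linarith
          exact h12.trans (mul_le_mul_of_nonneg_left h11 (by positivity)))
  intro x hx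
  have h1 := key x (by linarith)
  simp only [max_eq_right (show x - (X - 1) ≤ 0 by linarith)] at h1
  rw [hSS]
  have h2 : 144 * M * (1 / S ^ 2) = ε := by rw [hε]; ring
  linarith

/-- The differential inequalities and bounds satisfied by the logarithmic profile of the `n`-th
recurrence coefficient. -/
structure IsLogProfile (α : ℝ) (n : ℕ) (f f₁ f₂ : ℝ → ℝ) : Prop where
  hasDerivAt : ∀ x, HasDerivAt f (f₁ x) x
  hasDerivAt' : ∀ x, HasDerivAt f₁ (f₂ x) x
  le_limitForce : ∀ x, f₂ x ≤ limitForce α (f x) x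
  limitForce_le : ∀ x, limitForce α (f x) x
    - ((1 + α) / (2 * n) + Real.exp x / (4 * n ^ 2 * α)) * Real.exp (x - f x) ≤ f₂ x
  log_le : ∀ x, Real.log α ≤ f x
  exp_le : ∀ x, Real.exp (f x) ≤ 2 * n + 1 + α + Real.exp x / (2 * n * α)

/-- In the variable `x = log (2 n t)`, the logarithm of `t / R` satisfies a perturbation of
`w'' = limitForce α w x`. -/
theorem exists_log_profile {α : ℝ} (hα : 0 < α) {n : ℕ} (hn : 1 ≤ n) {R r : ℝ → ℝ}
    (hR : ∀ t > 0, HasDerivAt R ((2 * r t + (2 * n + 1 + α) * R t + R t ^ 2 - t) / t) t)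
    (hr : ∀ t > 0,
      HasDerivAt r (((2 * n + 1 + α) * r t - n * t + 2 * r t * (r t - t) / R t) / t) t)
    (hpos : ∀ t > 0, 0 < R t) (hle : ∀ t > 0, α * R t ≤ t)
    (hge : ∀ t > 0, t / R t ≤ 2 * n + 1 + α + R t) :
    ∃ f f₁ f₂ : ℝ → ℝ, IsLogProfile α n f f₁ f₂ ∧
      ∀ t > 0, R t = t * Real.exp (-f (Real.log (2 * n * t))) := by
  have hn0 : (0 : ℝ) < n := by exact_mod_cast hn
  set T : ℝ → ℝ := fun x => Real.exp x / (2 * n) with hTdef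
  have hT : ∀ x, 0 < T x := fun x => by positivity
  have hTd : ∀ x, HasDerivAt T (T x) x := fun x => (Real.hasDerivAt_exp x).div_const _
  have hRT : ∀ x, HasDerivAt (fun x => R (T x))
      (2 * r (T x) + (2 * n + 1 + α) * R (T x) + R (T x) ^ 2 - T x) x := fun x =>
    ((hR (T x) (hT x)).comp x (hTd x)).congr_deriv (by field_simp [(hT x).ne'])
  have hrT : ∀ x, HasDerivAt (fun x => r (T x))
      ((2 * n + 1 + α) * r (T x) - n * T x + 2 * r (T x) * (r (T x) - T x) / R (T x)) x := fun x =>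
    ((hr (T x) (hT x)).comp x (hTd x)).congr_deriv (by rw [div_mul_cancel₀ _ (hT x).ne'])
  have hexp : ∀ x, Real.exp (x - Real.log (2 * n) - Real.log (R (T x))) = T x / R (T x) := by
    intro x
    rw [Real.exp_sub, Real.exp_sub, Real.exp_log (by positivity), Real.exp_log (hpos _ (hT x))]
  have hexp2 : ∀ x, Real.exp (2 * (x - Real.log (2 * n) - Real.log (R (T x))))
      = (T x / R (T x)) ^ 2 := by
    intro x
    rw [two_mul, Real.exp_add, hexp, sq]
  have hexp' : ∀ x, Real.exp (x - (x - Real.log (2 * n) - Real.log (R (T x))))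
      = 2 * n * R (T x) := by
    intro x
    rw [show x - (x - Real.log (2 * n) - Real.log (R (T x)))
      = Real.log (2 * n) + Real.log (R (T x)) by ring, Real.exp_add, Real.exp_log (by positivity),
      Real.exp_log (hpos _ (hT x))]
  have hRle : ∀ x, R (T x) ≤ Real.exp x / (2 * n * α) := by
    intro x
    have h1 := hle _ (hT x)
    have h2 : Real.exp x / (2 * n * α) = T x / α := by
      simp only [hTdef]
      field_simp
    rw [h2, le_div_iff₀' hα]
    exact h1
  refine ⟨fun x => x - Real.log (2 * n) - Real.log (R (T x)),
    fun x => 1 - (2 * r (T x) - T x) / R (T x) - (2 * n + 1 + α) - R (T x),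
    fun x => (T x / R (T x)) ^ 2 - α * (T x / R (T x)) - (2 * n + 1 + α) * R (T x) - R (T x) ^ 2,
    ⟨fun x => ?_, fun x => ?_, fun x => ?_, fun x => ?_, fun x => ?_, fun x => ?_⟩, fun t ht => ?_⟩
  · have h0 := (hpos _ (hT x)).ne'
    refine (((hasDerivAt_id x).sub_const _).sub ((hRT x).log h0)).congr_deriv ?_
    field_simp
    ring
  · have h0 := (hpos _ (hT x)).ne'
    refine ((((hasDerivAt_const x (1 : ℝ)).sub ((((hrT x).const_mul 2).sub (hTd x)).div (hRT x)
      h0)).sub_const _).sub (hRT x)).congr_deriv ?_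
    simp only [Pi.sub_apply]
    field_simp
    ring
  · have h0 := hpos _ (hT x)
    simp only [limitForce, hexp, hexp2, hexp']
    nlinarith [mul_pos hα h0, mul_pos h0 h0]
  · have h0 := hpos _ (hT x)
    simp only [limitForce, hexp, hexp2, hexp']
    have h1 : ((1 + α) / (2 * n) + Real.exp x / (4 * n ^ 2 * α)) * (2 * n * R (T x))
        = (1 + α) * R (T x) + Real.exp x / (2 * n * α) * R (T x) := by
      field_simp
      ring
    rw [h1]
    nlinarith [mul_le_mul_of_nonneg_right (hRle x) h0.le]
  · rw [Real.log_le_iff_le_exp hα, hexp, le_div_iff₀ (hpos _ (hT x))]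
    exact hle _ (hT x)
  · simp only [hexp]
    linarith [hge _ (hT x), hRle x]
  · have h1 : T (Real.log (2 * n * t)) = t := by
      simp only [hTdef]
      rw [Real.exp_log (by positivity)]
      field_simp
    have h2 := hexp (Real.log (2 * n * t))
    rw [h1] at h2
    simp only [Real.exp_neg, h1, h2]
    have h0 := (hpos _ ht).ne'
    field_simp

lemma div_three_le_of_le_limitForce {α : ℝ} (hα : 0 < α) {g g₁ g₂ : ℝ → ℝ}
    (hg : ∀ x, HasDerivAt g (g₁ x) x) (hg₁ : ∀ x, HasDerivAt g₁ (g₂ x) x)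
    (hlog : ∀ x, Real.log α ≤ g x) (hg₂ : ∀ x, g₂ x ≤ limitForce α (g x) x) (x : ℝ) :
    x / 3 ≤ g x := by
  set c := |Real.log α| with hc
  have hc0 : 0 ≤ c := abs_nonneg _
  have hlim : Tendsto (fun X => 144 * (1 + c) * Real.exp (4 / 3) * Real.exp (-X)) atTop
      (𝓝 (144 * (1 + c) * Real.exp (4 / 3) * 0)) :=
    Real.tendsto_exp_neg_atTop_nhds_zero.const_mul _
  rw [mul_zero] at hlim
  suffices h : x / 3 - g x ≤ 0 by linarith
  refine ge_of_tendsto hlim ?_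
  filter_upwards [eventually_ge_atTop (max 0 (x + 1))] with X hX
  have hX0 : 0 ≤ X := (le_max_left _ _).trans hX
  have hX1 : x ≤ X - 1 := by linarith [(le_max_right 0 (x + 1)).trans hX]
  have h1 := sub_le_of_limitForce (α := α) (X := X) (M := X / 3 + c) (p := 0)
    (f := fun x => x / 3) (f₁ := fun _ => 1 / 3) (f₂ := fun _ => 0) hα (by positivity) le_rfl
    (fun x => (hasDerivAt_id x).div_const 3) (fun x => hasDerivAt_const x _) hg hg₁
    (fun x _ => hlog x)
    (fun x _ => by
      have h2 : Real.exp (2 * (x / 3)) = Real.exp (x - x / 3) := by ring_nf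
      rw [limitForce, h2]
      have := mul_pos hα (Real.exp_pos (x / 3))
      linarith)
    (fun x _ => hg₂ x)
    (fun y hy => by
      have h3 := hlog y
      have h4 := neg_abs_le (Real.log α)
      linarith) x hX1
  refine h1.trans ?_
  have h5 : X / 3 + c ≤ (1 + c) * Real.exp (X / 3) := by
    nlinarith [Real.add_one_le_exp (X / 3)]
  have h6 : Real.exp (-(4 * (X - 1) / 3))
      = Real.exp (4 / 3) * Real.exp (-X) * Real.exp (-(X / 3)) := by
    rw [← Real.exp_add, ← Real.exp_add]
    ring_nf
  have h7 : Real.exp (X / 3) * Real.exp (-(X / 3)) = 1 := by rw [← Real.exp_add]; simp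
  rw [h6]
  calc 2 * 0 + 144 * (X / 3 + c) * (Real.exp (4 / 3) * Real.exp (-X) * Real.exp (-(X / 3)))
      ≤ 2 * 0 + 144 * ((1 + c) * Real.exp (X / 3))
        * (Real.exp (4 / 3) * Real.exp (-X) * Real.exp (-(X / 3))) := by gcongr
    _ = 144 * (1 + c) * Real.exp (4 / 3) * Real.exp (-X)
        * (Real.exp (X / 3) * Real.exp (-(X / 3))) := by ring
    _ = _ := by rw [h7, mul_one]

lemma exists_supersolution {α : ℝ} (hα : 0 < α) :
    ∃ g₁ g₂ : ℝ → ℝ,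
      (∀ x, HasDerivAt (fun x => Real.log (Real.exp (x / 3) + (α + 1))) (g₁ x) x) ∧
      (∀ x, HasDerivAt g₁ (g₂ x) x) ∧
      ∀ x, g₂ x ≤ limitForce α (Real.log (Real.exp (x / 3) + (α + 1))) x := by
  have hσ : ∀ x, HasDerivAt (fun x : ℝ => Real.exp (x / 3)) (Real.exp (x / 3) / 3) x := fun x =>
    (((hasDerivAt_id x).div_const 3).exp).congr_deriv (by simp [div_eq_mul_inv])
  have hZ : ∀ x : ℝ, 0 < Real.exp (x / 3) + (α + 1) := fun x => by positivity
  refine ⟨fun x => Real.exp (x / 3) / 3 / (Real.exp (x / 3) + (α + 1)),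
    fun x => Real.exp (x / 3) * (α + 1) / 9 / (Real.exp (x / 3) + (α + 1)) ^ 2,
    fun x => ((hσ x).add_const _).log (hZ x).ne', fun x => ?_, fun x => ?_⟩
  · refine (((hσ x).div_const 3).div ((hσ x).add_const _) (hZ x).ne').congr_deriv ?_
    have := (hZ x).ne'
    field_simp
    ring
  · have h1 : Real.exp (x - Real.log (Real.exp (x / 3) + (α + 1)))
        = Real.exp (x / 3) ^ 3 / (Real.exp (x / 3) + (α + 1)) := by
      rw [Real.exp_sub, Real.exp_log (hZ x), ← Real.exp_nat_mul]
      congr 2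
      push_cast
      ring
    beta_reduce
    rw [limitForce, two_mul, Real.exp_add, Real.exp_log (hZ x), h1]
    have hσ0 := Real.exp_pos (x / 3)
    generalize Real.exp (x / 3) = σ at *
    have h2 : σ * (α + 1) / 9 / (σ + (α + 1)) ^ 2 ≤ 1 := by
      rw [div_le_one (by positivity)]
      nlinarith [mul_pos hσ0 (show 0 < α + 1 by linarith)]
    refine h2.trans ?_
    have h3 : (σ + (α + 1)) * (σ + (α + 1)) - α * (σ + (α + 1)) - σ ^ 3 / (σ + (α + 1))
        = σ + (α + 1) + (α + 1) * ((σ + (α + 1)) * σ + σ ^ 2) / (σ + (α + 1)) := by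
      field_simp
      ring
    rw [h3]
    have h4 : 0 ≤ (α + 1) * ((σ + (α + 1)) * σ + σ ^ 2) / (σ + (α + 1)) := by positivity
    linarith

theorem IsLogProfile.exists_sub_le {α D : ℝ} (hα : 0 < α) (hD : 0 < D) :
    ∃ C > 0, ∀ n : ℕ, 1 ≤ n → ∀ f f₁ f₂ g g₁ g₂ : ℝ → ℝ, IsLogProfile α n f f₁ f₂ →
      (∀ x, HasDerivAt g (g₁ x) x) → (∀ x, HasDerivAt g₁ (g₂ x) x) →
      (∀ x, Real.log α ≤ g x) → (∀ x, g₂ x ≤ limitForce α (g x) x) →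
      ∀ x ≤ Real.log (2 * n * D), f x - g x ≤ C * (n : ℝ) ^ (-(1 : ℝ) / 3) := by
  set E := D * Real.exp 1 with hE
  have hE0 : 0 < E := by positivity
  set c₁ := (1 + α) + E / α with hc₁
  set c₂ := 3 + α + E / α + |Real.log α| with hc₂
  have hc₁0 : 0 < c₁ := by positivity
  have hc₂0 : 0 < c₂ := by positivity
  refine ⟨c₁ + 144 * c₂ * (2 * D) ^ (-(4 : ℝ) / 3), by positivity, ?_⟩
  intro n hn f f₁ f₂ g g₁ g₂ hf hg hg₁ hlog hg₂ x hx
  have hn1 : (1 : ℝ) ≤ n := by exact_mod_cast hn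
  have hn0 : (0 : ℝ) < n := by linarith
  have hXexp : Real.exp (Real.log (2 * n * D) + 1) = 2 * n * E := by
    rw [Real.exp_add, Real.exp_log (by positivity), hE]
    ring
  have hexp : ∀ x ≤ Real.log (2 * n * D) + 1, Real.exp x ≤ 2 * n * E := fun x hx =>
    (Real.exp_le_exp.2 hx).trans hXexp.le
  have h1 := sub_le_of_limitForce (α := α) (X := Real.log (2 * n * D) + 1) (M := c₂ * n)
    (p := c₁ / (2 * n)) hα (by positivity) (by positivity) hf.hasDerivAt hf.hasDerivAt' hg hg₁
    (fun x _ => hlog x)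
    (fun x hx => by
      refine le_trans ?_ (hf.limitForce_le x)
      refine sub_le_sub_left (mul_le_mul_of_nonneg_right ?_ (Real.exp_pos _).le) _
      have h2 : c₁ / (2 * n) = (1 + α) / (2 * n) + 2 * n * E / (4 * n ^ 2 * α) := by
        rw [hc₁]
        field_simp
        ring
      rw [h2]
      have := hexp x hx
      gcongr)
    (fun x _ => hg₂ x)
    (fun x hx => by
      have h2 := hf.exp_le x
      have h3 : Real.exp x / (2 * n * α) ≤ E / α := by
        rw [div_le_div_iff₀ (by positivity) hα]
        nlinarith [mul_le_mul_of_nonneg_right (hexp x hx) hα.le]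
      have h4 := Real.add_one_le_exp (f x)
      have h5 := hlog x
      have h6 := neg_abs_le (Real.log α)
      have h7 : 0 ≤ (1 + α + E / α + |Real.log α|) * (n - 1) :=
        mul_nonneg (by positivity) (by linarith)
      rw [hc₂]
      linarith) x (by linarith)
  refine h1.trans ?_
  have h2 : Real.exp (-(4 * (Real.log (2 * n * D) + 1 - 1) / 3))
      = (2 * D) ^ (-(4 : ℝ) / 3) * (n : ℝ) ^ (-(4 : ℝ) / 3) := by
    rw [← Real.mul_rpow (by positivity) hn0.le, Real.rpow_def_of_pos (by positivity)]
    ring_nf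
  have h3 : (n : ℝ) * (n : ℝ) ^ (-(4 : ℝ) / 3) = (n : ℝ) ^ (-(1 : ℝ) / 3) := by
    rw [← Real.rpow_one_add' hn0.le (by norm_num)]
    norm_num
  have h4 : 1 / (n : ℝ) ≤ (n : ℝ) ^ (-(1 : ℝ) / 3) := by
    rw [one_div, ← Real.rpow_neg_one]
    exact Real.rpow_le_rpow_of_exponent_le hn1 (by norm_num)
  rw [h2, add_mul c₁]
  refine add_le_add ?_ ?_
  · calc 2 * (c₁ / (2 * n)) = c₁ * (1 / n) := by field_simp
      _ ≤ _ := by gcongr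
  · rw [← h3]
    apply le_of_eq
    ring

/-! ### Convergence of the logarithmic profiles -/

lemma abs_deriv_le_of_abs_le {y y₁ y₂ : ℝ → ℝ} {x δ A K : ℝ} (hδ : 0 < δ)
    (hy : ∀ x, HasDerivAt y (y₁ x) x) (hy₁ : ∀ x, HasDerivAt y₁ (y₂ x) x)
    (h0 : |y x| ≤ A) (h1 : |y (x + δ)| ≤ A) (h2 : ∀ z ∈ Icc x (x + δ), |y₂ z| ≤ K) :
    |y₁ x| ≤ 2 * A / δ + δ * K := by
  have hlt : x < x + δ := by linarith
  obtain ⟨ξ, hξ, e⟩ := exists_hasDerivAt_eq_slope y y₁ hlt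
    (fun z _ => (hy z).continuousAt.continuousWithinAt) fun z _ => hy z
  obtain ⟨ζ, hζ, e'⟩ := exists_hasDerivAt_eq_slope y₁ y₂ hξ.1
    (fun z _ => (hy₁ z).continuousAt.continuousWithinAt) fun z _ => hy₁ z
  have h3 := h2 ζ ⟨hζ.1.le, (hζ.2.trans hξ.2).le⟩
  rw [eq_div_iff (sub_pos.2 hξ.1).ne'] at e'
  rw [add_sub_cancel_left] at e
  have h4 : |y₁ ξ| ≤ 2 * A / δ := by
    rw [e, abs_div, abs_of_pos hδ]
    refine div_le_div_of_nonneg_right ?_ hδ.le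
    linarith [abs_sub (y (x + δ)) (y x)]
  have h5 : |y₁ ξ - y₁ x| ≤ δ * K := by
    rw [← e', abs_mul, abs_of_pos (sub_pos.2 hξ.1), mul_comm]
    have := abs_nonneg (y₂ ζ)
    exact mul_le_mul (by linarith [hξ.2]) h3 this hδ.le
  have h6 : y₁ x = y₁ ξ - (y₁ ξ - y₁ x) := by ring
  rw [h6]
  linarith [abs_sub (y₁ ξ) (y₁ ξ - y₁ x)]

lemma exists_hasDerivAt_of_uniform_limit {f f₁ f₂ : ℕ → ℝ → ℝ} {W G : ℝ → ℝ}
    (hf : ∀ n x, HasDerivAt (f n) (f₁ n x) x) (hf₁ : ∀ n x, HasDerivAt (f₁ n) (f₂ n x) x)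
    (H : ∀ a, ∀ ε > 0, ∀ᶠ n in atTop, ∀ x ≤ a, |f n x - W x| ≤ ε ∧ |f₂ n x - G x| ≤ ε) :
    ∃ W₁ : ℝ → ℝ, (∀ x, HasDerivAt W (W₁ x) x) ∧ ∀ x, HasDerivAt W₁ (G x) x := by
  have hcauchy : ∀ a, ∀ ε > 0, ∃ N, ∀ n ≥ N, ∀ m ≥ N, ∀ x ≤ a, |f₁ n x - f₁ m x| ≤ ε := by
    intro a ε hε
    obtain ⟨N, hN⟩ := eventually_atTop.1 (H (a + 1) (ε / 6) (by positivity))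
    refine ⟨N, fun n hn m hm x hx => ?_⟩
    have h0 : ∀ z ≤ a + 1, |f n z - f m z| ≤ ε / 3 ∧ |f₂ n z - f₂ m z| ≤ ε / 3 := by
      intro z hz
      have h1 := hN n hn z hz
      have h2 := hN m hm z hz
      rw [abs_sub_comm] at h2
      rw [abs_sub_comm (f₂ m z)] at h2
      exact ⟨by linarith [abs_sub_le (f n z) (W z) (f m z)],
        by linarith [abs_sub_le (f₂ n z) (G z) (f₂ m z)]⟩
    have h3 := abs_deriv_le_of_abs_le (y := fun x => f n x - f m x)
      (y₁ := fun x => f₁ n x - f₁ m x) (y₂ := fun x => f₂ n x - f₂ m x) (δ := 1) (x := x)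
      one_pos (fun x => (hf n x).sub (hf m x)) (fun x => (hf₁ n x).sub (hf₁ m x))
      (h0 x (by linarith)).1 (h0 (x + 1) (by linarith)).1
      (fun z hz => (h0 z (by linarith [hz.2])).2)
    linarith
  have hlim : ∀ x, ∃ l, Tendsto (fun n => f₁ n x) atTop (𝓝 l) := by
    intro x
    refine cauchySeq_tendsto_of_complete (Metric.cauchySeq_iff.2 fun ε hε => ?_)
    obtain ⟨N, hN⟩ := hcauchy x (ε / 2) (by positivity)
    refine ⟨N, fun m hm n hn => ?_⟩
    rw [Real.dist_eq]
    linarith [hN m hm n hn x le_rfl]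
  choose W₁ hW₁ using hlim
  have hunif : ∀ a, TendstoUniformlyOn f₁ W₁ atTop (Iio a) := by
    intro a
    refine Metric.tendstoUniformlyOn_iff.2 fun ε hε => ?_
    obtain ⟨N, hN⟩ := hcauchy a (ε / 2) (by positivity)
    filter_upwards [eventually_ge_atTop N] with n hn x hx
    have h1 : |f₁ n x - W₁ x| ≤ ε / 2 := by
      refine le_of_tendsto ((tendsto_const_nhds.sub (hW₁ x)).abs) ?_
      filter_upwards [eventually_ge_atTop N] with m hm
      exact hN n hn m hm x (le_of_lt hx)
    rw [dist_comm, Real.dist_eq]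
    linarith
  refine ⟨W₁, fun x => ?_, fun x => ?_⟩
  · refine hasDerivAt_of_tendstoUniformlyOn isOpen_Iio (hunif (x + 1))
      (Eventually.of_forall fun n y _ => hf n y) (fun y _ => ?_) (show x < x + 1 by linarith)
    refine Metric.tendsto_atTop'.2 fun ε hε => ?_
    obtain ⟨N, hN⟩ := eventually_atTop.1 (H y (ε / 2) (by positivity))
    refine ⟨N, fun n hn => ?_⟩
    rw [Real.dist_eq]
    linarith [(hN n hn.le y le_rfl).1]
  · refine hasDerivAt_of_tendstoUniformlyOn (f := f₁) (f' := f₂) isOpen_Iio ?_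
      (Eventually.of_forall fun n y _ => hf₁ n y) (fun y _ => hW₁ y) (show x < x + 1 by linarith)
    refine Metric.tendstoUniformlyOn_iff.2 fun ε hε => ?_
    filter_upwards [H (x + 1) (ε / 2) (by positivity)] with n hn y hy
    rw [dist_comm, Real.dist_eq]
    linarith [(hn y (le_of_lt hy)).2]

lemma abs_limitForce_sub_le {α f g x : ℝ} (hα : 0 < α) (hg : Real.log α ≤ g) (hgf : g ≤ f) :
    |limitForce α f x - limitForce α g x|
      ≤ (2 * Real.exp f ^ 2 + α * Real.exp f + Real.exp x / α) * (f - g) := by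
  have hαg : α ≤ Real.exp g := (Real.log_le_iff_le_exp hα).1 hg
  have hE : Real.exp f - Real.exp g ≤ Real.exp f * (f - g) := by
    have h1 : Real.exp g = Real.exp f * Real.exp (g - f) := by rw [← Real.exp_add]; ring_nf
    rw [h1]
    nlinarith [Real.add_one_le_exp (g - f), Real.exp_pos f]
  have hE0 : Real.exp g ≤ Real.exp f := Real.exp_le_exp.2 hgf
  have e1 : Real.exp (2 * f) = Real.exp f ^ 2 := by rw [← Real.exp_nat_mul]; norm_num
  have e2 : Real.exp (2 * g) = Real.exp g ^ 2 := by rw [← Real.exp_nat_mul]; norm_num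
  have e3 : Real.exp (x - g) - Real.exp (x - f) ≤ Real.exp x / α * (f - g) := by
    have h1 : Real.exp (x - f) = Real.exp (x - g) * Real.exp (g - f) := by
      rw [← Real.exp_add]
      ring_nf
    have h2 : Real.exp (x - g) ≤ Real.exp x / α := by
      rw [Real.exp_sub]
      gcongr
    rw [h1]
    nlinarith [Real.add_one_le_exp (g - f), Real.exp_pos (x - g)]
  have e4 : Real.exp (x - f) ≤ Real.exp (x - g) := Real.exp_le_exp.2 (by linarith)
  have h5 : Real.exp f ^ 2 - Real.exp g ^ 2 ≤ 2 * Real.exp f ^ 2 * (f - g) := by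
    nlinarith [Real.exp_pos f, Real.exp_pos g]
  have h6 : Real.exp g ^ 2 ≤ Real.exp f ^ 2 := by gcongr
  have h7 : 0 ≤ α * (Real.exp f - Real.exp g) := mul_nonneg hα.le (sub_nonneg.2 hE0)
  have h8 : α * (Real.exp f - Real.exp g) ≤ α * (Real.exp f * (f - g)) :=
    mul_le_mul_of_nonneg_left hE hα.le
  have h9 : 0 ≤ α * (Real.exp f * (f - g)) := h7.trans h8
  have h10 : 0 ≤ Real.exp x / α * (f - g) := by
    have := sub_nonneg.2 hgf
    positivity
  have h11 : 0 ≤ 2 * Real.exp f ^ 2 * (f - g) := by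
    have := sub_nonneg.2 hgf
    positivity
  simp only [limitForce, e1, e2]
  rw [abs_le]
  constructor <;> linarith

theorem exists_limit_profile {α : ℝ} (hα : 0 < α) {f f₁ f₂ : ℕ → ℝ → ℝ}
    (hf : ∀ n, 1 ≤ n → IsLogProfile α n (f n) (f₁ n) (f₂ n)) :
    ∃ W W₁ : ℝ → ℝ, (∀ x, HasDerivAt W (W₁ x) x) ∧
      (∀ x, HasDerivAt W₁ (limitForce α (W x) x) x) ∧ (∀ x, Real.log α ≤ W x) ∧
      (∀ x, W x ≤ Real.log (Real.exp (x / 3) + (α + 1))) ∧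
      ∀ D > 0, ∃ C > 0, ∀ n : ℕ, 1 ≤ n → ∀ x ≤ Real.log (2 * n * D),
        |f n x - W x| ≤ C * (n : ℝ) ^ (-(1 : ℝ) / 3) := by
  set W : ℝ → ℝ := fun x => ⨅ n : ℕ, f (n + 1) x with hWdef
  have hbdd : ∀ x, BddBelow (range fun n : ℕ => f (n + 1) x) := by
    rintro x
    refine ⟨Real.log α, ?_⟩
    rintro _ ⟨n, rfl⟩
    exact (hf (n + 1) (by omega)).log_le x
  have hWf : ∀ n, 1 ≤ n → ∀ x, W x ≤ f n x := by
    intro n hn x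
    obtain ⟨m, rfl⟩ : ∃ m, n = m + 1 := ⟨n - 1, by omega⟩
    exact ciInf_le (hbdd x) m
  have hlogW : ∀ x, Real.log α ≤ W x := fun x =>
    le_ciInf fun n => (hf (n + 1) (by omega)).log_le x
  have hrate : ∀ D > 0, ∃ C > 0, ∀ n : ℕ, 1 ≤ n → ∀ x ≤ Real.log (2 * n * D),
      f n x - W x ≤ C * (n : ℝ) ^ (-(1 : ℝ) / 3) := by
    intro D hD
    obtain ⟨C, hC, h⟩ := IsLogProfile.exists_sub_le hα hD
    refine ⟨C, hC, fun n hn x hx => ?_⟩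
    have h1 : f n x - C * (n : ℝ) ^ (-(1 : ℝ) / 3) ≤ W x := le_ciInf fun m => by
      have hm := hf (m + 1) (by omega)
      linarith [h n hn _ _ _ _ _ _ (hf n hn) hm.hasDerivAt hm.hasDerivAt' hm.log_le
        hm.le_limitForce x hx]
    linarith
  have hzero : Tendsto (fun n : ℕ => (n : ℝ) ^ (-(1 : ℝ) / 3)) atTop (𝓝 0) := by
    simpa [neg_div, Function.comp_def] using
      (tendsto_rpow_neg_atTop (show (0 : ℝ) < 1 / 3 by norm_num)).comp tendsto_natCast_atTop_atTop
  have hdom : ∀ a, ∀ᶠ n : ℕ in atTop, 1 ≤ n ∧ a ≤ Real.log (2 * n * 1) := by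
    intro a
    refine (eventually_ge_atTop 1).and ?_
    have : Tendsto (fun n : ℕ => Real.log (2 * n * 1)) atTop atTop := by
      simp only [mul_one]
      exact Real.tendsto_log_atTop.comp
        (tendsto_natCast_atTop_atTop.const_mul_atTop two_pos)
    exact this.eventually_ge_atTop a
  have hupper : ∀ x, W x ≤ Real.log (Real.exp (x / 3) + (α + 1)) := by
    intro x
    obtain ⟨g₁, g₂, hg, hg₁, hg₂⟩ := exists_supersolution hα
    obtain ⟨C, hC, h⟩ := IsLogProfile.exists_sub_le hα one_pos
    have hlim : Tendsto (fun n : ℕ => C * (n : ℝ) ^ (-(1 : ℝ) / 3)) atTop (𝓝 (C * 0)) :=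
      hzero.const_mul C
    rw [mul_zero] at hlim
    have h1 : W x - Real.log (Real.exp (x / 3) + (α + 1)) ≤ 0 := by
      refine ge_of_tendsto hlim ?_
      filter_upwards [hdom x] with n hn
      have h2 := h n hn.1 _ _ _ _ _ _ (hf n hn.1) hg hg₁
        (fun x => Real.log_le_log hα (by linarith [Real.exp_pos (x / 3)])) hg₂ x hn.2
      linarith [hWf n hn.1 x]
    linarith
  have hlimit : ∀ a, ∀ ε > 0, ∀ᶠ n : ℕ in atTop, ∀ x ≤ a, |f (n + 1) x - W x| ≤ ε
      ∧ |f₂ (n + 1) x - limitForce α (W x) x| ≤ ε := by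
    intro a ε hε
    obtain ⟨C, hC, h⟩ := hrate 1 one_pos
    set b := 3 + α + Real.exp a / α + 1 with hb
    set K := 2 * (b * Real.exp 1) ^ 2 + α * (b * Real.exp 1) + Real.exp a / α with hK
    have hb0 : 0 < b := by positivity
    have hK0 : 0 < K := by positivity
    have hpn : Tendsto (fun n : ℕ => ((1 + α) / 2 + Real.exp a / (4 * α)) * (Real.exp a / α)
        * (n : ℝ)⁻¹) atTop (𝓝 (((1 + α) / 2 + Real.exp a / (4 * α)) * (Real.exp a / α) * 0)) :=
      tendsto_inv_atTop_nhds_zero_nat.const_mul _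
    have hCn : Tendsto (fun n : ℕ => C * (n : ℝ) ^ (-(1 : ℝ) / 3)) atTop (𝓝 (C * 0)) :=
      hzero.const_mul C
    rw [mul_zero] at hpn hCn
    have hev := ((hdom a).and (hpn.eventually_le_const (half_pos hε))).and
      (hCn.eventually_le_const (show 0 < min (min ε 1) (ε / 2 / K) by positivity))
    filter_upwards [(tendsto_add_atTop_nat 1).eventually hev] with n hn x hx
    obtain ⟨⟨⟨hn1, hna⟩, hnp⟩, hnC⟩ := hn
    set m := n + 1 with hm
    have hmp := hf m hn1
    have hm1 : (1 : ℝ) ≤ m := by exact_mod_cast hn1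
    have hd := h m hn1 x (hx.trans hna)
    have hd0 := sub_nonneg.2 (hWf m hn1 x)
    have hC1 : C * (m : ℝ) ^ (-(1 : ℝ) / 3) ≤ ε :=
      hnC.trans ((min_le_left _ _).trans (min_le_left _ _))
    have hC2 : C * (m : ℝ) ^ (-(1 : ℝ) / 3) ≤ 1 :=
      hnC.trans ((min_le_left _ _).trans (min_le_right _ _))
    have hC3 : C * (m : ℝ) ^ (-(1 : ℝ) / 3) ≤ ε / 2 / K := hnC.trans (min_le_right _ _)
    have hxa : Real.exp x ≤ Real.exp a := Real.exp_le_exp.2 hx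
    refine ⟨by rw [abs_of_nonneg hd0]; linarith, ?_⟩
    have hfb : Real.exp (f m x) ≤ b * Real.exp 1 := by
      have h1 : Real.exp (f m x) ≤ Real.exp (W x) * Real.exp 1 := by
        rw [← Real.exp_add]
        exact Real.exp_le_exp.2 (by linarith)
      have h2 : Real.exp (W x) ≤ b := by
        have h3 := (Real.exp_le_exp.2 (hWf 1 le_rfl x)).trans ((hf 1 le_rfl).exp_le x)
        have h4 : Real.exp x / (2 * (1 : ℕ) * α) ≤ Real.exp a / α := by
          push_cast
          exact div_le_div₀ (Real.exp_pos a).le hxa hα (by linarith)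
        push_cast at h3 h4
        linarith
      exact h1.trans (mul_le_mul_of_nonneg_right h2 (Real.exp_pos 1).le)
    have hG : |limitForce α (f m x) x - limitForce α (W x) x| ≤ ε / 2 := by
      refine (abs_limitForce_sub_le hα (hlogW x) (hWf m hn1 x)).trans ?_
      calc _ ≤ K * (f m x - W x) := by
            refine mul_le_mul_of_nonneg_right ?_ hd0
            rw [hK]
            gcongr
        _ ≤ K * (ε / 2 / K) := mul_le_mul_of_nonneg_left (hd.trans hC3) hK0.le
        _ = ε / 2 := by field_simp
    have hF : |f₂ m x - limitForce α (f m x) x| ≤ ε / 2 := by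
      rw [abs_sub_comm, abs_of_nonneg (sub_nonneg.2 (hmp.le_limitForce x))]
      have h1 := hmp.limitForce_le x
      have h2 : Real.exp (x - f m x) ≤ Real.exp a / α := by
        rw [Real.exp_sub]
        exact div_le_div₀ (Real.exp_pos a).le hxa hα ((Real.log_le_iff_le_exp hα).1 (hmp.log_le x))
      have h3 : (1 + α) / (2 * (m : ℝ)) + Real.exp x / (4 * (m : ℝ) ^ 2 * α)
          ≤ ((1 + α) / 2 + Real.exp a / (4 * α)) * (m : ℝ)⁻¹ := by
        rw [add_mul]
        refine add_le_add (le_of_eq (by field_simp)) ?_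
        rw [← div_eq_mul_inv, div_div]
        exact div_le_div₀ (Real.exp_pos a).le hxa (by positivity)
          (by
            have := mul_nonneg (mul_nonneg hα.le (by linarith : (0 : ℝ) ≤ m)) (sub_nonneg.2 hm1)
            nlinarith)
      have h4 := mul_le_mul h3 h2 (Real.exp_pos _).le (by positivity)
      have h5 : ((1 + α) / 2 + Real.exp a / (4 * α)) * (m : ℝ)⁻¹ * (Real.exp a / α)
        = ((1 + α) / 2 + Real.exp a / (4 * α)) * (Real.exp a / α) * (m : ℝ)⁻¹ := by ring
      linarith
    linarith [abs_sub_le (f₂ m x) (limitForce α (f m x) x) (limitForce α (W x) x)]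
  obtain ⟨W₁, hW, hW₁⟩ := exists_hasDerivAt_of_uniform_limit
    (fun n x => (hf (n + 1) (by omega)).hasDerivAt x)
    (fun n x => (hf (n + 1) (by omega)).hasDerivAt' x) hlimit
  refine ⟨W, W₁, hW, hW₁, hlogW, hupper, fun D hD => ?_⟩
  obtain ⟨C, hC, h⟩ := hrate D hD
  refine ⟨C, hC, fun n hn x hx => ?_⟩
  rw [abs_of_nonneg (sub_nonneg.2 (hWf n hn x))]
  exact h n hn x hx

/-! ### The limiting profile -/

section Limit

variable {α : ℝ} {W W₁ : ℝ → ℝ}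

lemma hasDerivAt_exp_neg_profile (hW : ∀ x, HasDerivAt W (W₁ x) x) {s : ℝ} (hs : 0 < s) :
    HasDerivAt (fun s => Real.exp (-W (Real.log s)))
      (-(W₁ (Real.log s) * Real.exp (-W (Real.log s)) / s)) s :=
  ((((hW _).comp s (Real.hasDerivAt_log hs.ne')).neg).exp).congr_deriv (by
    simp only [Pi.neg_apply, Function.comp_apply]
    field_simp)

lemma contDiff_profile (hW : ∀ x, HasDerivAt W (W₁ x) x)
    (hW₁ : ∀ x, HasDerivAt W₁ (limitForce α (W x) x) x) :
    ContDiff ℝ (⊤ : ℕ∞) W ∧ ContDiff ℝ (⊤ : ℕ∞) W₁ := by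
  have hdW : deriv W = W₁ := funext fun x => (hW x).deriv
  have hdW₁ : deriv W₁ = fun x => limitForce α (W x) x := funext fun x => (hW₁ x).deriv
  have key : ∀ k : ℕ, ContDiff ℝ k W ∧ ContDiff ℝ k W₁ := by
    intro k
    induction k with
    | zero =>
      have h1 : Continuous W := continuous_iff_continuousAt.2 fun x => (hW x).continuousAt
      have h2 : Continuous W₁ := continuous_iff_continuousAt.2 fun x => (hW₁ x).continuousAt
      exact ⟨contDiff_zero.2 h1, contDiff_zero.2 h2⟩
    | succ k ih =>
      have h1 : ContDiff ℝ k fun x => limitForce α (W x) x := by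
        have := ih.1
        unfold limitForce
        fun_prop
      push_cast
      refine ⟨contDiff_succ_iff_deriv.2 ⟨fun x => (hW x).differentiableAt, by simp, ?_⟩,
        contDiff_succ_iff_deriv.2 ⟨fun x => (hW₁ x).differentiableAt, by simp, ?_⟩⟩
      · rw [hdW]
        exact ih.2
      · rw [hdW₁]
        exact h1
  exact ⟨contDiff_infty.2 fun k => (key k).1, contDiff_infty.2 fun k => (key k).2⟩

lemma exp_profile_sq (w : ℝ) : Real.exp (2 * w) = Real.exp w ^ 2 := by
  rw [← Real.exp_nat_mul]
  norm_num

lemma tendsto_profile_atBot (hα : 0 < α) (hW : ∀ x, HasDerivAt W (W₁ x) x)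
    (hW₁ : ∀ x, HasDerivAt W₁ (limitForce α (W x) x) x) (hlog : ∀ x, Real.log α ≤ W x)
    (hup : ∀ x, W x ≤ Real.log (Real.exp (x / 3) + (α + 1))) :
    Tendsto W atBot (𝓝 (Real.log α)) ∧ Tendsto W₁ atBot (𝓝 0) := by
  have hup0 : ∀ x ≤ 0, W x ≤ Real.log (α + 2) := fun x hx => (hup x).trans <|
    Real.log_le_log (by positivity) (by linarith [Real.exp_le_one_iff.2 (by linarith : x / 3 ≤ 0)])
  set β := min (α / 2) 1 with hβ
  have hβ0 : 0 < β := by positivity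
  have hβα : β ≤ α / 2 := min_le_left _ _
  have hβ1 : β ≤ 1 := min_le_right _ _
  have hlog2 : Real.log α ≤ Real.log (α + 2) := Real.log_le_log hα (by linarith)
  set K := 2 / α ^ 3 + (Real.log (α + 2) - Real.log α) with hK
  have hK1 : 2 / α ^ 3 ≤ K := by rw [hK]; linarith
  have hK0 : 0 < K := lt_of_lt_of_le (by positivity) hK1
  have hKα : 2 ≤ K * α ^ 3 := by rwa [div_le_iff₀ (by positivity)] at hK1
  have hβx : ∀ x, HasDerivAt (fun x => Real.exp (β * x)) (β * Real.exp (β * x)) x := fun x =>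
    (((hasDerivAt_id x).const_mul β).exp).congr_deriv (by simp [mul_comm])
  have hdecay : ∀ x ≤ 0, W x - Real.log α - K * Real.exp (β * x) ≤ 0 := by
    refine nonpos_of_deriv_deriv_pos (M := Real.log (α + 2) - Real.log α)
      (u₁ := fun x => W₁ x - K * (β * Real.exp (β * x)))
      (u₂ := fun x => limitForce α (W x) x - K * (β * (β * Real.exp (β * x))))
      (fun x => ((hW x).sub_const _).sub ((hβx x).const_mul K))
      (fun x => (hW₁ x).sub (((hβx x).const_mul β).const_mul K)) ?_ ?_
    · intro x hx
      have := mul_pos hK0 (Real.exp_pos (β * x))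
      linarith [hup0 x hx]
    · intro x hx hpos
      constructor
      · refine hx.lt_of_ne ?_
        rintro rfl
        have h1 := hup0 0 le_rfl
        have h2 : 0 < 2 / α ^ 3 := by positivity
        rw [mul_zero, Real.exp_zero, hK] at hpos
        linarith
      · have hE : Real.exp x ≤ Real.exp (β * x) := Real.exp_le_exp.2 (by nlinarith)
        have hZα : α ≤ Real.exp (W x) := (Real.log_le_iff_le_exp hα).1 (hlog x)
        have h1 : α * (W x - Real.log α) ≤ Real.exp (W x) - α := by
          have h2 := Real.add_one_le_exp (W x - Real.log α)
          rw [Real.exp_sub, Real.exp_log hα, le_div_iff₀ hα] at h2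
          linarith
        have h3 : Real.exp (x - W x) ≤ Real.exp x / α := by
          rw [Real.exp_sub]
          gcongr
        have h4 : α * (α * (W x - Real.log α)) ≤ Real.exp (2 * W x) - α * Real.exp (W x) := by
          rw [exp_profile_sq]
          have h5 : 0 ≤ α * (W x - Real.log α) := mul_nonneg hα.le (by linarith [hlog x])
          nlinarith
        have hEpos := Real.exp_pos (β * x)
        have h6 : α * (α * (K * Real.exp (β * x))) < α * (α * (W x - Real.log α)) := by
          gcongr
          linarith
        have h7 : Real.exp x / α ≤ Real.exp (β * x) / α := by gcongr
        have h8 : Real.exp (β * x) / α ≤ K * α ^ 2 / 2 * Real.exp (β * x) := by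
          rw [div_le_iff₀ hα]
          nlinarith
        have h9 : K * (β * (β * Real.exp (β * x))) ≤ K * α ^ 2 / 4 * Real.exp (β * x) := by
          have h10 : β * β ≤ α / 2 * (α / 2) := by gcongr
          have h11 : 0 ≤ K * Real.exp (β * x) := by positivity
          nlinarith
        have h12 : 0 < K * α ^ 2 * Real.exp (β * x) := by positivity
        simp only [limitForce]
        nlinarith
  have hexp0 : Tendsto (fun x => Real.exp (β * x)) atBot (𝓝 0) :=
    Real.tendsto_exp_atBot.comp (tendsto_id.const_mul_atBot hβ0)
  constructor
  · have h1 : Tendsto (fun x => Real.log α + K * Real.exp (β * x)) atBot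
        (𝓝 (Real.log α + K * 0)) := tendsto_const_nhds.add (hexp0.const_mul K)
    rw [mul_zero, add_zero] at h1
    refine tendsto_of_tendsto_of_tendsto_of_le_of_le' tendsto_const_nhds h1
      (Eventually.of_forall hlog) ?_
    filter_upwards [eventually_le_atBot 0] with x hx
    linarith [hdecay x hx]
  · set L := 2 * (α + 2) ^ 2 + α * (α + 2) + 1 / α with hL
    have hL0 : 0 < L := by positivity
    have hbound : ∀ x ≤ -1, |W₁ x| ≤ (2 * K + L * K) * (Real.exp β * Real.exp (β * x))
        + Real.exp 1 / α * Real.exp x := by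
      intro x hx
      have hy : ∀ z ≤ x + 1, |W z - Real.log α| ≤ K * (Real.exp β * Real.exp (β * x)) := by
        intro z hz
        rw [abs_of_nonneg (sub_nonneg.2 (hlog z)), ← Real.exp_add]
        have h1 := hdecay z (by linarith)
        have h2 : K * Real.exp (β * z) ≤ K * Real.exp (β + β * x) := by
          gcongr
          nlinarith
        linarith
      have hG : ∀ z ∈ Icc x (x + 1), |limitForce α (W z) z|
          ≤ L * (K * (Real.exp β * Real.exp (β * x))) + Real.exp 1 / α * Real.exp x := by
        intro z hz
        have hz0 : z ≤ 0 := by linarith [hz.2]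
        have h1 := abs_limitForce_sub_le (x := z) hα le_rfl (hlog z)
        have h2 : |limitForce α (Real.log α) z| ≤ Real.exp 1 / α * Real.exp x := by
          have h3 : limitForce α (Real.log α) z = -(Real.exp z / α) := by
            rw [limitForce, exp_profile_sq, Real.exp_sub, Real.exp_log hα]
            ring
          rw [h3, abs_neg, abs_of_pos (by positivity), div_mul_eq_mul_div, ← Real.exp_add]
          gcongr
          linarith [hz.2]
        have h4 : 2 * Real.exp (W z) ^ 2 + α * Real.exp (W z) + Real.exp z / α ≤ L := by
          have h5 : Real.exp (W z) ≤ α + 2 := by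
            rw [← Real.le_log_iff_exp_le (by positivity)]
            exact hup0 z hz0
          have h6 : Real.exp z ≤ 1 := Real.exp_le_one_iff.2 hz0
          rw [hL]
          gcongr
        have h7 := hy z hz.2
        rw [abs_of_nonneg (sub_nonneg.2 (hlog z))] at h7
        have h8 := mul_le_mul h4 h7 (sub_nonneg.2 (hlog z)) hL0.le
        have h9 := abs_sub_abs_le_abs_sub (limitForce α (W z) z) (limitForce α (Real.log α) z)
        linarith
      have h1 := abs_deriv_le_of_abs_le (y := fun x => W x - Real.log α) (δ := 1) one_pos
        (fun x => (hW x).sub_const _) hW₁ (hy x (by linarith)) (hy (x + 1) le_rfl) hG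
      linarith
    have hlim : Tendsto (fun x => (2 * K + L * K) * (Real.exp β * Real.exp (β * x))
        + Real.exp 1 / α * Real.exp x) atBot
        (𝓝 ((2 * K + L * K) * (Real.exp β * 0) + Real.exp 1 / α * 0)) :=
      ((hexp0.const_mul _).const_mul _).add (Real.tendsto_exp_atBot.const_mul _)
    simp only [mul_zero, add_zero] at hlim
    refine squeeze_zero_norm' ?_ hlim
    filter_upwards [eventually_le_atBot (-1)] with x hx
    exact hbound x hx

lemma exists_abs_deriv_profile_le (hα : 0 < α) (hW : ∀ x, HasDerivAt W (W₁ x) x)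
    (hW₁ : ∀ x, HasDerivAt W₁ (limitForce α (W x) x) x) (hlow : ∀ x, x / 3 ≤ W x)
    (hup : ∀ x, W x ≤ Real.log (Real.exp (x / 3) + (α + 1))) :
    ∃ M > 0, ∀ x ≥ 0, |W₁ x| ≤ M := by
  set K := α + 1 with hK
  have hK0 : 0 < K := by positivity
  have hZ : ∀ x, Real.exp (W x) ≤ Real.exp (x / 3) + K := fun x =>
    (Real.le_log_iff_exp_le (by positivity)).1 (hup x)
  refine ⟨1 / 3 + (2 * K + 3 * K * (K + 1) * Real.exp 1), by positivity, fun x hx => ?_⟩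
  have hy : ∀ z, x ≤ z → |W z - z / 3| ≤ K * Real.exp (-(x / 3)) := by
    intro z hz
    rw [abs_of_nonneg (sub_nonneg.2 (hlow z))]
    have h1 := Real.add_one_le_exp (W z - z / 3)
    rw [Real.exp_sub] at h1
    have h2 : Real.exp (W z) / Real.exp (z / 3) ≤ 1 + K * Real.exp (-(z / 3)) := by
      rw [div_le_iff₀ (Real.exp_pos _), add_mul, mul_assoc, ← Real.exp_add, neg_add_cancel,
        Real.exp_zero, one_mul, mul_one]
      exact hZ z
    have h3 : K * Real.exp (-(z / 3)) ≤ K * Real.exp (-(x / 3)) := by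
      gcongr
    linarith
  have hδ1 : Real.exp (-(x / 3)) ≤ 1 := Real.exp_le_one_iff.2 (by linarith)
  have hG : ∀ z ∈ Icc x (x + Real.exp (-(x / 3))), |limitForce α (W z) z|
      ≤ 3 * K * (K + 1) * Real.exp 1 * Real.exp (x / 3) := by
    intro z hz
    have hσ1 : 1 ≤ Real.exp (z / 3) := Real.one_le_exp (by linarith [hz.1])
    have hσ2 : Real.exp (z / 3) ≤ Real.exp 1 * Real.exp (x / 3) := by
      rw [← Real.exp_add]
      exact Real.exp_le_exp.2 (by linarith [hz.2])
    have hlz : Real.exp (z / 3) ≤ Real.exp (W z) := Real.exp_le_exp.2 (hlow z)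
    have hzz := hZ z
    have h1 : limitForce α (W z) z = (Real.exp (W z) - Real.exp (z / 3))
        * (Real.exp (W z) ^ 2 + Real.exp (W z) * Real.exp (z / 3) + Real.exp (z / 3) ^ 2)
        / Real.exp (W z) - α * Real.exp (W z) := by
      have h2 : Real.exp z = Real.exp (z / 3) ^ 3 := by
        rw [← Real.exp_nat_mul]
        congr 1
        push_cast
        ring
      rw [limitForce, exp_profile_sq, Real.exp_sub, h2]
      field_simp
      ring
    have h3 : |limitForce α (W z) z| ≤ 3 * K * (K + 1) * Real.exp (z / 3) := by
      rw [h1]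
      generalize Real.exp (W z) = Z at *
      generalize Real.exp (z / 3) = σ at *
      have hZ0 : 0 < Z := by linarith
      have h4 : (Z - σ) * (Z ^ 2 + Z * σ + σ ^ 2) / Z ≤ 3 * K * Z := by
        rw [div_le_iff₀ hZ0]
        have h5 : Z ^ 2 + Z * σ + σ ^ 2 ≤ 3 * Z ^ 2 := by nlinarith
        have h6 := mul_le_mul (show Z - σ ≤ K by linarith) h5 (by positivity) hK0.le
        linarith
      have h7 : 0 ≤ (Z - σ) * (Z ^ 2 + Z * σ + σ ^ 2) / Z := by
        have := sub_nonneg.2 hlz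
        positivity
      have h8 : Z ≤ (K + 1) * σ := by nlinarith
      have h9 : 3 * K * Z ≤ 3 * K * ((K + 1) * σ) := by gcongr
      have h10 : α * Z ≤ 3 * K * Z := by
        gcongr
        linarith
      have h11 : 0 < α * Z := by positivity
      rw [abs_le]
      constructor <;> linarith
    refine h3.trans ?_
    rw [mul_assoc (3 * K * (K + 1))]
    gcongr
  have h1 := abs_deriv_le_of_abs_le (y := fun x => W x - x / 3) (y₁ := fun x => W₁ x - 1 / 3)
    (Real.exp_pos (-(x / 3))) (fun x => (hW x).sub ((hasDerivAt_id x).div_const 3))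
    (fun x => (hW₁ x).sub_const _) (hy x le_rfl) (hy _ (by linarith [Real.exp_pos (-(x / 3))])) hG
  have h2 : 2 * (K * Real.exp (-(x / 3))) / Real.exp (-(x / 3)) = 2 * K := by
    field_simp
  have h3 : Real.exp (-(x / 3)) * (3 * K * (K + 1) * Real.exp 1 * Real.exp (x / 3))
      = 3 * K * (K + 1) * Real.exp 1 := by
    have h4 : Real.exp (-(x / 3)) * Real.exp (x / 3) = 1 := by rw [← Real.exp_add]; simp
    linear_combination (3 * K * (K + 1) * Real.exp 1) * h4
  rw [h2, h3] at h1
  have h5 := abs_add_le (W₁ x - 1 / 3) (1 / 3)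
  rw [sub_add_cancel, abs_of_pos (show (0 : ℝ) < 1 / 3 by norm_num)] at h5
  linarith

end Limit

/-! ### The solution of the third-order equation -/

section ThirdOrder

variable {α : ℝ} {W W₁ : ℝ → ℝ}

lemma exists_third_order_solution (hα : 0 < α) (hW : ∀ x, HasDerivAt W (W₁ x) x)
    (hW₁ : ∀ x, HasDerivAt W₁ (limitForce α (W x) x) x) (hlog : ∀ x, Real.log α ≤ W x)
    (hlow : ∀ x, x / 3 ≤ W x) (hup : ∀ x, W x ≤ Real.log (Real.exp (x / 3) + (α + 1))) :
    ∃ r : ℝ → ℝ, (∀ s > 0, ContDiffAt ℝ (⊤ : ℕ∞) r s) ∧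
      (∀ s > 0, 2 * s ^ 2 * deriv r s * deriv (deriv (deriv r)) s
        - s ^ 2 * (deriv (deriv r) s) ^ 2 + 2 * s * deriv r s * deriv (deriv r) s
        - 4 * s * (deriv r s) ^ 3 + (2 * r s - 1 / 4) * (deriv r s) ^ 2 + 1 = 0) ∧
      Tendsto r (𝓝[>] 0) (𝓝 ((1 - 4 * α ^ 2) / 8)) ∧
      (∃ M > 0, ∃ s₁ > 0, ∀ s ≥ s₁,
        |r s - ((3 / 2) * s ^ ((2 : ℝ) / 3) - α * s ^ ((1 : ℝ) / 3))| ≤ M) ∧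
      ∀ s > 0, deriv r s = Real.exp (-W (Real.log s)) := by
  set ρ : ℝ → ℝ := fun x => 1 / 8 + (Real.exp (2 * W x) - 2 * α * Real.exp (W x)
    + 2 * Real.exp (x - W x) - W₁ x ^ 2) / 2 with hρ
  have hρd : ∀ x, HasDerivAt ρ (Real.exp (x - W x)) x := fun x =>
    ((((((hW x).const_mul 2).exp.sub ((hW x).exp.const_mul (2 * α))).add
      (((hasDerivAt_id x).sub (hW x)).exp.const_mul 2)).sub ((hW₁ x).pow 2)).div_const 2
      |>.const_add (1 / 8)).congr_deriv (by
        simp only [limitForce, Pi.sub_apply, id_eq]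
        push_cast
        ring)
  have hd1 : ∀ s > 0, HasDerivAt (fun s => ρ (Real.log s)) (Real.exp (-W (Real.log s))) s := by
    intro s hs
    refine ((hρd _).comp s (Real.hasDerivAt_log hs.ne')).congr_deriv ?_
    rw [sub_eq_add_neg, Real.exp_add, Real.exp_log hs]
    field_simp
  have hev : ∀ {u v : ℝ → ℝ}, (∀ s > 0, u s = v s) → ∀ s > 0, u =ᶠ[𝓝 s] v := fun h s hs =>
    (eventually_gt_nhds hs).mono fun z hz => h z hz
  have hr1 : ∀ s > 0, deriv (fun s => ρ (Real.log s)) s = Real.exp (-W (Real.log s)) :=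
    fun s hs => (hd1 s hs).deriv
  have hr2 : ∀ s > 0, deriv (deriv fun s => ρ (Real.log s)) s
      = -(W₁ (Real.log s) * Real.exp (-W (Real.log s)) / s) := fun s hs => by
    rw [(hev hr1 s hs).deriv_eq, (hasDerivAt_exp_neg_profile hW hs).deriv]
  have hr3 : ∀ s > 0, deriv (deriv (deriv fun s => ρ (Real.log s))) s
      = Real.exp (-W (Real.log s)) * (-limitForce α (W (Real.log s)) (Real.log s)
        + W₁ (Real.log s) ^ 2 + W₁ (Real.log s)) / s ^ 2 := fun s hs => by
    rw [(hev hr2 s hs).deriv_eq]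
    refine HasDerivAt.deriv (((((hW₁ _).comp s (Real.hasDerivAt_log hs.ne')).mul
      (hasDerivAt_exp_neg_profile hW hs)).div (hasDerivAt_id s) hs.ne').neg.congr_deriv ?_)
    simp only [Pi.mul_apply, Function.comp_apply, id_eq]
    field_simp
    ring
  refine ⟨fun s => ρ (Real.log s), ?_, ?_, ?_, ?_, hr1⟩
  · intro s hs
    obtain ⟨h1, h2⟩ := contDiff_profile hW hW₁
    have h3 : ContDiff ℝ (⊤ : ℕ∞) ρ := by
      rw [hρ]
      fun_prop
    exact h3.contDiffAt.comp s (Real.contDiffAt_log.2 hs.ne')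
  · intro s hs
    rw [hr1 s hs, hr2 s hs, hr3 s hs]
    simp only [hρ, limitForce, exp_profile_sq, Real.exp_sub, Real.exp_neg, Real.exp_log hs]
    have := Real.exp_pos (W (Real.log s))
    field_simp
    ring
  · obtain ⟨h1, h2⟩ := tendsto_profile_atBot hα hW hW₁ hlog hup
    have h3 : Tendsto ρ atBot (𝓝 (1 / 8 + (Real.exp (2 * Real.log α)
        - 2 * α * Real.exp (Real.log α) + 2 * (0 * Real.exp (-Real.log α)) - 0 ^ 2) / 2)) := by
      have h4 : ρ = fun x => 1 / 8 + (Real.exp (2 * W x) - 2 * α * Real.exp (W x)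
          + 2 * (Real.exp x * Real.exp (-W x)) - W₁ x ^ 2) / 2 := by
        simp only [hρ, sub_eq_add_neg, Real.exp_add]
      rw [h4]
      have hE := Real.continuous_exp
      exact tendsto_const_nhds.add <| Tendsto.div_const ((((hE.tendsto _).comp
        (h1.const_mul 2)).sub (((hE.tendsto _).comp h1).const_mul (2 * α))).add
        ((Real.tendsto_exp_atBot.mul ((hE.tendsto _).comp h1.neg)).const_mul 2) |>.sub
        (h2.pow 2)) 2
    rw [exp_profile_sq, Real.exp_log hα] at h3
    rw [show (1 - 4 * α ^ 2) / 8 = 1 / 8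
      + (α ^ 2 - 2 * α * α + 2 * (0 * Real.exp (-Real.log α)) - 0 ^ 2) / 2 by ring]
    exact h3.comp Real.tendsto_log_nhdsGT_zero
  · obtain ⟨M, hM, hMb⟩ := exists_abs_deriv_profile_le hα hW hW₁ hlow hup
    refine ⟨1 / 8 + (3 * (α + 1) ^ 2 + 2 * α * (α + 1) + M ^ 2) / 2, by positivity, 1, one_pos,
      fun s hs => ?_⟩
    have hs0 : 0 < s := by linarith
    obtain ⟨x, rfl⟩ : ∃ x, Real.exp x = s := ⟨_, Real.exp_log hs0⟩
    have hx : 0 ≤ x := Real.one_le_exp_iff.1 hs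
    have hD : W₁ x ^ 2 ≤ M ^ 2 := sq_le_sq' (neg_le_of_abs_le (hMb x hx)) (le_of_abs_le (hMb x hx))
    have hZl : Real.exp (x / 3) ≤ Real.exp (W x) := Real.exp_le_exp.2 (hlow x)
    have hZu : Real.exp (W x) ≤ Real.exp (x / 3) + (α + 1) :=
      (Real.le_log_iff_exp_le (by positivity)).1 (hup x)
    have e1 : Real.exp x ^ ((1 : ℝ) / 3) = Real.exp (x / 3) := by
      rw [← Real.exp_mul]
      ring_nf
    have e2 : Real.exp x ^ ((2 : ℝ) / 3) = Real.exp (x / 3) ^ 2 := by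
      rw [← Real.exp_mul, ← exp_profile_sq]
      ring_nf
    have e3 : Real.exp x = Real.exp (x / 3) ^ 3 := by
      rw [← Real.exp_nat_mul]
      congr 1
      push_cast
      ring
    have hσ := Real.exp_pos (x / 3)
    have hZ := Real.exp_pos (W x)
    rw [e1, e2]
    simp only [hρ, Real.log_exp, exp_profile_sq, Real.exp_sub]
    rw [e3]
    generalize Real.exp (x / 3) = σ at *
    generalize Real.exp (W x) = Z at *
    have key : 1 / 8 + (Z ^ 2 - 2 * α * Z + 2 * (σ ^ 3 / Z) - W₁ x ^ 2) / 2
        - (3 / 2 * σ ^ 2 - α * σ)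
        = 1 / 8 + ((Z - σ) ^ 2 * (1 + 2 * (σ / Z)) - 2 * α * (Z - σ) - W₁ x ^ 2) / 2 := by
      field_simp
      ring
    rw [key]
    have hq : σ / Z ≤ 1 := (div_le_one hZ).2 hZl
    have hq0 : 0 ≤ σ / Z := by positivity
    have hc : (Z - σ) ^ 2 ≤ (α + 1) ^ 2 := by
      have : 0 ≤ Z - σ := by linarith
      gcongr
      linarith
    have hcq : (Z - σ) ^ 2 * (1 + 2 * (σ / Z)) ≤ (α + 1) ^ 2 * 3 := by
      gcongr
      linarith
    have hcq0 : 0 ≤ (Z - σ) ^ 2 * (1 + 2 * (σ / Z)) := by positivity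
    have hαc : α * (Z - σ) ≤ α * (α + 1) := by
      gcongr
      linarith
    have hαc0 : 0 ≤ α * (Z - σ) := mul_nonneg hα.le (by linarith)
    have hd0 := sq_nonneg (W₁ x)
    have hp : 0 < α * (α + 1) := by positivity
    have hp2 : 0 < (α + 1) ^ 2 := by positivity
    have hM2 := sq_nonneg M
    rw [abs_le]
    constructor <;> linarith

end ThirdOrder

/-- Fix `α > 0` and `d > 0`. There exist a smooth solution `r` of the
third-order ODE with the prescribed boundary behavior, and constants `C > 0`, `N ∈ ℕ`,
such that for every `n ≥ N` and `t ∈ (0,d]`, writing `s = 2nt`,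
`α_n(t) = 2n + α + 1 + (s r'(s)/(2n))(1 + ε_n(t))` with `|ε_n(t)| ≤ C n^{-1/3}`. -/
theorem recurrence_alpha_asymptotics
    (α d : ℝ) (hα : 0 < α) (hd : 0 < d)
    (P : ℕ → ℝ → ℝ → ℝ) (h : ℕ → ℝ → ℝ) (A B : ℕ → ℝ → ℝ)
    (hmonic : ∀ m : ℕ, ∀ τ > (0:ℝ), ∃ p : Polynomial ℝ,
      p.Monic ∧ p.natDegree = m ∧ ∀ x, P m τ x = p.eval x)
    (horth : ∀ j k : ℕ, ∀ τ > (0:ℝ),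
      (∫ x in Ioi (0:ℝ), P j τ x * P k τ x * pertLagWeight α τ x)
        = if j = k then h j τ else 0)
    (hpos : ∀ j : ℕ, ∀ τ > (0:ℝ), 0 < h j τ)
    (hrec : ∀ m : ℕ, 1 ≤ m → ∀ τ > (0:ℝ), ∀ x : ℝ,
      x * P m τ x = P (m + 1) τ x + A m τ * P m τ x + B m τ * P (m - 1) τ x) :
    ∃ r : ℝ → ℝ,
      (∀ s > (0:ℝ), ContDiffAt ℝ (⊤ : ℕ∞) r s) ∧
      (∀ s > (0:ℝ),
        2 * s ^ 2 * deriv r s * deriv (deriv (deriv r)) s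
          - s ^ 2 * (deriv (deriv r) s) ^ 2
          + 2 * s * deriv r s * deriv (deriv r) s
          - 4 * s * (deriv r s) ^ 3
          + (2 * r s - 1 / 4) * (deriv r s) ^ 2 + 1 = 0) ∧
      Tendsto r (𝓝[>] (0:ℝ)) (𝓝 ((1 - 4 * α ^ 2) / 8)) ∧
      (∃ M > (0:ℝ), ∃ s₁ > (0:ℝ), ∀ s ≥ s₁,
        |r s - ((3 / 2) * s ^ ((2:ℝ) / 3) - α * s ^ ((1:ℝ) / 3))| ≤ M) ∧
      ∃ C > (0:ℝ), ∃ N : ℕ, ∀ n ≥ N, ∀ t ∈ Ioc (0:ℝ) d,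
        ∃ ε : ℝ, |ε| ≤ C * (n : ℝ) ^ (-(1:ℝ) / 3) ∧
          A n t = 2 * n + α + 1 +
            (2 * (n : ℝ) * t * deriv r (2 * n * t)) / (2 * n) * (1 + ε) := by
  choose! Q hQmonic hQdeg hQP using hmonic
  have H : ∀ τ > 0, IsMonicOrthogonal (pertLagFunctional α τ) (Q · τ) (h · τ) := fun τ hτ =>
    { monic := fun m => hQmonic m τ hτ
      natDegree := fun m => hQdeg m τ hτ
      orth := fun j k => by
        rw [← horth j k τ hτ, ← (integrableOn_eval_mul_pertLagWeight (by linarith) hτ _).2]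
        simp only [Polynomial.eval_mul, hQP _ τ hτ]
      pos := fun j => hpos j τ hτ }
  have hQrec : ∀ m : ℕ, 1 ≤ m → ∀ τ > (0 : ℝ), Polynomial.X * Q m τ
      = Q (m + 1) τ + Polynomial.C (A m τ) * Q m τ + Polynomial.C (B m τ) * Q (m - 1) τ :=
    fun m hm τ hτ => Polynomial.funext fun x => by
      simpa [hQP _ τ hτ] using hrec m hm τ hτ x
  have hprof : ∀ n : ℕ, 1 ≤ n → ∃ f f₁ f₂ : ℝ → ℝ, IsLogProfile α n f f₁ f₂ ∧
      ∀ t > 0, A n t = 2 * n + 1 + α + t * Real.exp (-f (Real.log (2 * n * t))) := by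
    intro n hn
    obtain ⟨R, r, hRr⟩ := exists_ladder_system hα H hQrec hn
    obtain ⟨f, f₁, f₂, hf, hRf⟩ := exists_log_profile hα hn (fun t ht => (hRr t ht).1)
      (fun t ht => (hRr t ht).2.1) (fun t ht => (hRr t ht).2.2.1)
      (fun t ht => (hRr t ht).2.2.2.1) (fun t ht => (hRr t ht).2.2.2.2.1)
    exact ⟨f, f₁, f₂, hf, fun t ht => by rw [(hRr t ht).2.2.2.2.2, hRf t ht]⟩
  choose! f f₁ f₂ hf hA using hprof
  obtain ⟨W, W₁, hW, hW₁, hlog, hup, hconv⟩ := exists_limit_profile hα hf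
  obtain ⟨r, hsmooth, hode, hzero, hinf, hderiv⟩ := exists_third_order_solution hα hW hW₁ hlog
    (div_three_le_of_le_limitForce hα hW hW₁ hlog fun _ => le_rfl) hup
  refine ⟨r, hsmooth, hode, hzero, hinf, ?_⟩
  obtain ⟨C, hC, hbound⟩ := hconv d hd
  have hlim : Tendsto (fun n : ℕ => C * (n : ℝ) ^ (-(1 : ℝ) / 3)) atTop (𝓝 (C * 0)) := by
    have h1 := (tendsto_rpow_neg_atTop (show (0 : ℝ) < 1 / 3 by norm_num)).comp
      tendsto_natCast_atTop_atTop
    simpa only [neg_div, Function.comp_apply] using h1.const_mul C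
  rw [mul_zero] at hlim
  obtain ⟨N, hN⟩ := eventually_atTop.1 (hlim.eventually_le_const one_pos)
  refine ⟨2 * C, by positivity, N + 1, fun n hn t ht => ?_⟩
  have hn1 : 1 ≤ n := by omega
  have hn0 : (0 : ℝ) < n := by exact_mod_cast hn1
  have ht0 : 0 < t := ht.1
  set x := Real.log (2 * n * t) with hx
  have hfW : |f n x - W x| ≤ C * (n : ℝ) ^ (-(1 : ℝ) / 3) := hbound n hn1 x <|
    Real.log_le_log (by positivity) (by have := ht.2; gcongr)
  refine ⟨Real.exp (W x - f n x) - 1, ?_, ?_⟩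
  · rw [abs_sub_comm] at hfW
    have h1 := Real.abs_exp_sub_one_le (hfW.trans (hN n (by omega)))
    linarith
  · rw [hderiv _ (by positivity), hA n hn1 t ht0, ← hx, add_sub_cancel, mul_assoc _ t,
      mul_div_cancel_left₀ _ (by positivity), mul_assoc t, ← Real.exp_add, neg_add_eq_sub,
      sub_sub_cancel_left]
    ring
end
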